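/- arXiv:2307.12829 — 6 statements merged into one kernel-verified Lean document; each statement's English description precedes it below -/
import Mathlib

section
/- There exists a constant Q such that for every power of two q = 2^e with q ≥ Q, every finite field F with q^6 elements, and every c ∈ 𝔠, the map f_c : F → F defined by f_c(x) = x^q + x^{q^3} + c·x^{q^5} is scattered. -/
noncomputable section

def F1 (q : ℕ) {F : Type*} [Field F] (c : F) : F :=
  c ^ (q ^ 4 + 2 * q ^ 3 + q ^ 2 + q + 1) + c ^ (q ^ 4 + q ^ 3 + q ^ 2 + 1)
    + c ^ (q ^ 3 + q + 1) + c + c ^ (2 * q ^ 3 + q ^ 2 + q) + c ^ (q ^ 3 + q ^ 2 + q)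
    + c ^ (q ^ 3) + 1

def F2 (q : ℕ) {F : Type*} [Field F] (c : F) : F :=
  c ^ (q ^ 3 + q ^ 2 + 2 * q + 2) + c ^ (q ^ 2 + q + 2) + c ^ (q ^ 3 + 2 * q ^ 2 + 2 * q + 1)
    + c ^ (2 * q ^ 3 + 2 * q ^ 2 + q + 1) + c ^ (q ^ 2 + q + 1) + c ^ (q ^ 3 + q + 1)
    + c ^ (q ^ 3 + q ^ 2 + 1) + c + c ^ (2 * q ^ 3 + q ^ 2 + q) + c ^ (q ^ 3 + q ^ 2 + q)
    + c ^ (q ^ 3) + 1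

def F3 (q : ℕ) {F : Type*} [Field F] (c : F) : F := c ^ (q ^ 2 + q + 1) + 1

def F4 (q : ℕ) {F : Type*} [Field F] (c : F) : F :=
  c ^ (2 * q ^ 2 + q + 4) + c ^ (3 * q ^ 2 + 2 * q + 3) + c ^ (q ^ 2 + 2 * q + 3)
    + c ^ (3 * q ^ 2 + q + 3) + c ^ (q ^ 2 + q + 3) + c ^ (2 * q ^ 2 + 3) + c ^ (q ^ 2 + 3)
    + c ^ (4 * q ^ 2 + q + 2) + c ^ (q + 2) + c ^ (3 * q ^ 2 + 2) + c ^ 2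
    + c ^ (3 * q ^ 2 + 2 * q + 1) + c ^ (q ^ 2 + 2 * q + 1) + c ^ (3 * q ^ 2 + q + 1)
    + c ^ (q ^ 2 + q + 1) + c ^ (3 * q ^ 2 + 1) + c + c ^ (2 * q ^ 2 + q) + c ^ (2 * q ^ 2)
    + c ^ (q ^ 2)

def F5 (q : ℕ) {F : Type*} [Field F] (c : F) : F :=
  c ^ (2 * q ^ 2 + q + 2) + c ^ (q ^ 2 + q + 2) + c ^ (2 * q ^ 2 + 2)
    + c ^ (2 * q ^ 2 + q + 1) + c ^ (q ^ 2 + q + 1) + 1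

def frakC (q : ℕ) (F : Type*) [Field F] : Set F :=
  {c | c ^ (q ^ 2) ≠ c ∧ F1 q c = 0 ∧ F2 q c = 0 ∧ F3 q c * F4 q c * F5 q c ≠ 0}

def IsScattered (q : ℕ) {F : Type*} [Field F] (f : F → F) : Prop :=
  ∀ y z : F, y ≠ 0 → z ≠ 0 → f y * z = f z * y → ∃ l : F, l ^ q = l ∧ y = l * z


section helpers

variable {F : Type} [Field F] [CharP F 2]

/-- `F1 = F2 = 0` forces the collinearity relation. -/
theorem aux_A (c0 c1 c2 c3 c4 : F) (h0 : c0 ≠ 0) (h2 : c2 ≠ 0) (h3 : c3 ≠ 0)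
    (h13 : c1 * c3 + 1 ≠ 0)
    (hF1 : c4 * c3 ^ 2 * c2 * c1 * c0 + c4 * c3 * c2 * c0 + c3 * c1 * c0 + c0
      + c3 ^ 2 * c2 * c1 + c3 * c2 * c1 + c3 + 1 = 0)
    (hF2 : c3 * c2 * c1 ^ 2 * c0 ^ 2 + c2 * c1 * c0 ^ 2 + c3 * c2 ^ 2 * c1 ^ 2 * c0
      + c3 ^ 2 * c2 ^ 2 * c1 * c0 + c2 * c1 * c0 + c3 * c1 * c0 + c3 * c2 * c0 + c0
      + c3 ^ 2 * c2 * c1 + c3 * c2 * c1 + c3 + 1 = 0) :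
    c0 * c2 * c4 * (c1 + c3) + c0 * (1 + c1) + c4 * (1 + c3) = 0 := by
  have two : (2 : F) = 0 := CharTwo.two_eq_zero
  have h : (c0 * c2 * c3 * (c1 * c3 + 1)) *
      (c0 * c2 * c4 * (c1 + c3) + c0 * (1 + c1) + c4 * (1 + c3)) = 0 := by
    clear h0 h2 h3 h13
    have key : (c0 * c2 * c3 * (c1 * c3 + 1)) *
      (c0 * c2 * c4 * (c1 + c3) + c0 * (1 + c1) + c4 * (1 + c3)) =
      (c0 * c2 * (c1 + c3) + 1 + c3) *
        (c4 * c3 ^ 2 * c2 * c1 * c0 + c4 * c3 * c2 * c0 + c3 * c1 * c0 + c0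
      + c3 ^ 2 * c2 * c1 + c3 * c2 * c1 + c3 + 1) + (1 + c3) *
        (c3 * c2 * c1 ^ 2 * c0 ^ 2 + c2 * c1 * c0 ^ 2 + c3 * c2 ^ 2 * c1 ^ 2 * c0
      + c3 ^ 2 * c2 ^ 2 * c1 * c0 + c2 * c1 * c0 + c3 * c1 * c0 + c3 * c2 * c0 + c0
      + c3 ^ 2 * c2 * c1 + c3 * c2 * c1 + c3 + 1) := by
      clear hF1 hF2
      grind
    rw [key, hF1, hF2]; ring
  rcases mul_eq_zero.1 h with h | h
  · exact absurd h (by simp [h0, h2, h3, h13])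
  · exact h

/-- `N = 1` together with collinearity contradicts `F3 F5 ≠ 0`. -/
theorem aux_N (c0 c1 c2 c3 c4 c5 : F) (d1 : c1 + 1 ≠ 0) (d3 : c3 + 1 ≠ 0) (d4 : c4 + 1 ≠ 0)
    (hN : c0 * c2 * c4 = 1) (hM : c1 * c3 * c5 = 1)
    (A0 : (c0 + 1) * (c1 + 1) = (c3 + 1) * (c4 + 1))
    (A5 : (c5 + 1) * (c0 + 1) = (c2 + 1) * (c3 + 1))
    (hF3 : c2 * c1 * c0 + 1 ≠ 0)
    (hF5 : c2 ^ 2 * c1 * c0 ^ 2 + c2 * c1 * c0 ^ 2 + c2 ^ 2 * c0 ^ 2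
      + c2 ^ 2 * c1 * c0 + c2 * c1 * c0 + 1 ≠ 0) : False := by
  have two : (2 : F) = 0 := CharTwo.two_eq_zero
  obtain ⟨r, hr⟩ : ∃ r, c0 + 1 = r * (c3 + 1) := ⟨(c0 + 1) / (c3 + 1), by field_simp⟩
  have e4 : c4 + 1 = r * (c1 + 1) := by
    apply mul_left_cancel₀ d3
    rw [← A0, hr]; ring
  have e2 : c2 + 1 = r * (c5 + 1) := by
    apply mul_right_cancel₀ d3
    rw [← A5, hr]; ring
  obtain ⟨x, hx⟩ : ∃ x, x = c3 + 1 := ⟨_, rfl⟩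
  obtain ⟨y, hy⟩ : ∃ y, y = c5 + 1 := ⟨_, rfl⟩
  obtain ⟨w, hw⟩ : ∃ w, w = c1 + 1 := ⟨_, rfl⟩
  have k3 : c3 = x + 1 := by linear_combination -hx - two
  have k5 : c5 = y + 1 := by linear_combination -hy - two
  have k1 : c1 = w + 1 := by linear_combination -hw - two
  have k0 : c0 = r * x + 1 := by linear_combination hr - r * hx - two
  have k2 : c2 = r * y + 1 := by linear_combination e2 - r * hy - two
  have k4 : c4 = r * w + 1 := by linear_combination e4 - r * hw - two
  rw [← hx] at d3
  rw [← hw] at d1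
  have hr0 : r ≠ 0 := by rintro rfl; apply d4; rw [e4]; ring
  subst k3 k5 k1 k0 k2 k4
  have m1 : (x + y + w) + (x * y + x * w + y * w) + x * y * w = 0 := by
    linear_combination hM
  have m2 : (x + y + w) + r * (x * y + x * w + y * w) + r ^ 2 * (x * y * w) = 0 := by
    apply mul_left_cancel₀ hr0
    linear_combination hN
  by_cases h1 : r = 1
  · subst h1
    apply hF3
    linear_combination hN + two
  · have h1' : r + 1 ≠ 0 := by
      intro h; apply h1; linear_combination h - two
    have m3 : (x * y + x * w + y * w) + (r + 1) * (x * y * w) = 0 := by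
      apply mul_left_cancel₀ h1'
      linear_combination m2 + m1 - (x + y + w - x * y * w * r) * two
    have m4 : (x + y + w) = r * (x * y * w) := by
      linear_combination m1 - m3
    apply hF5
    have hc4 : r * w + 1 ≠ 0 := by
      intro h; rw [h] at hN; simp at hN
    have g : (r * w + 1) ^ 2 * ((r * y + 1) ^ 2 * (w + 1) * (r * x + 1) ^ 2
        + (r * y + 1) * (w + 1) * (r * x + 1) ^ 2 + (r * y + 1) ^ 2 * (r * x + 1) ^ 2
        + (r * y + 1) ^ 2 * (w + 1) * (r * x + 1) + (r * y + 1) * (w + 1) * (r * x + 1) + 1)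
        = (w + 1) * (r * w + 1) * (r * x) * (r * y) + (r * w) ^ 2 := by
      obtain ⟨a, ha⟩ : ∃ a, a = r * x + 1 := ⟨_, rfl⟩
      obtain ⟨b, hb⟩ : ∃ b, b = r * y + 1 := ⟨_, rfl⟩
      obtain ⟨d, hd⟩ : ∃ d, d = r * w + 1 := ⟨_, rfl⟩
      have ka : r * x = a + 1 := by linear_combination -ha - two
      have kb : r * y = b + 1 := by linear_combination -hb - two
      have kd : r * w = d + 1 := by linear_combination -hd - two
      rw [← ha, ← hb, ← hd] at hN ⊢
      rw [ka, kb, kd]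
      have key : d ^ 2 * (b ^ 2 * (w + 1) * a ^ 2 + b * (w + 1) * a ^ 2 + b ^ 2 * a ^ 2
        + b ^ 2 * (w + 1) * a + b * (w + 1) * a + 1)
        = (w + 1) * d * (a * b * d) * (a + 1) * (b + 1) + (a * b * d + d) ^ 2 := by
        clear m1 m2 m3 m4 hN hM hF3 hF5 A0 A5 hc4 hr e4 e2 ka kb kd ha hb hd
        grind
      rw [key, hN]; ring
    have g2 : w * ((w + 1) * (r * w + 1) * (r * x) * (r * y) + (r * w) ^ 2) = 0 := by
      have key : w * ((w + 1) * (r * w + 1) * (r * x) * (r * y) + (r * w) ^ 2)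
        = r ^ 2 * (((x + y + w) - r * (x * y * w)) * w ^ 2
          + ((x * y + x * w + y * w) + (r + 1) * (x * y * w)) * w) := by
        clear g m1 m2 m3 m4 hN hM hF3 hF5 A0 A5 hc4 hr e4 e2
        grind
      rw [key, m3, m4]; ring
    have g3 := (mul_eq_zero.1 g2).resolve_left d1
    rw [g3] at g
    exact (mul_eq_zero.1 g).resolve_left (pow_ne_zero 2 hc4)

theorem aux_det (c0 c2 c4 l0 l1 l2 l3 l4 l5 z1 z3 z5 : F) (hz : z1 ≠ 0)
    (R1 : (l1 + l0) * z1 + (l3 + l0) * z3 + c0 * (l5 + l0) * z5 = 0)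
    (R2 : (l3 + l2) * z3 + (l5 + l2) * z5 + c2 * (l1 + l2) * z1 = 0)
    (R3 : (l5 + l4) * z5 + (l1 + l4) * z1 + c4 * (l3 + l4) * z3 = 0) :
    (l0 + l1) * (l2 + l3) * (l4 + l5) + (l0 + l3) * (l2 + l5) * (l4 + l1)
    + c0 * c2 * c4 * ((l0 + l5) * (l2 + l1) * (l4 + l3))
    + c4 * ((l0 + l1) * (l2 + l5) * (l3 + l4)) + c0 * ((l2 + l3) * (l4 + l1) * (l0 + l5))
    + c2 * ((l4 + l5) * (l0 + l3) * (l1 + l2)) = 0 := by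
  have two : (2 : F) = 0 := CharTwo.two_eq_zero
  apply mul_right_cancel₀ hz
  linear_combination
    ((l3 + l2) * (l5 + l4) - (l5 + l2) * c4 * (l3 + l4)) * R1
    + (-(l3 + l0) * (l5 + l4) + c0 * (l5 + l0) * c4 * (l3 + l4)) * R2
    + ((l3 + l0) * (l5 + l2) - c0 * (l5 + l0) * (l3 + l2)) * R3
    + (c4 * ((l0 + l1) * (l2 + l5) * (l3 + l4)) + c0 * ((l2 + l3) * (l4 + l1) * (l0 + l5))
    + c2 * ((l4 + l5) * (l0 + l3) * (l1 + l2))) * z1 * two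

theorem aux_main (s : F →+* F) (hs : ∀ x, s (s (s (s (s (s x))))) = x)
    (c c1 c2 c3 c4 c5 : F) (e1 : s c = c1) (e2 : s c1 = c2) (e3 : s c2 = c3) (e4 : s c3 = c4)
    (e5 : s c4 = c5) (hc : c2 ≠ c)
    (hF1 : c4 * c3 ^ 2 * c2 * c1 * c + c4 * c3 * c2 * c + c3 * c1 * c + c
      + c3 ^ 2 * c2 * c1 + c3 * c2 * c1 + c3 + 1 = 0)
    (hF2 : c3 * c2 * c1 ^ 2 * c ^ 2 + c2 * c1 * c ^ 2 + c3 * c2 ^ 2 * c1 ^ 2 * c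
      + c3 ^ 2 * c2 ^ 2 * c1 * c + c2 * c1 * c + c3 * c1 * c + c3 * c2 * c + c
      + c3 ^ 2 * c2 * c1 + c3 * c2 * c1 + c3 + 1 = 0)
    (hF3 : c2 * c1 * c + 1 ≠ 0)
    (hF5 : c2 ^ 2 * c1 * c ^ 2 + c2 * c1 * c ^ 2 + c2 ^ 2 * c ^ 2
      + c2 ^ 2 * c1 * c + c2 * c1 * c + 1 ≠ 0)
    (l z : F) (hz : z ≠ 0)
    (h : s (l * z) + s (s (s (l * z))) + c * s (s (s (s (s (l * z))))) =
      l * (s z + s (s (s z)) + c * s (s (s (s (s z)))))) : s l = l := by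
  have two : (2 : F) = 0 := CharTwo.two_eq_zero
  have inj : Function.Injective s := s.injective
  have e6 : s c5 = c := by rw [← e5, ← e4, ← e3, ← e2, ← e1]; exact hs c
  have nz : ∀ x, x ≠ 0 → s x ≠ 0 := fun x hx => (map_ne_zero s).2 hx
  have h00 : c ≠ 0 := by
    rintro rfl
    apply hc; rw [← e2, ← e1]; simp
  have h01 : c + 1 ≠ 0 := by
    intro h1
    have : c = 1 := by linear_combination h1 - two
    subst this
    apply hc; rw [← e2, ← e1]; simp
  have h10 := nz _ h00
  rw [e1] at h10
  have h20 := nz _ h10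
  rw [e2] at h20
  have h30 := nz _ h20
  rw [e3] at h30
  have hd1 : c1 + 1 ≠ 0 := by simpa [e1] using nz _ h01
  have hd2 : c2 + 1 ≠ 0 := by simpa [e2] using nz _ hd1
  have hd3 : c3 + 1 ≠ 0 := by simpa [e3] using nz _ hd2
  have hd4 : c4 + 1 ≠ 0 := by simpa [e4] using nz _ hd3
  have h13 : c1 * c3 + 1 ≠ 0 := by
    intro k1
    have k2 := congrArg s k1
    simp only [map_add, map_mul, map_one, map_zero, e1, e2, e3, e4, e5, e6] at k2
    have k3 := congrArg s k2
    simp only [map_add, map_mul, map_one, map_zero, e1, e2, e3, e4, e5, e6] at k3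
    have k4 := congrArg s k3
    simp only [map_add, map_mul, map_one, map_zero, e1, e2, e3, e4, e5, e6] at k4
    have k5 := congrArg s k4
    simp only [map_add, map_mul, map_one, map_zero, e1, e2, e3, e4, e5, e6] at k5
    have k6 := congrArg s k5
    simp only [map_add, map_mul, map_one, map_zero, e1, e2, e3, e4, e5, e6] at k6
    have h40 : c4 ≠ 0 := by
      have := nz _ h30
      rwa [e4] at this
    apply hc
    apply mul_left_cancel₀ h40
    linear_combination k2 - k4
  have A0 := aux_A c c1 c2 c3 c4 h00 h20 h30 h13 hF1 hF2
  have A1 := congrArg s A0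
  simp only [map_add, map_mul, map_one, map_zero, e1, e2, e3, e4, e5, e6] at A1
  have A2 := congrArg s A1
  simp only [map_add, map_mul, map_one, map_zero, e1, e2, e3, e4, e5, e6] at A2
  have A3 := congrArg s A2
  simp only [map_add, map_mul, map_one, map_zero, e1, e2, e3, e4, e5, e6] at A3
  have A4 := congrArg s A3
  simp only [map_add, map_mul, map_one, map_zero, e1, e2, e3, e4, e5, e6] at A4
  have A5 := congrArg s A4
  simp only [map_add, map_mul, map_one, map_zero, e1, e2, e3, e4, e5, e6] at A5
  -- `N ≠ 1`
  have hN : c * c2 * c4 ≠ 1 := by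
    intro hN
    have hM := congrArg s hN
    simp only [map_mul, map_one, e1, e3, e5] at hM
    refine aux_N c c1 c2 c3 c4 c5 hd1 hd3 hd4 hN hM ?_ ?_ hF3 hF5
    · linear_combination A0 - (c1 + c3) * hN - (c3 * c4 + c4 + c3) * two
    · linear_combination A5 - (c + c2) * hM - (c2 * c3 + c2 + c3) * two
  -- reset of the conjugates of `l` and `z`
  obtain ⟨l1, f1⟩ : ∃ x, s l = x := ⟨_, rfl⟩
  obtain ⟨l2, f2⟩ : ∃ x, s l1 = x := ⟨_, rfl⟩
  obtain ⟨l3, f3⟩ : ∃ x, s l2 = x := ⟨_, rfl⟩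
  obtain ⟨l4, f4⟩ : ∃ x, s l3 = x := ⟨_, rfl⟩
  obtain ⟨l5, f5⟩ : ∃ x, s l4 = x := ⟨_, rfl⟩
  have f6 : s l5 = l := by rw [← f5, ← f4, ← f3, ← f2, ← f1]; exact hs l
  obtain ⟨z1, g1⟩ : ∃ x, s z = x := ⟨_, rfl⟩
  obtain ⟨z2, g2⟩ : ∃ x, s z1 = x := ⟨_, rfl⟩
  obtain ⟨z3, g3⟩ : ∃ x, s z2 = x := ⟨_, rfl⟩
  obtain ⟨z4, g4⟩ : ∃ x, s z3 = x := ⟨_, rfl⟩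
  obtain ⟨z5, g5⟩ : ∃ x, s z4 = x := ⟨_, rfl⟩
  have g6 : s z5 = z := by rw [← g5, ← g4, ← g3, ← g2, ← g1]; exact hs z
  have hz1 := nz _ hz
  rw [g1] at hz1
  simp only [map_mul, f1, f2, f3, f4, f5, g1, g2, g3, g4, g5] at h
  have R1 : (l1 + l) * z1 + (l3 + l) * z3 + c * (l5 + l) * z5 = 0 := by
    linear_combination h + l * (z1 + z3 + c * z5) * two
  have R2 := congrArg s (congrArg s R1)
  simp only [map_add, map_mul, map_zero, e1, e2, f1, f2, f3, f4, f5, f6,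
    g1, g2, g3, g4, g5, g6] at R2
  have R3 := congrArg s (congrArg s R2)
  simp only [map_add, map_mul, map_zero, e3, e4, f1, f2, f3, f4, f5, f6,
    g1, g2, g3, g4, g5, g6] at R3
  have E1 := aux_det c c2 c4 l l1 l2 l3 l4 l5 z1 z3 z5 hz1 R1 R2 R3
  have E2 := congrArg s E1
  simp only [map_add, map_mul, map_zero, e1, e2, e3, e4, e5, f1, f2, f3, f4, f5, f6] at E2
  -- it suffices that one difference vanishes
  by_contra hl
  have n1 : l1 ≠ l := fun h => hl (f1.trans h)
  have dd : ∀ a b : F, a ≠ b → a + b ≠ 0 := by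
    intro a b hab h; apply hab; linear_combination h - b * two
  have hx0 : c3 + c5 ≠ 0 := by
    have h := nz _ (nz _ (nz _ (dd _ _ hc)))
    simp only [map_add, e1, e2, e3, e4, e5] at h
    rwa [add_comm] at h
  have hN1 := dd _ _ hN
  have hX : c3 + c5 + (c + c2) + (c * c5 + c2 * c3) ≠ 0 := by
    intro h
    apply mul_ne_zero hx0 hN1
    linear_combination A2 - h + (c3 + c5) * two
  have hD : c4 * (c3 + c5) + c1 * (c + c2) + (c * c5 + c2 * c3) = 0 := by
    linear_combination A0 + A2 + A4
      - (c * c2 * c4 * (c1 + c3 + c5) + c + c2 + c4) * two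
  have hr : (c3 + c5 + (c + c2) + (c * c5 + c2 * c3)) *
      ((l + l3) * (l2 + l5) * (l4 + l1)) = 0 := by
    have E0 : (l + l1) * (l2 + l3) * (l4 + l5) + (l + l3) * (l2 + l5) * (l4 + l1)
        + (l + l5) * (l2 + l1) * (l4 + l3) + (l + l1) * (l2 + l5) * (l3 + l4)
        + (l2 + l3) * (l4 + l1) * (l + l5) + (l4 + l5) * (l + l3) * (l1 + l2) = 0 := by
      clear * - two
      grind
    obtain ⟨p, hp⟩ : ∃ p, p = (l + l1) * (l2 + l3) * (l4 + l5) := ⟨_, rfl⟩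
    obtain ⟨r, hr⟩ : ∃ r, r = (l + l3) * (l2 + l5) * (l4 + l1) := ⟨_, rfl⟩
    obtain ⟨t, ht⟩ : ∃ t, t = (l + l5) * (l2 + l1) * (l4 + l3) := ⟨_, rfl⟩
    obtain ⟨u, hu⟩ : ∃ u, u = (l + l1) * (l2 + l5) * (l3 + l4) := ⟨_, rfl⟩
    obtain ⟨v, hv⟩ : ∃ v, v = (l2 + l3) * (l4 + l1) * (l + l5) := ⟨_, rfl⟩
    obtain ⟨w, hw⟩ : ∃ w, w = (l4 + l5) * (l + l3) * (l1 + l2) := ⟨_, rfl⟩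
    have E2' : t + r + c1 * c3 * c5 * p + c5 * w + c1 * u + c3 * v = 0 := by
      rw [hp, hr, ht, hu, hv, hw]
      linear_combination E2
    rw [← hp, ← hr, ← ht, ← hu, ← hv, ← hw] at E0 E1
    rw [← hr]
    linear_combination (c3 + c5) * E1 + (c + c2) * E2' + (c * c5 + c2 * c3) * E0
      - p * A5 - t * A2 - u * hD
      - v * (c * c3 + c * c5 + c2 * c3) * two - w * (c2 * c5 + c2 * c3 + c * c5) * two
  have hr' := (mul_eq_zero.1 hr).resolve_left hX
  have z0 : ∀ a b : F, a + b = 0 → a = b := by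
    intro a b h; linear_combination h - b * two
  have h3 : l3 = l := by
    rcases mul_eq_zero.1 hr' with h | h
    · rcases mul_eq_zero.1 h with h | h
      · exact (z0 _ _ h).symm
      · have h' := z0 _ _ h
        rw [← f2, ← f1, ← f5, ← f4] at h'
        exact (inj (inj h')).symm
    · have h' := z0 _ _ h
      rw [← f1, ← f4] at h'
      exact inj h'
  have h4 : l4 = l1 := by rw [← f4, h3, f1]
  have h5 : l5 = l2 := by rw [← f5, h4, f2]
  subst h3 h4 h5
  have hp : (c * c2 * c4 + 1) * ((l3 + l4) * (l5 + l3) * (l4 + l5)) = 0 := by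
    clear * - two E1
    grind
  have hp' := (mul_eq_zero.1 hp).resolve_left hN1
  rcases mul_eq_zero.1 hp' with h | h
  · rcases mul_eq_zero.1 h with h | h
    · exact n1 (z0 _ _ h).symm
    · have h' := z0 _ _ h
      have h'' := congrArg s h'
      rw [f3, f1] at h''
      exact n1 h''.symm
  · have h' := z0 _ _ h
    rw [← f2, ← f1] at h'
    exact n1 ((inj h') ▸ f1.symm ▸ rfl)

end helpers

theorem statement0 :
    ∃ Q : ℕ, ∀ (e q : ℕ), 1 ≤ e → q = 2 ^ e → Q ≤ q →
      ∀ (F : Type) [Field F] [Fintype F], Fintype.card F = q ^ 6 →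
        ∀ c ∈ frakC q F,
          IsScattered q (fun x : F => x ^ q + x ^ (q ^ 3) + c * x ^ (q ^ 5)) := by
  refine ⟨0, ?_⟩
  rintro e q _ rfl _ F _ _ hcard c ⟨hc, h1, h2, h345⟩ y z hy hz h
  have hch : CharP F 2 := by
    have : Fintype.card F = 2 ^ (e * 6) := by rw [hcard, pow_mul]
    exact charP_of_card_eq_prime_pow (f := e * 6) this
  have hexp : ∀ x : F, x ^ (2 ^ e) = iterateFrobenius F 2 e x := fun x => rfl
  obtain ⟨s, hs⟩ : ∃ s : F →+* F, ∀ x, s x = x ^ (2 ^ e) := ⟨iterateFrobenius F 2 e, fun _ => rfl⟩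
  generalize 2 ^ e = q at *
  have p2 : ∀ x, x ^ (q ^ 2) = s (s x) := fun x => by rw [hs, hs, ← pow_mul, pow_two]
  have p3 : ∀ x, x ^ (q ^ 3) = s (s (s x)) := fun x => by
    rw [← p2, hs, ← pow_mul]; congr 1; ring
  have p4 : ∀ x, x ^ (q ^ 4) = s (s (s (s x))) := fun x => by
    rw [← p3, hs, ← pow_mul]; congr 1; ring
  have p5 : ∀ x, x ^ (q ^ 5) = s (s (s (s (s x)))) := fun x => by
    rw [← p4, hs, ← pow_mul]; congr 1; ring
  have p6 : ∀ x, s (s (s (s (s (s x))))) = x := fun x => by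
    rw [← p5, hs, ← pow_mul]
    have := FiniteField.pow_card x
    rw [hcard] at this
    rw [← pow_succ']
    exact this
  have h3 : F3 q c ≠ 0 := fun h => h345 (by rw [h]; ring)
  have h5 : F5 q c ≠ 0 := fun h => h345 (by rw [h]; ring)
  have mm : ∀ (a b : ℕ) , c ^ (a * b) = (c ^ b) ^ a := fun a b => by rw [mul_comm, pow_mul]
  simp only [F1, F2, F3, F5, pow_add, mm, p4, p3, p2, ← hs, pow_one] at h1 h2 h3 h5
  rw [p2] at hc
  simp only [p3, p5, ← hs] at h
  refine ⟨y / z, ?_, by field_simp⟩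
  rw [← hs]
  refine aux_main s p6 c _ _ _ _ _ rfl rfl rfl rfl rfl hc ?_ ?_ ?_ ?_ (y / z) z hz ?_
  · linear_combination h1
  · linear_combination h2
  · convert h3 using 1
  · convert h5 using 1
  · rw [div_mul_cancel₀ y hz]
    field_simp
    linear_combination h
end
end

section
/- There exists a constant Q such that for every power of two q = 2^e with q ≥ Q, every finite field F with q^6 elements, and every c ∈ 𝔠, the map f : F → F defined by f(x) = x^{q^5} + x^{q^3} + c·x^q is scattered. -/
noncomputable section

theorem stepP {F : Type*} [Field F] [CharP F 2] (a b g d h : F)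
    (h1 : h*a*g*d*(b*d+1)+a*b*d+a+b*g*d*d+b*g*d+d+1 = 0)
    (h2 : a*a*b*b*g*d+a*a*b*g+a*b*b*g*g*d+a*b*g*g*d*d+a*b*g+a*b*d+a*g*d+a+b*g*d*d+b*g*d+d+1 = 0)
    (ha : a ≠ 0) (hg : g ≠ 0) (hd : d ≠ 0) (hbd : b*d+1 ≠ 0) :
    h+a+d*h+a*b+a*g*d*h+a*b*g*h = 0 := by
  have hne : a*g*d*(b*d+1) ≠ 0 := mul_ne_zero (mul_ne_zero (mul_ne_zero ha hg) hd) hbd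
  have : a*g*d*(b*d+1) * (h+a+d*h+a*b+a*g*d*h+a*b*g*h) = 0 := by
    clear hne ha hg hd hbd; grind
  exact (mul_eq_zero.mp this).resolve_left hne

/-- The odd conjugates are affine in the even ones. -/
theorem affine_of_P {F : Type*} [Field F] [CharP F 2] (c0 c1 c2 c3 c4 c5 : F)
    (hc0 : c0 ≠ 0) (hc2 : c2 ≠ 0) (hc4 : c4 ≠ 0)
    (hD0 : c0*c2+1 ≠ 0)
    (p0 : c4+c0+c3*c4+c0*c1+c0*c2*c3*c4+c0*c1*c2*c4 = 0)
    (p4 : c2+c4+c1*c2+c4*c5+c4*c0*c1*c2+c4*c5*c0*c2 = 0) :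
    ∃ v m : F, c0*c1*c2+1 = v*(c0*c2+1) ∧ m*(c0*c2*c4) = 1+v ∧
      c1 = v+m*c4 ∧ c3 = v+m*c0 ∧ c5 = v+m*c2 := by
  have hv : c0*c1*c2+1 = (c0*c1*c2+1)/(c0*c2+1)*(c0*c2+1) := by field_simp
  have hs : c0*c2*c4 ≠ 0 := mul_ne_zero (mul_ne_zero hc0 hc2) hc4
  generalize (c0*c1*c2+1)/(c0*c2+1) = v at hv
  have hm : (1+v)/(c0*c2*c4)*(c0*c2*c4) = 1+v := by field_simp
  generalize (1+v)/(c0*c2*c4) = m at hm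
  have e2 : (c0*c2+1)*(c2*c3*c4+1 - v*(c2*c4+1)) = 0 := by grind
  have e2 := (mul_eq_zero.mp e2).resolve_left hD0
  have e4 : (c0*c2+1)*(c4*c5*c0+1 - v*(c4*c0+1)) = 0 := by grind
  have e4 := (mul_eq_zero.mp e4).resolve_left hD0
  refine ⟨v, m, hv, hm, ?_, ?_, ?_⟩
  · apply mul_left_cancel₀ (mul_ne_zero hc0 hc2); grind
  · apply mul_left_cancel₀ (mul_ne_zero hc2 hc4); grind
  · apply mul_left_cancel₀ (mul_ne_zero hc4 hc0); grind

/-- coefficient of `u0² u2`. -/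
theorem coefA {F : Type*} [Field F] [CharP F 2] (a g h v m : F)
    (hs : m*(a*g*h) = 1+v)
    (st : v^3+v^2*m*(a+g+h)+v*m^2*(a*g+g*h+h*a)+m^2*(1+v) = v+m) :
    m*(1+(v+m*g)*a+(v+m*g)*a*(v+m*h)*g+a*g+(v+m*g)+(v+m*g)*a*(v+m*h)) =
      v*((a*g+1)*((v+m*a)*(v+m*g)+1)*((v+m*h)*(v+m*g)+1)) := by
  have h1 : 1+(v+m*g)*a+(v+m*g)*a*(v+m*h)*g+a*g+(v+m*g)+(v+m*g)*a*(v+m*h)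
      = (a*g+1)*(1+v^2+m+m*v+v*m*(g+a*h)) := by grind
  have h2 : v*(((v+m*a)*(v+m*g)+1)*((v+m*h)*(v+m*g)+1)) = m*(1+v^2+m+m*v+v*m*(g+a*h)) := by
    grind
  rw [h1]
  linear_combination (-(a*g+1))*h2

/-- coefficient of `u0² u4`. -/
theorem coefB {F : Type*} [Field F] [CharP F 2] (a g h v m : F)
    (hs : m*(a*g*h) = 1+v)
    (st : v^3+v^2*m*(a+g+h)+v*m^2*(a*g+g*h+h*a)+m^2*(1+v) = v+m) (c1 c3 c5 : F)
    (e1 : c1 = v+m*h) (e3 : c3 = v+m*a) (e5 : c5 = v+m*g) :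
    1+a*c5+a*c3*h*c5+a*h*c5+a+c3*c5 = v*((c3*c5+1)*(a*g+1)*(h*a+1)) := by
  subst e1 e3 e5
  grind

/-- coefficient of `u0 u2 u4`. -/
theorem coefK {F : Type*} [Field F] [CharP F 2] (a g h v m : F)
    (hs : m*(a*g*h) = 1+v)
    (st : v^3+v^2*m*(a+g+h)+v*m^2*(a*g+g*h+h*a)+m^2*(1+v) = v+m) (c1 c3 c5 : F)
    (e1 : c1 = v+m*h) (e3 : c3 = v+m*a) (e5 : c5 = v+m*g) :
    m*(c1*g+c3*h+a*c5+c1*g*c3*h*a*c5+1+g*c3+c1*a+h*c5+c1*c3*c5+a*g*h) = (m+1+v)^2 := by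
  subst e1 e3 e5
  grind

theorem coefX {F : Type*} [Field F] [CharP F 2] (a g h v m : F)
    (hs : m*(a*g*h) = 1+v)
    (st : v^3+v^2*m*(a+g+h)+v*m^2*(a*g+g*h+h*a)+m^2*(1+v) = v+m) (c1 c3 c5 : F)
    (e1 : c1 = v+m*h) (e3 : c3 = v+m*a) (e5 : c5 = v+m*g) :
    v*((c1*c3+1)*(c3*c5+1)*(c5*c1+1)+m^3*((a*g+1)*(g*h+1)*(h*a+1))) = m*(m+1+v)^2 := by
  subst e1 e3 e5
  grind

theorem F5_zero {F : Type*} [Field F] [CharP F 2] (a g h v b : F)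
    (hs : a*g*h = 1) (hv : v ≠ 0) (h1 : a*b*g+1 = v*(a*g+1))
    (hD0 : a*g+1 ≠ 0) (hD2 : g*h+1 ≠ 0) (hD4 : h*a+1 ≠ 0)
    (st : v^2*((a*g+1)*(g*h+1)*(h*a+1))+v*((a*g*h)^2+(a*g+g*h+h*a))+(1+a*g*h) = 0) :
    g^2*b*a^2+g*b*a^2+g^2*a^2+g^2*b*a+g*b*a+1 = 0 := by
  have st' : v*((a*g+1)*(g*h+1)*(h*a+1))+(1+(a*g+g*h+h*a)) = 0 := by
    apply mul_left_cancel₀ hv; grind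
  apply mul_left_cancel₀ (mul_ne_zero (mul_ne_zero hD0 hD2) hD4)
  have : g^2*b*a^2+g*b*a^2+g^2*a^2+g^2*b*a+g*b*a+1 = (a*g+1)^2+ (v*(a*g+1)+1)*(1+a)*(1+g) := by
    clear hv hD0 hD2 hD4 st st'; grind
  rw [this]
  clear hv hD0 hD2 hD4 st this; grind

theorem F4_zero {F : Type*} [Field F] [CharP F 2] (a g h v b : F)
    (hM : a*g*h+a+g+h = 0) (h1 : a*b*g+1 = v*(a*g+1)) (ha : a ≠ 0) (hg : g ≠ 0)
    (hD0 : a*g+1 ≠ 0)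
    (st : v^2*((a*g+1)*(g*h+1)*(h*a+1))+v*((a*g*h)^2+(a*g+g*h+h*a))+(1+a*g*h) = 0) :
    g^2*b*a^4+g^3*b^2*a^3+g*b^2*a^3+g^3*b*a^3+g*b*a^3+g^2*a^3+g*a^3+g^4*b*a^2+b*a^2+g^3*a^2+a^2
      +g^3*b^2*a+g*b^2*a+g^3*b*a+g*b*a+g^3*a+a+g^2*b+g^2+g = 0 := by
  have hD : h*(a*g+1) = a+g := by clear h1 st ha hg hD0; grind
  have k1 : a*g*(g^2*b*a^4+g^3*b^2*a^3+g*b^2*a^3+g^3*b*a^3+g*b*a^3+g^2*a^3+g*a^3+g^4*b*a^2+b*a^2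
      +g^3*a^2+a^2+g^3*b^2*a+g*b^2*a+g^3*b*a+g*b*a+g^3*a+a+g^2*b+g^2+g) =
      (a*b*g+1)^2*(g^2+1)*(a^2+1) + (a*b*g+1)*(a^2*g^2*(a+g)^2+a*g*(a*g+1)^2+(a+g)^2*(a*g+1))
       + (a*g+1)^3+a*g*(a+g)*(a*g+1)^2 := by clear h1 st ha hg hD0 hM hD; grind
  have g1 : g^2+1 = (g*h+1)*(a*g+1) := by clear h1 st ha hg hD0 hM; grind
  have g2 : a^2+1 = (h*a+1)*(a*g+1) := by clear h1 st ha hg hD0 hM; grind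
  apply mul_left_cancel₀ (mul_ne_zero ha hg)
  rw [k1, h1, g1, g2, ← hD]
  linear_combination (a*g+1)^3*st + v*(a*g+1)^3*h*hD

theorem star_of_star {F : Type*} [Field F] [CharP F 2] (a g h v m : F) (hm0 : m ≠ 0)
    (hs : m*(a*g*h) = 1+v)
    (st : v^3+v^2*m*(a+g+h)+v*m^2*(a*g+g*h+h*a)+m^2*(1+v) = v+m) :
    v^2*((a*g+1)*(g*h+1)*(h*a+1))+v*((a*g*h)^2+(a*g+g*h+h*a))+(1+a*g*h) = 0 := by
  apply mul_left_cancel₀ (pow_ne_zero 2 hm0)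
  clear hm0
  grind

theorem phi_expand {F : Type*} [Field F] [CharP F 2] (c0 c1 c2 c3 c4 c5 u0 u2 u4 : F) :
    (u0+c1*c2*u2+u4)*(u0+u2+c3*c4*u4)*(c5*c0*u0+u2+u4)
      - (u0+c1*u2+c4*u4)*(c5*u0+c2*u2+u4)*(c0*u0+u2+c3*u4) =
    (1+c5*c0+c5*c0*c1*c2+c0*c2+c5+c5*c0*c1)*(u0^2*u2)
    + (1+c1*c2+c1*c2*c3*c4+c2*c4+c1+c1*c2*c3)*(u2^2*u4)
    + (1+c3*c4+c3*c4*c5*c0+c4*c0+c3+c3*c4*c5)*(u4^2*u0)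
    + (1+c0*c5+c0*c3*c4*c5+c0*c4*c5+c0+c3*c5)*(u0^2*u4)
    + (1+c2*c1+c2*c5*c0*c1+c2*c0*c1+c2+c5*c1)*(u2^2*u0)
    + (1+c4*c3+c4*c1*c2*c3+c4*c2*c3+c4+c1*c3)*(u4^2*u2)
    + (c1*c2+c3*c4+c0*c5+c1*c2*c3*c4*c0*c5+1+c2*c3+c1*c0+c4*c5+c1*c3*c5+c0*c2*c4)*(u0*u2*u4) := by
  grind

theorem phi_factor {F : Type*} [Field F] [CharP F 2] (a g h v m c1 c3 c5 u0 u2 u4 : F)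
    (hs : m*(a*g*h) = 1+v)
    (st : v^3+v^2*m*(a+g+h)+v*m^2*(a*g+g*h+h*a)+m^2*(1+v) = v+m)
    (e1 : c1 = v+m*h) (e3 : c3 = v+m*a) (e5 : c5 = v+m*g) :
    m^2*((u0+c1*g*u2+u4)*(u0+u2+c3*h*u4)*(c5*a*u0+u2+u4)
      - (u0+c1*u2+h*u4)*(c5*u0+g*u2+u4)*(a*u0+u2+c3*u4)) =
    v*(((c3*c5+1)*u0+m*(g*h+1)*u2)*((c5*c1+1)*u2+m*(h*a+1)*u4)*((c1*c3+1)*u4+m*(a*g+1)*u0)) := by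
  have hs2 : m*(g*h*a) = 1+v := by rw [← hs]; ring
  have hs4 : m*(h*a*g) = 1+v := by rw [← hs]; ring
  have st2 : v^3+v^2*m*(g+h+a)+v*m^2*(g*h+h*a+a*g)+m^2*(1+v) = v+m := by rw [← st]; ring
  have st4 : v^3+v^2*m*(h+a+g)+v*m^2*(h*a+a*g+g*h)+m^2*(1+v) = v+m := by rw [← st]; ring
  have A0 := coefA a g h v m hs st
  have A2 := coefA g h a v m hs2 st2
  have A4 := coefA h a g v m hs4 st4
  rw [← e1, ← e3, ← e5] at A0 A2 A4
  have B0 := coefB a g h v m hs st c1 c3 c5 e1 e3 e5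
  have B2 := coefB g h a v m hs2 st2 c3 c5 c1 e3 e5 e1
  have B4 := coefB h a g v m hs4 st4 c5 c1 c3 e5 e1 e3
  have K := coefK a g h v m hs st c1 c3 c5 e1 e3 e5
  have X := coefX a g h v m hs st c1 c3 c5 e1 e3 e5
  rw [phi_expand]
  linear_combination m*(u0^2*u2)*A0 + m*(u2^2*u4)*A2 + m*(u4^2*u0)*A4 + m^2*(u0^2*u4)*B0
    + m^2*(u2^2*u0)*B2 + m^2*(u4^2*u2)*B4 + m*(u0*u2*u4)*K - (u0*u2*u4)*X

theorem core {F : Type*} [Field F] [CharP F 2] (c0 c1 c2 c3 c4 c5 : F)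
    (hc0 : c0 ≠ 0) (hc1 : c1 ≠ 0) (hc2 : c2 ≠ 0) (hc3 : c3 ≠ 0) (hc4 : c4 ≠ 0) (hc5 : c5 ≠ 0)
    (hD0 : c0*c2+1 ≠ 0) (hD1 : c1*c3+1 ≠ 0) (hD2 : c2*c4+1 ≠ 0) (hD4 : c4*c0+1 ≠ 0)
    (hE0 : c0*c1*c2+1 ≠ 0) (h02 : c0 ≠ c2) (h13 : c1 ≠ c3)
    (p0 : c4+c0+c3*c4+c0*c1+c0*c2*c3*c4+c0*c1*c2*c4 = 0)
    (p4 : c2+c4+c1*c2+c4*c5+c4*c0*c1*c2+c4*c5*c0*c2 = 0)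
    (p1 : c5+c1+c4*c5+c1*c2+c1*c3*c4*c5+c1*c2*c3*c5 = 0)
    (p5 : c3+c5+c2*c3+c5*c0+c5*c1*c2*c3+c5*c0*c1*c3 = 0)
    (hF5 : c2^2*c1*c0^2+c2*c1*c0^2+c2^2*c0^2+c2^2*c1*c0+c2*c1*c0+1 ≠ 0)
    (hF4 : c2^2*c1*c0^4+c2^3*c1^2*c0^3+c2*c1^2*c0^3+c2^3*c1*c0^3+c2*c1*c0^3+c2^2*c0^3+c2*c0^3
      +c2^4*c1*c0^2+c1*c0^2+c2^3*c0^2+c0^2+c2^3*c1^2*c0+c2*c1^2*c0+c2^3*c1*c0+c2*c1*c0+c2^3*c0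
      +c0+c2^2*c1+c2^2+c2 ≠ 0) :
    c0*c2*c4+c0+c2+c4 ≠ 0 ∧
    (∀ u0 u2 u4 : F, (u0+c1*c2*u2+u4)*(u0+u2+c3*c4*u4)*(c5*c0*u0+u2+u4)
      = (u0+c1*u2+c4*u4)*(c5*u0+c2*u2+u4)*(c0*u0+u2+c3*u4) →
      ((c3*c4*c5+1)*u0+(c2*c3*c4+1)*u2)*((c5*c0*c1+1)*u2+(c4*c5*c0+1)*u4)
        *((c1*c2*c3+1)*u4+(c0*c1*c2+1)*u0) = 0) ∧
    (c1*c2*c3+1)*(c3*c4*c5+1)*(c5*c0*c1+1) ≠ (c0*c1*c2+1)*(c2*c3*c4+1)*(c4*c5*c0+1) := by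
  obtain ⟨v, m, hv, hm, e1, e3, e5⟩ := affine_of_P c0 c1 c2 c3 c4 c5 hc0 hc2 hc4 hD0 p0 p4
  obtain ⟨w, n, hw, hn, e2, e4, e0⟩ := affine_of_P c1 c2 c3 c4 c5 c0 hc1 hc3 hc5 hD1 p1 p5
  have hv0 : v ≠ 0 := by rintro rfl; exact hE0 (by rw [hv, zero_mul])
  have hm0 : m ≠ 0 := by rintro rfl; exact h13 (by rw [e1, e3]; ring)
  have hmn : m*n = 1 := by
    have : (c0-c2)*(m*n) = (c0-c2)*1 := by
      linear_combination (-1)*e0 + e2 - n*e3 + n*e5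
    exact mul_left_cancel₀ (sub_ne_zero.mpr h02) this
  have hwn : w = n*v := by
    have h2 : (2:F) = 0 := CharTwo.two_eq_zero
    linear_combination (-1)*e0 - n*e3 - c0*hmn - n*v*h2
  have hprod : c1*c3*c5 = v+m := by
    linear_combination m*hn + m*hwn + (v - c1*c3*c5)*hmn
  have st : v^3+v^2*m*(c0+c2+c4)+v*m^2*(c0*c2+c2*c4+c4*c0)+m^2*(1+v) = v+m := by
    rw [← hprod, e1, e3, e5]
    linear_combination -m^2*hm
  have st' := star_of_star c0 c2 c4 v m hm0 hm st
  have E2 : c2*c3*c4+1 = v*(c2*c4+1) := by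
    rw [e3]; clear * - hm; grind
  have E4 : c4*c5*c0+1 = v*(c4*c0+1) := by
    rw [e5]; clear * - hm; grind
  have E3 : c3*c4*c5+1 = w*(c3*c5+1) := by
    rw [e4]; clear * - hn; grind
  have E5 : c5*c0*c1+1 = w*(c5*c1+1) := by
    rw [e0]; clear * - hn; grind
  have hn0 : n ≠ 0 := by rintro rfl; simp at hmn
  refine ⟨?_, ?_, ?_⟩
  · intro hM
    exact hF4 (F4_zero c0 c2 c4 v c1 hM hv hc0 hc2 hD0 st')
  · intro u0 u2 u4 hu
    have key := phi_factor c0 c2 c4 v m c1 c3 c5 u0 u2 u4 hm st e1 e3 e5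
    rw [hu, sub_self, mul_zero] at key
    have key := (mul_eq_zero.mp key.symm).resolve_left hv0
    rw [E2, E3, E4, E5, hv, hw, hwn]
    have : v = n*m*v := by rw [mul_comm n m, hmn, one_mul]
    have a1 : n*v*(c3*c5+1)*u0+v*(c2*c4+1)*u2 = n*v*((c3*c5+1)*u0+m*(c2*c4+1)*u2) := by
      linear_combination (c2*c4+1)*u2*this
    have a2 : n*v*(c5*c1+1)*u2+v*(c4*c0+1)*u4 = n*v*((c5*c1+1)*u2+m*(c4*c0+1)*u4) := by
      linear_combination (c4*c0+1)*u4*this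
    have a3 : n*v*(c1*c3+1)*u4+v*(c0*c2+1)*u0 = n*v*((c1*c3+1)*u4+m*(c0*c2+1)*u0) := by
      linear_combination (c0*c2+1)*u0*this
    rw [a1, a2, a3]
    linear_combination (n*v)^3*key
  · intro hX
    rw [E2, E3, E4, E5, hv, hw, hwn] at hX
    have X := coefX c0 c2 c4 v m hm st c1 c3 c5 e1 e3 e5
    have hX' : (c1*c3+1)*(c3*c5+1)*(c5*c1+1) = m^3*((c0*c2+1)*(c2*c4+1)*(c4*c0+1)) := by
      have hnv : (n*v)^3 ≠ 0 := pow_ne_zero 3 (mul_ne_zero hn0 hv0)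
      apply mul_left_cancel₀ hnv
      have : (n*v)^3*m^3 = v^3 := by rw [← mul_pow]; congr 1; linear_combination v*hmn
      linear_combination hX - ((c0*c2+1)*(c2*c4+1)*(c4*c0+1))*this
    rw [hX', CharTwo.add_self_eq_zero, mul_zero] at X
    have hz := pow_eq_zero_iff (two_ne_zero) |>.mp ((mul_eq_zero.mp X.symm).resolve_left hm0)
    have hs1 : c0*c2*c4 = 1 := by
      apply mul_left_cancel₀ hm0
      rw [hm]
      clear * - hz
      grind
    exact hF5 (F5_zero c0 c2 c4 v c1 hs1 hv0 hv hD0 hD2 hD4 st')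

theorem row_cross {F : Type*} [Field F] (n1 n3 n5 y1 y3 y5 z1 z3 z5 : F)
    (hy : n1*y1+n3*y3+n5*y5 = 0) (hz : n1*z1+n3*z3+n5*z5 = 0) :
    n3*(y1*z3-y3*z1) = n5*(y5*z1-y1*z5) := by
  linear_combination y1*hz - z1*hy

theorem phi_zero {F : Type*} [Field F] (c0 c1 c2 c3 c4 c5 u0 u2 u4 m1 m3 m5
    y0 y1 y2 y3 y4 y5 z0 z1 z2 z3 z4 z5 : F)
    (hy0 : y0 = u0*(c0*y1+y3+y5)) (hy2 : y2 = u2*(c2*y3+y5+y1)) (hy4 : y4 = u4*(c4*y5+y1+y3))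
    (hz0 : z0 = u0*(c0*z1+z3+z5)) (hz2 : z2 = u2*(c2*z3+z5+z1)) (hz4 : z4 = u4*(c4*z5+z1+z3))
    (hy1 : c1*y2+y4+y0 = m1*y1) (hy3 : c3*y4+y0+y2 = m3*y3) (hy5 : c5*y0+y2+y4 = m5*y5)
    (hz1 : c1*z2+z4+z0 = m1*z1) (hz3 : c3*z4+z0+z2 = m3*z3) (hz5 : c5*z0+z2+z4 = m5*z5)
    (w1 : y3*z5-y5*z3 ≠ 0) (w3 : y5*z1-y1*z5 ≠ 0) (w5 : y1*z3-y3*z1 ≠ 0) :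
    (u0+c1*c2*u2+u4)*(u0+u2+c3*c4*u4)*(c5*c0*u0+u2+u4)
      = (u0+c1*u2+c4*u4)*(c5*u0+c2*u2+u4)*(c0*u0+u2+c3*u4) := by
  subst hy0 hy2 hy4 hz0 hz2 hz4
  have r1 := row_cross (c0*u0+c1*u2+u4-m1) (u0+c1*c2*u2+u4) (u0+c1*u2+c4*u4) y1 y3 y5 z1 z3 z5
    (by linear_combination hy1) (by linear_combination hz1)
  have r3 := row_cross (u0+c2*u2+c3*u4-m3) (u0+u2+c3*c4*u4) (c0*u0+u2+c3*u4) y3 y5 y1 z3 z5 z1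
    (by linear_combination hy3) (by linear_combination hz3)
  have r5 := row_cross (c5*u0+u2+c4*u4-m5) (c5*c0*u0+u2+u4) (c5*u0+c2*u2+u4) y5 y1 y3 z5 z1 z3
    (by linear_combination hy5) (by linear_combination hz5)
  apply mul_right_cancel₀ (mul_ne_zero (mul_ne_zero w1 w3) w5)
  generalize u0+c1*c2*u2+u4 = A at *
  generalize u0+c1*u2+c4*u4 = B at *
  generalize u0+u2+c3*c4*u4 = C at *
  generalize c0*u0+u2+c3*u4 = D at *
  generalize c5*c0*u0+u2+u4 = E at *
  generalize c5*u0+c2*u2+u4 = G at *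
  generalize y3*z5-y5*z3 = W1 at *
  generalize y5*z1-y1*z5 = W3 at *
  generalize y1*z3-y3*z1 = W5 at *
  calc A*C*E*(W1*W3*W5) = (A*W5)*(C*W1)*(E*W3) := by ring
    _ = _ := by rw [r1, r3, r5]; ring

theorem det_zero {F : Type*} [Field F] [CharP F 2] (c0 c2 c4 z1 z3 z5 : F)
    (hM : c0*c2*c4+c0+c2+c4 ≠ 0) (h0 : c0*z1+z3+z5 = 0) (h2 : c2*z3+z5+z1 = 0)
    (h4 : c4*z5+z1+z3 = 0) : z1 = 0 := by
  apply (mul_eq_zero.mp (?_ : (c0*c2*c4+c0+c2+c4)*z1 = 0)).resolve_left hM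
  have h : (2:F) = 0 := CharTwo.two_eq_zero
  clear hM
  grind

theorem main_alg {F : Type*} [Field F] [CharP F 2] (s : F →+* F)
    (h6 : ∀ x, s (s (s (s (s (s x))))) = x) (c0 c1 c2 c3 c4 c5 : F)
    (t0 : s c0 = c1) (t1 : s c1 = c2) (t2 : s c2 = c3) (t3 : s c3 = c4) (t4 : s c4 = c5)
    (t5 : s c5 = c0) (hne : c2 ≠ c0)
    (h1 : c4*c0*c2*c3*(c1*c3+1)+c0*c1*c3+c0+c1*c2*c3*c3+c1*c2*c3+c3+1 = 0)
    (h2 : c0*c0*c1*c1*c2*c3+c0*c0*c1*c2+c0*c1*c1*c2*c2*c3+c0*c1*c2*c2*c3*c3+c0*c1*c2+c0*c1*c3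
      +c0*c2*c3+c0+c1*c2*c3*c3+c1*c2*c3+c3+1 = 0)
    (hE0 : c0*c1*c2+1 ≠ 0)
    (hF5 : c2^2*c1*c0^2+c2*c1*c0^2+c2^2*c0^2+c2^2*c1*c0+c2*c1*c0+1 ≠ 0)
    (hF4 : c2^2*c1*c0^4+c2^3*c1^2*c0^3+c2*c1^2*c0^3+c2^3*c1*c0^3+c2*c1*c0^3+c2^2*c0^3+c2*c0^3
      +c2^4*c1*c0^2+c1*c0^2+c2^3*c0^2+c0^2+c2^3*c1^2*c0+c2*c1^2*c0+c2^3*c1*c0+c2*c1*c0+c2^3*c0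
      +c0+c2^2*c1+c2^2+c2 ≠ 0)
    (y z : F) (hy : y ≠ 0) (hz : z ≠ 0)
    (hf : (s (s (s (s (s y)))) + s (s (s y)) + c0 * s y) * z
      = (s (s (s (s (s z)))) + s (s (s z)) + c0 * s z) * y) : s (y/z) = y/z := by
  have inj : ∀ x, x ≠ 0 → s x ≠ 0 := fun x hx => (map_ne_zero s).mpr hx
  have hc0 : c0 ≠ 0 := by
    rintro rfl
    have : c1 = 0 := by rw [← t0, map_zero]
    subst this
    have : c2 = 0 := by rw [← t1, map_zero]
    exact hne this
  have hc1 : c1 ≠ 0 := t0 ▸ inj _ hc0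
  have hc2 : c2 ≠ 0 := t1 ▸ inj _ hc1
  have hc3 : c3 ≠ 0 := t2 ▸ inj _ hc2
  have hc4 : c4 ≠ 0 := t3 ▸ inj _ hc3
  have hc5 : c5 ≠ 0 := t4 ▸ inj _ hc4
  have hone : c2 ≠ 1 ∧ c3 ≠ 1 := by
    have a3 : c3 ≠ 1 := by
      intro h
      have k4 : c4 = 1 := by rw [← t3, h, map_one]
      have k5 : c5 = 1 := by rw [← t4, k4, map_one]
      have k0 : c0 = 1 := by rw [← t5, k5, map_one]
      have k1 : c1 = 1 := by rw [← t0, k0, map_one]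
      have k2 : c2 = 1 := by rw [← t1, k1, map_one]
      exact hne (k2.trans k0.symm)
    exact ⟨fun h => a3 (by rw [← t2, h, map_one]), a3⟩
  have hD1 : c1*c3+1 ≠ 0 := by
    intro h
    have : (c2-1)*(c3-1) = 0 := by clear * - h h1; grind
    rcases mul_eq_zero.mp this with h | h
    · exact hone.1 (sub_eq_zero.mp h)
    · exact hone.2 (sub_eq_zero.mp h)
  have hD2 : c2*c4+1 ≠ 0 := by have := inj _ hD1; simpa only [map_add, map_mul, map_one, t0, t1, t2, t3, t4, t5] using this
  have hD3 : c3*c5+1 ≠ 0 := by have := inj _ hD2; simpa only [map_add, map_mul, map_one, t0, t1, t2, t3, t4, t5] using this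
  have hD4 : c4*c0+1 ≠ 0 := by have := inj _ hD3; simpa only [map_add, map_mul, map_one, t0, t1, t2, t3, t4, t5] using this
  have hD5 : c5*c1+1 ≠ 0 := by have := inj _ hD4; simpa only [map_add, map_mul, map_one, t0, t1, t2, t3, t4, t5] using this
  have hD0 : c0*c2+1 ≠ 0 := by have := inj _ hD5; simpa only [map_add, map_mul, map_one, t0, t1, t2, t3, t4, t5] using this
  have p0 := stepP c0 c1 c2 c3 c4 h1 h2 hc0 hc2 hc3 hD1
  have p1 := congrArg s p0
  simp only [map_add, map_mul, map_one, map_zero, t0, t1, t2, t3, t4, t5] at p1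
  have p2 := congrArg s p1
  simp only [map_add, map_mul, map_one, map_zero, t0, t1, t2, t3, t4, t5] at p2
  have p3 := congrArg s p2
  simp only [map_add, map_mul, map_one, map_zero, t0, t1, t2, t3, t4, t5] at p3
  have p4 := congrArg s p3
  simp only [map_add, map_mul, map_one, map_zero, t0, t1, t2, t3, t4, t5] at p4
  have p5 := congrArg s p4
  simp only [map_add, map_mul, map_one, map_zero, t0, t1, t2, t3, t4, t5] at p5
  have h13 : c1 ≠ c3 := by
    intro h
    apply hne
    apply s.injective
    rw [t2, t0, h]
  obtain ⟨hM, hPhi, hEE⟩ := core c0 c1 c2 c3 c4 c5 hc0 hc1 hc2 hc3 hc4 hc5 hD0 hD1 hD2 hD4 hE0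
    (Ne.symm hne) h13 p0 p4 p1 p5 hF5 hF4
  obtain ⟨m, hm⟩ : ∃ m, m = (s (s (s (s (s z)))) + s (s (s z)) + c0 * s z) / z := ⟨_, rfl⟩
  have hfz : c0 * s z + s (s (s z)) + s (s (s (s (s z)))) = m * z := by
    rw [hm]; field_simp; ring
  have hfy : c0 * s y + s (s (s y)) + s (s (s (s (s y)))) = m * y := by
    apply mul_right_cancel₀ hz
    linear_combination hf + y * hfz
  clear hf hm
  have shift : ∀ x, c0 * s x + s (s (s x)) + s (s (s (s (s x)))) = m * x →
      c1 * s (s x) + s (s (s (s x))) + x = s m * s x ∧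
      c2 * s (s (s x)) + s (s (s (s (s x)))) + s x = s (s m) * s (s x) ∧
      c3 * s (s (s (s x))) + x + s (s x) = s (s (s m)) * s (s (s x)) ∧
      c4 * s (s (s (s (s x)))) + s x + s (s (s x)) = s (s (s (s m))) * s (s (s (s x))) ∧
      c5 * x + s (s x) + s (s (s (s x))) = s (s (s (s (s m)))) * s (s (s (s (s x)))) := by
    intro x h
    have g1 := congrArg s h
    simp only [map_add, map_mul, t0, h6] at g1
    have g2 := congrArg s g1
    simp only [map_add, map_mul, t1, h6] at g2
    have g3 := congrArg s g2
    simp only [map_add, map_mul, t2, h6] at g3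
    have g4 := congrArg s g3
    simp only [map_add, map_mul, t3, h6] at g4
    have g5 := congrArg s g4
    simp only [map_add, map_mul, t4, h6] at g5
    exact ⟨g1, g2, g3, g4, g5⟩
  obtain ⟨hz1, hz2, hz3, hz4, hz5⟩ := shift z hfz
  obtain ⟨hy1, hy2, hy3, hy4, hy5⟩ := shift y hfy
  by_cases hm0 : m = 0
  · exfalso
    subst hm0
    simp only [map_zero, zero_mul] at hfz hz2 hz4
    exact inj z hz (det_zero c0 c2 c4 _ _ _ hM hfz hz2 hz4)
  by_contra hl
  have w1 : s (s (s y)) * s (s (s (s (s z)))) - s (s (s (s (s y)))) * s (s (s z)) ≠ 0 := by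
    intro h
    have h' : y * s (s z) = s (s y) * z := by
      apply s.injective; apply s.injective; apply s.injective
      simp only [map_mul]
      exact sub_eq_zero.mp h
    obtain ⟨l, rfl⟩ : ∃ l, y = l * z := ⟨y / z, by field_simp⟩
    rw [mul_div_cancel_right₀ _ hz] at hl
    have hz2 : s (s z) ≠ 0 := inj _ (inj _ hz)
    have hl2 : s (s l) = l := by
      simp only [map_mul] at h'
      apply mul_right_cancel₀ (mul_ne_zero hz hz2)
      linear_combination -h'
    simp only [map_mul, hl2] at hfy
    have : (s l - l) * (m * z) = 0 := by
      linear_combination hfy - s l * hfz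
    rcases mul_eq_zero.mp this with h | h
    · exact hl (sub_eq_zero.mp h)
    · exact mul_ne_zero hm0 hz h
  have w3 := inj _ (inj _ w1)
  simp only [map_sub, map_mul, h6] at w3
  have w5 := inj _ (inj _ w3)
  simp only [map_sub, map_mul, h6] at w5
  have hu : m⁻¹ ≠ 0 := inv_ne_zero hm0
  have hum : m⁻¹ * m = 1 := inv_mul_cancel₀ hm0
  generalize m⁻¹ = u at hu hum
  have hum2 := congrArg (fun x => s (s x)) hum
  simp only [map_mul, map_one] at hum2
  have hum4 := congrArg (fun x => s (s x)) hum2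
  simp only [map_mul, map_one] at hum4
  have ev : ∀ (a b x r : F), a * b = 1 → r = b * x → x = a * r := by
    intro a b x r h1 h2
    rw [h2, ← mul_assoc, h1, one_mul]
  have phi := phi_zero c0 c1 c2 c3 c4 c5 u (s (s u)) (s (s (s (s u)))) _ _ _ y (s y) (s (s y))
    (s (s (s y))) (s (s (s (s y)))) (s (s (s (s (s y))))) z (s z) (s (s z))
    (s (s (s z))) (s (s (s (s z)))) (s (s (s (s (s z)))))
    (ev _ _ _ _ hum hfy) (ev _ _ _ _ hum2 hy2) (ev _ _ _ _ hum4 hy4)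
    (ev _ _ _ _ hum hfz) (ev _ _ _ _ hum2 hz2) (ev _ _ _ _ hum4 hz4)
    hy1 hy3 hy5 hz1 hz3 hz5 w1 w3 w5
  have lines := hPhi _ _ _ phi
  have all : (c3*c4*c5+1)*u+(c2*c3*c4+1)*s (s u) = 0 ∧
      (c5*c0*c1+1)*s (s u)+(c4*c5*c0+1)*s (s (s (s u))) = 0 ∧
      (c1*c2*c3+1)*s (s (s (s u)))+(c0*c1*c2+1)*u = 0 := by
    have rot : ∀ x y : F, s (s x) = y → x = 0 → y = 0 := by
      rintro x y rfl rfl; simp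
    have r1 := rot ((c3*c4*c5+1)*u+(c2*c3*c4+1)*s (s u))
      ((c5*c0*c1+1)*s (s u)+(c4*c5*c0+1)*s (s (s (s u))))
      (by simp only [map_add, map_mul, map_one, t0, t1, t2, t3, t4, t5])
    have r2 := rot ((c5*c0*c1+1)*s (s u)+(c4*c5*c0+1)*s (s (s (s u))))
      ((c1*c2*c3+1)*s (s (s (s u)))+(c0*c1*c2+1)*u)
      (by simp only [map_add, map_mul, map_one, t0, t1, t2, t3, t4, t5, h6])
    have r3 := rot ((c1*c2*c3+1)*s (s (s (s u)))+(c0*c1*c2+1)*u)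
      ((c3*c4*c5+1)*u+(c2*c3*c4+1)*s (s u))
      (by simp only [map_add, map_mul, map_one, t0, t1, t2, t3, t4, t5, h6])
    rcases mul_eq_zero.mp lines with h | h
    · rcases mul_eq_zero.mp h with h | h
      · exact ⟨h, r1 h, r2 (r1 h)⟩
      · exact ⟨r3 (r2 h), h, r2 h⟩
    · exact ⟨r3 h, r1 (r3 h), h⟩
  obtain ⟨l0, l2, l4⟩ := all
  have l0 := CharTwo.add_eq_zero.mp l0
  have l2 := CharTwo.add_eq_zero.mp l2
  have l4 := CharTwo.add_eq_zero.mp l4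
  apply hEE
  apply mul_right_cancel₀ hu
  linear_combination (c1*c2*c3+1)*(c5*c0*c1+1)*l0 + (c1*c2*c3+1)*(c2*c3*c4+1)*l2
    + (c2*c3*c4+1)*(c4*c5*c0+1)*l4

theorem statement1 :
    ∃ Q : ℕ, ∀ (e q : ℕ), 1 ≤ e → q = 2 ^ e → Q ≤ q →
      ∀ (F : Type) [Field F] [Fintype F], Fintype.card F = q ^ 6 →
        ∀ c ∈ frakC q F,
          IsScattered q (fun x : F => x ^ (q ^ 5) + x ^ (q ^ 3) + c * x ^ q) := by
  refine ⟨0, ?_⟩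
  intro e q he hq _ F _ _ hcard c hc y z hy hz hf
  obtain ⟨hne, hF1, hF2, hF345⟩ := hc
  haveI : CharP F 2 := by
    haveI : Fact (Nat.Prime 2) := ⟨Nat.prime_two⟩
    obtain ⟨p, hp⟩ := CharP.exists F
    obtain ⟨n, hpp, hn⟩ := FiniteField.card F p
    have hdvd : p ∣ 2 := by
      have h1 : p ∣ Fintype.card F := by rw [hn]; exact dvd_pow_self p n.ne_zero
      rw [hcard, hq, ← pow_mul] at h1
      exact hpp.dvd_of_dvd_pow h1
    have : p = 2 := (Nat.prime_dvd_prime_iff_eq hpp Nat.prime_two).mp hdvd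
    rw [← this]; exact hp
  haveI : ExpChar F 2 := ExpChar.prime Nat.prime_two
  obtain ⟨s, hs⟩ : ∃ s : F →+* F, ∀ x, s x = x ^ q :=
    ⟨iterateFrobenius F 2 e, fun x => by rw [iterateFrobenius_def, hq]⟩
  have s2 : ∀ x, s (s x) = x ^ (q ^ 2) := fun x => by simp only [hs, ← pow_mul]; congr 1; ring
  have s3 : ∀ x, s (s (s x)) = x ^ (q ^ 3) := fun x => by simp only [hs, ← pow_mul]; congr 1; ring
  have s4 : ∀ x, s (s (s (s x))) = x ^ (q ^ 4) := fun x => by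
    simp only [hs, ← pow_mul]; congr 1; ring
  have s5 : ∀ x, s (s (s (s (s x)))) = x ^ (q ^ 5) := fun x => by
    simp only [hs, ← pow_mul]; congr 1; ring
  have h6 : ∀ x, s (s (s (s (s (s x))))) = x := fun x => by
    have h := FiniteField.pow_card x
    rw [hcard] at h
    conv_rhs => rw [← h]
    simp only [hs, ← pow_mul]; congr 1; ring
  have hF3 : F3 q c ≠ 0 := fun h => hF345 (by rw [h]; ring)
  have hF4 : F4 q c ≠ 0 := fun h => hF345 (by rw [h]; ring)
  have hF5 : F5 q c ≠ 0 := fun h => hF345 (by rw [h]; ring)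
  have ex : ∀ k j : ℕ, c ^ (k * j) = (c ^ j) ^ k := fun k j => by rw [mul_comm, pow_mul]
  unfold F1 at hF1
  unfold F2 at hF2
  unfold F3 at hF3
  unfold F4 at hF4
  unfold F5 at hF5
  simp only [pow_add, ex, pow_one] at hF1 hF2 hF3 hF4 hF5
  simp only [← s4, ← s3, ← s2, ← hs] at hF1 hF2 hF3 hF4 hF5 hne
  simp only [← s5, ← s3, ← hs] at hf
  refine ⟨y / z, ?_, by field_simp⟩
  rw [← hs]
  refine main_alg s h6 c (s c) (s (s c)) (s (s (s c))) (s (s (s (s c)))) (s (s (s (s (s c)))))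
    rfl rfl rfl rfl rfl (h6 c) hne ?_ ?_ ?_ ?_ ?_ y z hy hz hf
  · rw [← hF1]; ring
  · rw [← hF2]; ring
  · intro h; apply hF3; rw [← h]; ring
  · intro h; apply hF5; rw [← h]
  · intro h; apply hF4; rw [← h]
end
end

section
/- There exist a real constant C > 0 and a constant Q such that for every power of two q = 2^e with q ≥ Q and every finite field F with q^6 elements, the set 𝔠 is nonempty and its cardinality N satisfies |N − q^3| ≤ C·q^2·√q (i.e. |𝔠| = q^3 + O(q^{5/2})). -/
noncomputable section

set_option linter.unusedSectionVars false

section core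
variable {F : Type*} [Field F] [CharP F 2]

lemma two_zero' : (2 : F) = 0 := CharTwo.two_eq_zero

/-- consequences of the two equations at one window -/
lemma window {A B C D E k : F} (hA : A ≠ 0) (hC : C ≠ 0) (hD : D ≠ 0) (hM : 1 + B * D ≠ 0)
    (hk : k * (1 + B * D) = 1 + B * C * D)
    (h1 : A * (1 + B * D) * (1 + C * D * E) = (1 + D) * (1 + B * C * D))
    (h2 : A * C * ((1 + B * D) * (A * B + D * E) + (B + D) * (1 + B * C * D)) = 0) :
    A * (1 + C * D * E) = (1 + D) * k ∧ A * B + D * E = (B + D) * k ∧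
      E * (1 + A * B * C) = (1 + B) * k := by
  have t : (2 : F) = 0 := two_zero'
  have e1 : A * (1 + C * D * E) = (1 + D) * k := by
    apply mul_left_cancel₀ hM
    linear_combination h1 - (1 + D) * hk
  have e2 : A * B + D * E = (B + D) * k := by
    have h2' := (mul_eq_zero.mp h2).resolve_left (mul_ne_zero hA hC)
    apply mul_left_cancel₀ hM
    linear_combination h2' - (B + D) * hk - (B + D) * (1 + B * C * D) * t
  refine ⟨e1, e2, ?_⟩
  apply mul_left_cancel₀ hD
  clear hA hC hM hk h1 h2 hD
  grind

lemma back_alg {A B C D E k l : F} (hl : l ≠ 0)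
    (e1 : B * D * (C + k) = 1 + k) (e2 : C * E * (D + l) = 1 + l)
    (e3 : k * D + l * A = k * l) (e4 : l * E + k * B = k * l) :
    A * (1 + B * D) * (1 + C * D * E) = (1 + D) * (1 + B * C * D) ∧
    A * C * ((1 + B * D) * (A * B + D * E) + (B + D) * (1 + B * C * D)) = 0 := by
  have t : (2 : F) = 0 := two_zero'
  have p1 : 1 + B * C * D = k * (1 + B * D) := by grind
  have p2 : 1 + C * D * E = l * (1 + C * E) := by grind
  have p3 : A * B + D * E = (B + D) * k := by
    apply mul_left_cancel₀ hl
    grind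
  constructor
  · rw [p1, p2]
    have : A * l * (1 + C * E) = (1 + D) * k := by grind
    linear_combination (1 + B * D) * this
  · rw [p1, p3]
    linear_combination (A * C * (1 + B * D) * (B + D) * k) * t

lemma lin_alg {A C D E k l : F} (hM : 1 + C * E ≠ 0)
    (e1 : A * (1 + C * D * E) = (1 + D) * k) (e2 : l * (1 + C * E) = 1 + C * D * E) :
    k * D + l * A = k * l ∧ C * E * (D + l) = 1 + l := by
  have t : (2 : F) = 0 := two_zero'
  have e3 : C * E * (D + l) = 1 + l := by grind
  refine ⟨?_, e3⟩
  apply mul_left_cancel₀ hM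
  grind

lemma F1_eq (q : ℕ) (c : F) : F1 q c = c * (1 + c ^ q * c ^ q ^ 3) *
    (1 + c ^ q ^ 2 * c ^ q ^ 3 * c ^ q ^ 4) + (1 + c ^ q ^ 3) * (1 + c ^ q * c ^ q ^ 2 * c ^ q ^ 3) := by
  simp only [F1, pow_add, pow_mul', pow_one]
  ring

lemma F2_eq (q : ℕ) (c : F) : F2 q c = F1 q c + c * c ^ q ^ 2 * ((1 + c ^ q * c ^ q ^ 3) *
    (c * c ^ q + c ^ q ^ 3 * c ^ q ^ 4) + (c ^ q + c ^ q ^ 3) * (1 + c ^ q * c ^ q ^ 2 * c ^ q ^ 3)) := by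
  have t : (2 : F) = 0 := two_zero'
  rw [F1_eq]
  simp only [F2, pow_add, pow_mul', pow_one]
  generalize c ^ q ^ 4 = E
  generalize c ^ q ^ 3 = D
  generalize c ^ q ^ 2 = C
  generalize c ^ q = B
  grind

end core

section count
open Finset Polynomial

variable {F : Type*} [Field F] [Fintype F] [DecidableEq F] [CharP F 2]

/-- relative norm to the fixed field of `φ²` -/
def nrm (φ : F →+* F) (w : F) : F := w * φ (φ w) * φ (φ (φ (φ w)))

def gg (φ : F →+* F) (s : F) : F := s ^ 2 * (φ s + 1)

def K2 (φ : F →+* F) : Finset F := univ.filter fun s => φ (φ s) = s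
def K3 (φ : F →+* F) : Finset F := univ.filter fun s => φ (φ (φ s)) = s
def TT (φ : F →+* F) : Finset F := univ.filter fun w => φ (φ (φ w)) = w + 1

def aa (φ : F →+* F) (W : F) : ℕ := ((TT φ).filter fun w => nrm φ w = W).card

def SS (φ : F →+* F) : Finset (F × F) :=
  ((K2 φ) ×ˢ (TT φ)).filter fun p => nrm φ p.2 = gg φ p.1

lemma root_bound (P : F[X]) (hP : P ≠ 0) (n : ℕ) (hn : P.natDegree ≤ n) (S : Finset F)
    (h : ∀ x ∈ S, P.eval x = 0) : S.card ≤ n := by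
  refine le_trans (Polynomial.card_le_degree_of_subset_roots (p := P) ?_) hn
  intro x hx
  rw [Polynomial.mem_roots hP]
  exact h x hx

lemma root_bound' (n : ℕ) (R : F[X]) (hR : R.natDegree < n) (S : Finset F)
    (h : ∀ x ∈ S, x ^ n + R.eval x = 0) : S.card ≤ n := by
  have hd : R.degree < n := Polynomial.degree_le_natDegree.trans_lt (by exact_mod_cast hR)
  refine root_bound (X ^ n + R) (Polynomial.monic_X_pow_add hd).ne_zero n ?_ S ?_
  · refine (Polynomial.natDegree_add_le _ _).trans ?_
    simp [hR.le]
  · intro x hx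
    simpa using h x hx

variable (φ : F →+* F) (q : ℕ) (hq : 2 ≤ q) (hφ : ∀ x, φ x = x ^ q)
  (h6 : ∀ x, φ (φ (φ (φ (φ (φ x))))) = x) (hcard : Fintype.card F = q ^ 6)

include hφ in
lemma phi2 (x : F) : φ (φ x) = x ^ q ^ 2 := by rw [hφ, hφ, ← pow_mul]; ring_nf
include hφ in
lemma phi3 (x : F) : φ (φ (φ x)) = x ^ q ^ 3 := by rw [hφ, phi2 φ q hφ, ← pow_mul]; ring_nf
include hφ in
lemma phi4 (x : F) : φ (φ (φ (φ x))) = x ^ q ^ 4 := by rw [hφ, phi3 φ q hφ, ← pow_mul]; ring_nf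

include hq hφ in
lemma card_K2_le : (K2 φ).card ≤ q ^ 2 := by
  refine root_bound' (q ^ 2) X ?_ _ ?_
  · simp; nlinarith
  · intro x hx
    simp only [K2, mem_filter, mem_univ, true_and, phi2 φ q hφ] at hx
    simp [hx, CharTwo.add_self_eq_zero]

include hq hφ in
lemma card_K3_le : (K3 φ).card ≤ q ^ 3 := by
  refine root_bound' (q ^ 3) X ?_ _ ?_
  · simp; nlinarith [Nat.pow_le_pow_left hq 3]
  · intro x hx
    simp only [K3, mem_filter, mem_univ, true_and, phi3 φ q hφ] at hx
    simp [hx, CharTwo.add_self_eq_zero]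

include hq hφ in
lemma fib3_le (y : F) (s : Finset F) : (s.filter fun w => w + φ (φ (φ w)) = y).card ≤ q ^ 3 := by
  refine root_bound' (q ^ 3) (X + C y) ?_ _ ?_
  · rw [natDegree_X_add_C]; nlinarith [Nat.pow_le_pow_left hq 3]
  · intro x hx
    simp only [mem_filter, phi3 φ q hφ] at hx
    rw [← hx.2]
    simp only [eval_add, eval_X, eval_C]
    linear_combination (x + x ^ q ^ 3) * (CharTwo.two_eq_zero : (2 : F) = 0)

include hq hφ hcard in
lemma le_card_K2 (h6 : ∀ x, φ (φ (φ (φ (φ (φ x))))) = x) : q ^ 2 ≤ (K2 φ).card := by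
  have := Finset.card_le_mul_card_image_of_maps_to (s := (univ : Finset F)) (t := K2 φ)
    (f := fun x => x + φ (φ x) + φ (φ (φ (φ x)))) (by
      intro x _
      simp only [K2, mem_univ, true_and, mem_filter, map_add, h6]
      ring) (q ^ 4) (by
      intro y _
      refine root_bound' (q ^ 4) (X ^ q ^ 2 + (X + C y)) ?_ _ ?_
      · refine (natDegree_add_le _ _).trans_lt ?_
        rw [natDegree_X_add_C, natDegree_X_pow]
        have : q ^ 2 < q ^ 4 := Nat.pow_lt_pow_right (by omega) (by norm_num)
        have : 1 < q ^ 4 := Nat.one_lt_pow (by norm_num) (by omega)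
        simp [*]
      · intro x hx
        simp only [mem_filter, phi4 φ q hφ] at hx
        rw [phi2 φ q hφ] at hx
        rw [← hx.2]
        simp only [eval_add, eval_pow, eval_X, eval_C]
        linear_combination (x + x ^ q ^ 2 + x ^ q ^ 4) * (CharTwo.two_eq_zero : (2 : F) = 0))
  rw [Finset.card_univ, hcard] at this
  have hp : 0 < q ^ 4 := by positivity
  refine Nat.le_of_mul_le_mul_left (c := q ^ 4) ?_ hp
  calc q ^ 4 * q ^ 2 = q ^ 6 := by ring
    _ ≤ _ := this

lemma mem_TT (w : F) : w ∈ TT φ ↔ w + φ (φ (φ w)) = 1 := by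
  have t : (2 : F) = 0 := CharTwo.two_eq_zero
  simp only [TT, mem_filter, mem_univ, true_and]
  constructor <;> intro h
  · linear_combination h + w * t
  · linear_combination h - w * t

lemma TT_eq : TT φ = (univ.filter fun w => w + φ (φ (φ w)) = 1) := by
  ext w; simp [mem_TT]

include hq hφ in
lemma card_TT_le : (TT φ).card ≤ q ^ 3 := by
  rw [TT_eq]; exact fib3_le φ q hq hφ 1 univ

include hq hφ hcard h6 in
lemma le_card_TT : q ^ 3 ≤ (TT φ).card := by
  have := Finset.card_le_mul_card_image_of_maps_to
    (s := (univ.filter fun w : F => ¬ (w + φ (φ (φ w)) = 1))) (t := (K3 φ).erase 1)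
    (f := fun x => x + φ (φ (φ x))) (by
      intro x hx
      replace hx := (mem_filter.1 (mem_coe.1 hx)).2
      simp only [K3, mem_erase, mem_univ, true_and, mem_filter, map_add, h6]
      exact ⟨hx, by ring⟩) (q ^ 3) (by
      intro y _
      exact fib3_le φ q hq hφ y _)
  have h1 : (1 : F) ∈ K3 φ := by simp [K3]
  rw [Finset.card_erase_of_mem h1] at this
  have h2 := Finset.card_filter_add_card_filter_not (s := (univ : Finset F))
    (fun w : F => w + φ (φ (φ w)) = 1)
  rw [Finset.card_univ, hcard, ← TT_eq] at h2
  have h3 := card_K3_le φ q hq hφ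
  have h4 : q ^ 3 * ((K3 φ).card - 1) ≤ q ^ 3 * (q ^ 3 - 1) := Nat.mul_le_mul_left _ (by omega)
  have h5 : q ^ 3 * (q ^ 3 - 1) + q ^ 3 = q ^ 6 := by
    have : 1 ≤ q ^ 3 := Nat.one_le_pow _ _ (by omega)
    obtain ⟨m, hm⟩ := Nat.exists_eq_add_of_le this
    have : q ^ 6 = q ^ 3 * q ^ 3 := by ring
    rw [this, hm]; simp; ring
  omega

include h6 in
lemma nrm_mem (w : F) : nrm φ w ∈ K2 φ := by
  simp only [nrm, K2, mem_filter, mem_univ, true_and, map_mul, h6]; ring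

lemma gg_mem (s : F) (hs : s ∈ K2 φ) : gg φ s ∈ K2 φ := by
  simp only [K2, mem_filter, mem_univ, true_and] at hs
  simp only [gg, K2, mem_filter, mem_univ, true_and, map_mul, map_add, map_pow, map_one, hs]

lemma TT_ne {w : F} (hw : w ∈ TT φ) : w ≠ 0 := by
  rintro rfl
  simp [mem_TT] at hw

include hq hφ h6 in
lemma pairs_le : (((TT φ) ×ˢ (TT φ)).filter fun p => nrm φ p.1 = nrm φ p.2).card
    ≤ q ^ 3 + (q ^ 4 + q ^ 2 + 1) := by
  rw [← Finset.card_filter_add_card_filter_not (fun p : F × F => p.1 = p.2)]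
  refine add_le_add ?_ ?_
  · refine le_trans (Finset.card_le_card_of_injOn (t := TT φ) Prod.fst ?_ ?_)
      (card_TT_le φ q hq hφ)
    · intro p hp
      simp only [coe_filter, mem_filter, mem_product, Set.mem_ofPred_eq] at hp
      exact hp.1.1.1
    · rintro ⟨a, b⟩ hp ⟨a', b'⟩ hp' h
      simp only [coe_filter, mem_filter, Set.mem_ofPred_eq] at hp hp' h
      rw [← hp.2, ← hp'.2, h]
  · have hb : (univ.filter fun l : F => l ^ (q ^ 4 + q ^ 2 + 1) + 1 = 0).card
        ≤ q ^ 4 + q ^ 2 + 1 := by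
      refine root_bound' _ (C 1) (by rw [natDegree_C]; omega) _ ?_
      intro x hx
      simpa using hx
    refine le_trans (Finset.card_le_card_of_injOn (fun p => p.2 / p.1) ?_ ?_) hb
    · rintro ⟨a, b⟩ hp
      simp only [coe_filter, mem_filter, mem_product, Set.mem_ofPred_eq] at hp
      obtain ⟨⟨⟨ha, hb⟩, hn⟩, hne⟩ := hp
      have ha0 := TT_ne φ ha
      have hb0 := TT_ne φ hb
      simp only [coe_filter, mem_univ, true_and, Set.mem_ofPred_eq]
      have : (b / a) ^ (q ^ 4 + q ^ 2 + 1) = nrm φ b / nrm φ a := by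
        simp only [nrm, phi4 φ q hφ]
        rw [phi2 φ q hφ, phi2 φ q hφ]
        simp only [pow_add, pow_one, div_pow]
        field_simp
      rw [this, hn, div_self, CharTwo.add_self_eq_zero]
      simp [nrm, hb0]
    · have key : ∀ p : F × F, p ∈ TT φ ×ˢ TT φ → p.1 ≠ p.2 →
          p.1 * (φ (φ (φ (p.2 / p.1))) - p.2 / p.1) = 1 - φ (φ (φ (p.2 / p.1))) ∧
          φ (φ (φ (p.2 / p.1))) - p.2 / p.1 ≠ 0 := by
        rintro ⟨a, b⟩ hp hne
        rw [mem_product] at hp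
        obtain ⟨ha, hb⟩ := hp
        have ha0 := TT_ne φ ha
        simp only [TT, mem_filter, mem_univ, true_and] at ha hb
        have hl : b = b / a * a := by field_simp
        simp only at hne ⊢
        generalize b / a = l at *
        have e := hb
        rw [hl] at e
        simp only [map_mul, ha] at e
        have e1 : a * (φ (φ (φ l)) - l) = 1 - φ (φ (φ l)) := by linear_combination e
        refine ⟨e1, fun h0 => hne ?_⟩
        rw [h0, mul_zero] at e1
        have : l = 1 := by linear_combination e1 - h0
        rw [hl, this, one_mul]
      rintro ⟨a, b⟩ hp ⟨a', b'⟩ hp' h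
      simp only [coe_filter, mem_filter, Set.mem_ofPred_eq] at hp hp' h
      obtain ⟨k1, k2⟩ := key _ hp.1.1 hp.2
      obtain ⟨k1', k2'⟩ := key _ hp'.1.1 hp'.2
      simp only at k1 k2 k1' k2'
      have ha0 := TT_ne φ (mem_product.1 hp.1.1).1
      have ha0' := TT_ne φ (mem_product.1 hp'.1.1).1
      simp only at ha0 ha0'
      rw [← h] at k1'
      have haa : a = a' := mul_right_cancel₀ k2 (k1.trans k1'.symm)
      subst haa
      rw [div_left_inj' ha0] at h
      rw [h]

include hq hφ h6 in
lemma sum_sq_le : ∑ W ∈ K2 φ, (aa φ W) ^ 2 ≤ q ^ 3 + (q ^ 4 + q ^ 2 + 1) := by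
  refine le_trans (le_of_eq ?_) (pairs_le φ q hq hφ h6)
  rw [Finset.card_eq_sum_card_fiberwise (f := fun p : F × F => nrm φ p.1) (t := K2 φ)
    (fun p _ => nrm_mem φ h6 _)]
  refine Finset.sum_congr rfl fun W _ => ?_
  rw [aa, sq, ← Finset.card_product]
  congr 1
  ext ⟨a, b⟩
  simp only [mem_filter, mem_product]
  constructor
  · rintro ⟨⟨h1, h2⟩, h3, h4⟩
    exact ⟨⟨⟨h1, h3⟩, h2.trans h4.symm⟩, h2⟩
  · rintro ⟨⟨⟨h1, h3⟩, h4⟩, h2⟩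
    exact ⟨⟨h1, h2⟩, h3, h4.symm.trans h2⟩

include h6 in
lemma sum_aa : ∑ W ∈ K2 φ, aa φ W = (TT φ).card := by
  rw [Finset.card_eq_sum_card_fiberwise (f := nrm φ) (t := K2 φ) (fun p _ => nrm_mem φ h6 _)]
  rfl

include hq hφ h6 hcard in
lemma sum_var_le : ∑ W ∈ K2 φ, ((aa φ W : ℝ) - q) ^ 2 ≤ 3 * (q : ℝ) ^ 3 := by
  have h1 : (∑ W ∈ K2 φ, (aa φ W : ℝ) ^ 2) ≤ q ^ 3 + (q ^ 4 + q ^ 2 + 1) := by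
    exact_mod_cast sum_sq_le φ q hq hφ h6
  have h2 : (q : ℝ) ^ 3 ≤ ∑ W ∈ K2 φ, (aa φ W : ℝ) := by
    have := le_card_TT φ q hq hφ h6 hcard
    rw [← sum_aa φ h6] at this
    exact_mod_cast this
  have h3 : ((K2 φ).card : ℝ) ≤ (q : ℝ) ^ 2 := by exact_mod_cast card_K2_le φ q hq hφ
  have h4 : ∑ W ∈ K2 φ, ((aa φ W : ℝ) - q) ^ 2 =
      (∑ W ∈ K2 φ, (aa φ W : ℝ) ^ 2) - 2 * q * (∑ W ∈ K2 φ, (aa φ W : ℝ))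
        + (K2 φ).card * (q : ℝ) ^ 2 := by
    rw [Finset.mul_sum, ← Finset.sum_sub_distrib, ← nsmul_eq_mul, ← Finset.sum_const,
      ← Finset.sum_add_distrib]
    exact Finset.sum_congr rfl fun _ _ => by ring
  have hq' : (2 : ℝ) ≤ q := by exact_mod_cast hq
  have h5 : 2 * q * (q : ℝ) ^ 3 ≤ 2 * q * (∑ W ∈ K2 φ, (aa φ W : ℝ)) :=
    mul_le_mul_of_nonneg_left h2 (by positivity)
  have h6 : ((K2 φ).card : ℝ) * (q : ℝ) ^ 2 ≤ q ^ 2 * q ^ 2 :=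
    mul_le_mul_of_nonneg_right h3 (by positivity)
  have h7 : (q : ℝ) ^ 2 ≤ q ^ 3 := pow_le_pow_right₀ (by linarith) (by norm_num)
  have h8 : (1 : ℝ) ≤ q ^ 3 := one_le_pow₀ (by linarith)
  rw [h4]
  nlinarith

lemma gg_fib (W : F) : ((K2 φ).filter fun s => gg φ s = W).card ≤ 5 := by
  have t : (2 : F) = 0 := CharTwo.two_eq_zero
  refine root_bound' 5 (X ^ 4 + C (W ^ 2) * X + C (W ^ 2) + C (φ W) * X ^ 4) ?_ _ ?_
  · refine lt_of_le_of_lt (b := 4) ?_ (by norm_num)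
    compute_degree
  · intro r hr
    obtain ⟨h1, h2⟩ := mem_filter.1 hr
    simp only [K2, mem_filter, mem_univ, true_and] at h1
    rw [gg] at h2
    have h3 : φ W = (φ r) ^ 2 * (r + 1) := by
      rw [← h2]; simp [h1]
    simp only [eval_add, eval_mul, eval_pow, eval_X, eval_C]
    rw [h3, ← h2]
    generalize φ r = r'
    grind

include hq hφ h6 hcard in
lemma card_SS : |((SS φ).card : ℝ) - (q : ℝ) ^ 3| ≤ 4 * (q : ℝ) ^ 2 * Real.sqrt q := by
  have hK : ((K2 φ).card : ℝ) = (q : ℝ) ^ 2 := by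
    exact_mod_cast le_antisymm (card_K2_le φ q hq hφ) (le_card_K2 φ q hq hφ hcard h6)
  have h1 : (SS φ).card = ∑ s ∈ K2 φ, aa φ (gg φ s) := by
    rw [SS, Finset.card_filter, Finset.sum_product]
    refine Finset.sum_congr rfl fun s _ => ?_
    rw [aa, Finset.card_filter]
  have h2 : ((SS φ).card : ℝ) - (q : ℝ) ^ 3 = ∑ s ∈ K2 φ, ((aa φ (gg φ s) : ℝ) - q) := by
    rw [h1, Finset.sum_sub_distrib, Finset.sum_const, nsmul_eq_mul, hK]
    push_cast; ring
  have h3 : ∑ s ∈ K2 φ, ((aa φ (gg φ s) : ℝ) - q) ^ 2 ≤ 5 * (3 * (q : ℝ) ^ 3) := by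
    refine le_trans ?_ (mul_le_mul_of_nonneg_left (sum_var_le φ q hq hφ h6 hcard) (by norm_num))
    rw [← Finset.sum_fiberwise_of_maps_to (t := K2 φ) (g := gg φ) (fun s hs => gg_mem φ s hs),
      Finset.mul_sum]
    refine Finset.sum_le_sum fun W _ => ?_
    have : ∑ s ∈ (K2 φ).filter (fun s => gg φ s = W), ((aa φ (gg φ s) : ℝ) - q) ^ 2
        = ∑ s ∈ (K2 φ).filter (fun s => gg φ s = W), ((aa φ W : ℝ) - q) ^ 2 := by
      refine Finset.sum_congr rfl fun s hs => ?_
      rw [(mem_filter.1 hs).2]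
    rw [this, Finset.sum_const, nsmul_eq_mul]
    refine mul_le_mul_of_nonneg_right ?_ (sq_nonneg _)
    exact_mod_cast gg_fib φ W
  have h4 := sq_sum_le_card_mul_sum_sq (s := K2 φ) (f := fun s => (aa φ (gg φ s) : ℝ) - q)
  rw [← h2, hK] at h4
  refine abs_le_of_sq_le_sq ?_ (by positivity)
  have h5 : (4 * (q : ℝ) ^ 2 * Real.sqrt q) ^ 2 = 16 * q ^ 5 := by
    rw [mul_pow, Real.sq_sqrt (by positivity)]; ring
  rw [h5]
  have h6 : (q : ℝ) ^ 2 * ∑ s ∈ K2 φ, ((aa φ (gg φ s) : ℝ) - q) ^ 2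
      ≤ (q : ℝ) ^ 2 * (5 * (3 * (q : ℝ) ^ 3)) := mul_le_mul_of_nonneg_left h3 (by positivity)
  have h7 : (0 : ℝ) ≤ (q : ℝ) ^ 5 := by positivity
  nlinarith

end count

section link
open Finset Polynomial

variable {F : Type*} [Field F] [Fintype F] [DecidableEq F] [CharP F 2]
variable (φ : F →+* F) (q : ℕ) (hq : 2 ≤ q) (hφ : ∀ x, φ x = x ^ q)
  (h6 : ∀ x, φ (φ (φ (φ (φ (φ x))))) = x)

include hφ in
lemma F1_phi (c : F) : F1 q c = c * (1 + φ c * φ (φ (φ c))) *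
    (1 + φ (φ c) * φ (φ (φ c)) * φ (φ (φ (φ c)))) +
    (1 + φ (φ (φ c))) * (1 + φ c * φ (φ c) * φ (φ (φ c))) := by
  rw [F1_eq, phi4 φ q hφ, phi3 φ q hφ, phi2 φ q hφ, hφ]

include hφ in
lemma F2_phi (c : F) : F2 q c = F1 q c + c * φ (φ c) * ((1 + φ c * φ (φ (φ c))) *
    (c * φ c + φ (φ (φ c)) * φ (φ (φ (φ c)))) +
    (φ c + φ (φ (φ c))) * (1 + φ c * φ (φ c) * φ (φ (φ c)))) := by
  rw [F2_eq, phi4 φ q hφ, phi3 φ q hφ, phi2 φ q hφ, hφ]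

include hφ in
lemma F3_phi (c : F) : F3 q c = 1 + c * φ c * φ (φ c) := by
  rw [F3, phi2 φ q hφ, hφ]
  simp only [pow_add, pow_one]; ring

lemma char_two_eq {a b : F} (h : a + b = 0) : a = b := CharTwo.add_eq_zero.1 h

include hφ h6 in
lemma forward (c : F) (hc : c ∈ frakC q F) :
    ∃ p ∈ SS φ, p.2 / p.1 = c := by
  have t : (2 : F) = 0 := CharTwo.two_eq_zero
  obtain ⟨hc2, hF1, hF2, hF⟩ := hc
  have hF3 : F3 q c ≠ 0 := fun h => hF (by rw [h]; ring)
  rw [F2_phi φ q hφ, hF1, zero_add] at hF2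
  rw [F1_phi φ q hφ] at hF1
  rw [F3_phi φ q hφ] at hF3
  rw [← phi2 φ q hφ] at hc2
  have hF1' := char_two_eq hF1
  have inj : ∀ {x : F}, φ x = 0 → x = 0 := fun {x} h => (map_eq_zero φ).1 h
  have hN1 : 1 + φ c * φ (φ c) * φ (φ (φ c)) ≠ 0 := by
    intro h
    apply hF3
    apply inj
    simpa using h
  have hc0 : c ≠ 0 := by
    rintro rfl
    simp at hc2
  have hu : 1 + φ (φ (φ c)) ≠ 0 := by
    intro h
    have h' : 1 + c = 0 := by
      apply inj; apply inj; apply inj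
      simpa using h
    have : c = 1 := (char_two_eq h').symm
    rw [this] at hc2
    simp at hc2
  have hM : 1 + φ c * φ (φ (φ c)) ≠ 0 := by
    intro h
    rw [h, mul_zero, zero_mul] at hF1'
    exact mul_ne_zero hu hN1 hF1'.symm
  obtain ⟨k, hk⟩ : ∃ k, k * (1 + φ c * φ (φ (φ c))) = 1 + φ c * φ (φ c) * φ (φ (φ c)) :=
    ⟨_, div_mul_cancel₀ _ hM⟩
  have hk0 : k ≠ 0 := by
    rintro rfl
    rw [zero_mul] at hk
    exact hN1 hk.symm
  obtain ⟨w1, w2, w3⟩ := window hc0 (by simpa using hc0) (by simpa using hc0) hM hk hF1' hF2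
  have w3' := congrArg (fun x => φ (φ x)) w3
  simp only [map_mul, map_add, map_one, h6] at w3'
  have hkk : φ (φ k) = k := by
    apply mul_left_cancel₀ hu
    rw [← w3', ← w1]
  have hk' := congrArg φ hk
  simp only [map_mul, map_add, map_one] at hk'
  have hM' : 1 + φ (φ c) * φ (φ (φ (φ c))) ≠ 0 := by
    intro h
    apply hM
    apply inj
    simpa using h
  obtain ⟨l1, l2⟩ := lin_alg hM' w1 hk'
  have hl0 : φ k ≠ 0 := by simpa using hk0
  refine ⟨(k⁻¹, c * k⁻¹), ?_, by field_simp⟩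
  refine mem_filter.2 ⟨mem_product.2 ⟨mem_filter.2 ⟨mem_univ _, ?_⟩, (mem_TT φ _).2 ?_⟩, ?_⟩ <;>
    simp only [nrm, gg, map_mul, map_inv₀, hkk]
  · generalize φ (φ (φ c)) = D at *
    generalize φ k = l at *
    field_simp
    linear_combination l1
  · generalize φ (φ (φ (φ c))) = E at *
    generalize φ (φ (φ c)) = D at *
    generalize φ (φ c) = C at *
    generalize φ k = l at *
    field_simp
    have : k * (D + l) = c * l := by linear_combination l1 - c * l * t + k * l * t
    linear_combination k * l2 - C * E * this

include hφ h6 in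
lemma backward (p : F × F) (hp : p ∈ SS φ) :
    F1 q (p.2 / p.1) = 0 ∧ F2 q (p.2 / p.1) = 0 := by
  have t : (2 : F) = 0 := CharTwo.two_eq_zero
  obtain ⟨s, w⟩ := p
  simp only [SS, mem_filter, mem_product, K2, mem_univ, true_and] at hp
  obtain ⟨⟨hs, hw⟩, hn⟩ := hp
  have hw0 := TT_ne φ hw
  have hw3 : φ (φ (φ w)) = w + 1 := by simpa [TT] using hw
  have hw4 : φ (φ (φ (φ w))) = φ w + 1 := by rw [hw3]; simp
  have hs0 : s ≠ 0 := by
    rintro rfl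
    simp [nrm, gg, hw0] at hn
  have hs0' : φ s ≠ 0 := by simpa using hs0
  have hn' := congrArg φ hn
  simp only [nrm, gg, map_mul, map_add, map_one, map_pow, hs, hw3] at hn hn'
  simp only
  have hb := back_alg (A := w / s) (B := φ w / φ s) (C := φ (φ w) / s) (D := (w + 1) / φ s)
    (E := (φ w + 1) / s) (k := s⁻¹) (l := (φ s)⁻¹) (inv_ne_zero hs0')
    (by
      generalize φ (φ w) = C at *
      generalize φ w = B at *
      generalize φ s = s' at *
      field_simp
      linear_combination hn')
    (by
      generalize φ (φ w) = C at *
      generalize φ w = B at *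
      generalize φ s = s' at *
      field_simp
      linear_combination hn + C * (B + 1) * t)
    (by
      generalize φ s = s' at *
      field_simp
      linear_combination w * t)
    (by
      generalize φ w = B at *
      generalize φ s = s' at *
      field_simp
      linear_combination B * t)
  rw [F2_phi φ q hφ, F1_phi φ q hφ]
  simp only [map_div₀, hs, hw3, map_add, map_one]
  rw [hb.1, hb.2]
  simp [CharTwo.add_self_eq_zero]

lemma SS_inj (c : F) (hc : c ≠ 1) (p : F × F) (hp : p ∈ SS φ) (hpc : p.2 / p.1 = c) :
    p.1 * (φ (φ (φ c)) * nrm φ c + c) = 1 + φ (φ (φ c)) ∧ φ (φ (φ c)) * nrm φ c + c ≠ 0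
      ∧ p.2 = c * p.1 := by
  have t : (2 : F) = 0 := CharTwo.two_eq_zero
  obtain ⟨s, w⟩ := p
  simp only [SS, mem_filter, mem_product, K2, mem_univ, true_and] at hp
  obtain ⟨⟨hs, hw⟩, hn⟩ := hp
  have hw0 := TT_ne φ hw
  have hw3 : φ (φ (φ w)) = w + 1 := by simpa [TT] using hw
  have hs0 : s ≠ 0 := by
    rintro rfl
    simp [nrm, gg, hw0] at hn
  simp only at hpc ⊢
  have hwc : w = c * s := by rw [← hpc]; field_simp
  rw [hwc] at hw3 hn
  simp only [map_mul, hs] at hw3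
  have hns : nrm φ c * s = φ s + 1 := by
    have : s ^ 2 * (nrm φ c * s) = s ^ 2 * (φ s + 1) := by
      rw [← gg, ← hn]
      simp only [nrm, map_mul, hs]
      ring
    exact mul_left_cancel₀ (pow_ne_zero 2 hs0) this
  have e : s * (φ (φ (φ c)) * nrm φ c + c) = 1 + φ (φ (φ c)) := by
    linear_combination φ (φ (φ c)) * hns + hw3 + c * s * t
  refine ⟨e, ?_, hwc⟩
  intro h0
  rw [h0, mul_zero] at e
  have h1 : φ (φ (φ (1 + c))) = 0 := by simpa using e.symm
  simp only [map_eq_zero] at h1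
  exact hc (char_two_eq h1).symm

def Bad (q : ℕ) (F : Type*) [Field F] [Fintype F] [DecidableEq F] : Finset F :=
  (((univ.filter fun c => c ^ q ^ 2 = c) ∪ univ.filter fun c => F3 q c = 0)
    ∪ univ.filter fun c => F4 q c = 0) ∪ univ.filter fun c => F5 q c = 0

include hq in
lemma Bad_card : (Bad q F).card ≤ 20 * q ^ 2 := by
  have hq2 : 2 * q ≤ q ^ 2 := by nlinarith
  have b1 : (univ.filter fun c : F => c ^ q ^ 2 = c).card ≤ q ^ 2 := by
    refine root_bound' (q ^ 2) X ?_ _ ?_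
    · simp; nlinarith
    · intro x hx
      rw [(mem_filter.1 hx).2, eval_X, CharTwo.add_self_eq_zero]
  have b2 : (univ.filter fun c : F => F3 q c = 0).card ≤ q ^ 2 + q + 1 := by
    refine root_bound' _ (C 1) (by rw [natDegree_C]; omega) _ ?_
    intro x hx
    have := (mem_filter.1 hx).2
    simpa [F3] using this
  have b3 : (univ.filter fun c : F => F4 q c = 0).card ≤ 6 * q ^ 2 := by
    let P : F[X] := X ^ (2 * q ^ 2 + q + 4) + X ^ (3 * q ^ 2 + 2 * q + 3) + X ^ (q ^ 2 + 2 * q + 3)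
      + X ^ (3 * q ^ 2 + q + 3) + X ^ (q ^ 2 + q + 3) + X ^ (2 * q ^ 2 + 3) + X ^ (q ^ 2 + 3)
      + X ^ (4 * q ^ 2 + q + 2) + X ^ (q + 2) + X ^ (3 * q ^ 2 + 2) + X ^ 2
      + X ^ (3 * q ^ 2 + 2 * q + 1) + X ^ (q ^ 2 + 2 * q + 1) + X ^ (3 * q ^ 2 + q + 1)
      + X ^ (q ^ 2 + q + 1) + X ^ (3 * q ^ 2 + 1) + X + X ^ (2 * q ^ 2 + q) + X ^ (2 * q ^ 2)
      + X ^ (q ^ 2)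
    have hP : P.coeff 1 = 1 := by
      have hq1 : q ^ 2 ≠ 1 := by nlinarith
      have hq0 : q ≠ 0 := by omega
      simp only [P, coeff_add, coeff_X_pow, coeff_X]
      rw [if_neg (by omega), if_neg (by omega), if_neg (by omega), if_neg (by omega),
        if_neg (by omega), if_neg (by omega), if_neg (by omega), if_neg (by omega),
        if_neg (by omega), if_neg (by omega), if_neg (by omega), if_neg (by omega),
        if_neg (by omega), if_neg (by omega), if_neg (by omega), if_neg (by omega),
        if_pos trivial, if_neg (by omega), if_neg (by omega), if_neg (by omega)]
      simp
    refine root_bound P ?_ _ ?_ _ ?_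
    · intro h
      rw [h] at hP
      simp at hP
    · refine natDegree_le_iff_coeff_eq_zero.2 fun N hN => ?_
      have hq4 : 4 ≤ q ^ 2 := by nlinarith
      simp only [P, coeff_add, coeff_X_pow, coeff_X]
      rw [if_neg (by omega), if_neg (by omega), if_neg (by omega), if_neg (by omega),
        if_neg (by omega), if_neg (by omega), if_neg (by omega), if_neg (by omega),
        if_neg (by omega), if_neg (by omega), if_neg (by omega), if_neg (by omega),
        if_neg (by omega), if_neg (by omega), if_neg (by omega), if_neg (by omega),
        if_neg (by omega), if_neg (by omega), if_neg (by omega), if_neg (by omega)]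
      simp
    · intro x hx
      have := (mem_filter.1 hx).2
      simpa [F4, P] using this
  have b4 : (univ.filter fun c : F => F5 q c = 0).card ≤ 4 * q ^ 2 := by
    let P : F[X] := X ^ (2 * q ^ 2 + q + 2) + X ^ (q ^ 2 + q + 2) + X ^ (2 * q ^ 2 + 2)
      + X ^ (2 * q ^ 2 + q + 1) + X ^ (q ^ 2 + q + 1) + 1
    refine root_bound P ?_ _ ?_ _ ?_
    · intro h
      have : P.eval 0 = 0 := by rw [h]; simp
      simp [P] at this
    · have hq4 : 4 ≤ q ^ 2 := by nlinarith
      refine natDegree_le_iff_coeff_eq_zero.2 fun N hN => ?_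
      simp only [P, coeff_add, coeff_X_pow, coeff_one]
      rw [if_neg (by omega), if_neg (by omega), if_neg (by omega), if_neg (by omega),
        if_neg (by omega), if_neg (by omega)]
      simp
    · intro x hx
      have := (mem_filter.1 hx).2
      simpa [F5, P] using this
  have u1 := card_union_le (((univ.filter fun c : F => c ^ q ^ 2 = c) ∪
    univ.filter fun c => F3 q c = 0) ∪ univ.filter fun c => F4 q c = 0)
    (univ.filter fun c => F5 q c = 0)
  have u2 := card_union_le ((univ.filter fun c : F => c ^ q ^ 2 = c) ∪
    univ.filter fun c => F3 q c = 0) (univ.filter fun c => F4 q c = 0)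
  have u3 := card_union_le (univ.filter fun c : F => c ^ q ^ 2 = c)
    (univ.filter fun c => F3 q c = 0)
  rw [Bad]
  have : 1 ≤ q := by omega
  omega

open Classical in
include hφ h6 in
lemma upper : (univ.filter fun c : F => c ∈ frakC q F).card ≤ (SS φ).card := by
  refine le_trans (card_le_card ?_) (card_image_le (s := SS φ) (f := fun p => p.2 / p.1))
  intro c hc
  rw [mem_image]
  exact forward φ q hφ h6 c (mem_filter.1 hc).2

open Classical in
include hq hφ h6 in
lemma lower : (SS φ).card ≤ (univ.filter fun c : F => c ∈ frakC q F).card + 21 * q ^ 2 := by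
  have h1 : ((SS φ).filter fun p => p.2 / p.1 = 1).card ≤ q ^ 2 := by
    refine le_trans (Finset.card_le_card_of_injOn (t := K2 φ) Prod.fst ?_ ?_)
      (card_K2_le φ q hq hφ)
    · intro p hp
      have := (mem_filter.1 (mem_coe.1 hp)).1
      rw [SS] at this
      exact (mem_product.1 (mem_filter.1 this).1).1
    · have key : ∀ p ∈ (SS φ).filter (fun p => p.2 / p.1 = 1), p.2 = p.1 := by
        intro p hp
        have h := (mem_filter.1 hp).2
        have h0 : p.1 ≠ 0 := by
          intro h0
          rw [h0] at h
          simp at h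
        field_simp at h
        exact h
      rintro ⟨a, b⟩ hp ⟨a', b'⟩ hp' h
      have e1 := key _ hp
      have e2 := key _ hp'
      simp only at e1 e2 h
      rw [e1, e2, h]
  have h2 : ((SS φ).filter fun p => ¬ p.2 / p.1 = 1).card ≤
      ((univ.filter fun c : F => c ∈ frakC q F) ∪ Bad q F).card := by
    refine Finset.card_le_card_of_injOn (fun p => p.2 / p.1) ?_ ?_
    · intro p hp
      obtain ⟨hp, _⟩ := mem_filter.1 (mem_coe.1 hp)
      obtain ⟨e1, e2⟩ := backward φ q hφ h6 p hp
      rw [mem_coe, mem_union]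
      by_cases g1 : (p.2 / p.1) ^ q ^ 2 = p.2 / p.1
      · exact Or.inr (by simp [Bad, g1])
      by_cases g2 : F3 q (p.2 / p.1) = 0
      · exact Or.inr (by simp [Bad, g2])
      by_cases g3 : F4 q (p.2 / p.1) = 0
      · exact Or.inr (by simp [Bad, g3])
      by_cases g4 : F5 q (p.2 / p.1) = 0
      · exact Or.inr (by simp [Bad, g4])
      refine Or.inl (mem_filter.2 ⟨mem_univ _, ?_⟩)
      exact ⟨g1, e1, e2, mul_ne_zero (mul_ne_zero g2 g3) g4⟩
    · intro p hp p' hp' h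
      obtain ⟨m, n⟩ := mem_filter.1 (mem_coe.1 hp)
      obtain ⟨m', _⟩ := mem_filter.1 (mem_coe.1 hp')
      obtain ⟨a1, a2, a3⟩ := SS_inj φ _ n p m rfl
      obtain ⟨b1, _, b3⟩ := SS_inj φ _ n p' m' h.symm
      have e : p.1 = p'.1 := mul_right_cancel₀ a2 (a1.trans b1.symm)
      refine Prod.ext e ?_
      rw [a3, b3, e]
  have h3 := card_union_le (univ.filter fun c : F => c ∈ frakC q F) (Bad q F)
  have h4 := Bad_card (F := F) q hq
  have h5 := Finset.card_filter_add_card_filter_not (s := SS φ) (fun p : F × F => p.2 / p.1 = 1)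
  omega

end link

theorem statement2 :
    ∃ C : ℝ, 0 < C ∧ ∃ Q : ℕ, ∀ (e q : ℕ), 1 ≤ e → q = 2 ^ e → Q ≤ q →
      ∀ (F : Type) [Field F] [Fintype F], Fintype.card F = q ^ 6 →
        (frakC q F).Nonempty ∧
          |((frakC q F).ncard : ℝ) - (q : ℝ) ^ 3| ≤ C * (q : ℝ) ^ 2 * Real.sqrt q := by
  refine ⟨25, by norm_num, 626, ?_⟩
  intro e q he hqe hQ F _ _ hcard
  classical
  have hq : 2 ≤ q := by omega
  have : Fact (Nat.Prime 2) := ⟨Nat.prime_two⟩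
  have : CharP F 2 := by
    refine charP_of_card_eq_prime_pow (f := e * 6) ?_
    rw [hcard, hqe, ← pow_mul]
  let φ : F →+* F := iterateFrobenius F 2 e
  have hφ : ∀ x, φ x = x ^ q := by
    intro x
    rw [hqe]
    exact iterateFrobenius_def 2 e x
  have h6 : ∀ x, φ (φ (φ (φ (φ (φ x))))) = x := by
    intro x
    rw [phi3 φ q hφ, phi3 φ q hφ, ← pow_mul, ← pow_add, ← hcard]
    exact FiniteField.pow_card x
  have hN : (frakC q F).ncard = (Finset.univ.filter fun c : F => c ∈ frakC q F).card := by
    rw [← Set.ncard_coe_finset]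
    congr 1
    ext c
    simp
  have u := upper φ q hφ h6
  have l := lower φ q hq hφ h6
  have s := card_SS φ q hq hφ h6 hcard
  rw [← hN] at u l
  have u' : ((frakC q F).ncard : ℝ) ≤ (SS φ).card := by exact_mod_cast u
  have l' : ((SS φ).card : ℝ) ≤ (frakC q F).ncard + 21 * (q : ℝ) ^ 2 := by exact_mod_cast l
  have hqr : (626 : ℝ) ≤ q := by exact_mod_cast hQ
  have hsq : (1 : ℝ) ≤ Real.sqrt q := Real.one_le_sqrt.2 (by linarith)
  have hq2 : (q : ℝ) ^ 2 ≤ (q : ℝ) ^ 2 * Real.sqrt q := le_mul_of_one_le_right (by positivity) hsq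
  have main : |((frakC q F).ncard : ℝ) - (q : ℝ) ^ 3| ≤ 25 * (q : ℝ) ^ 2 * Real.sqrt q := by
    rw [abs_le] at s ⊢
    constructor <;> nlinarith [s.1, s.2]
  refine ⟨?_, main⟩
  by_contra hne
  rw [Set.not_nonempty_iff_eq_empty] at hne
  rw [hne] at main
  simp only [Set.ncard_empty, Nat.cast_zero, zero_sub, abs_neg] at main
  rw [abs_of_nonneg (by positivity)] at main
  have h1 : Real.sqrt q * Real.sqrt q = q := Real.mul_self_sqrt (by positivity)
  have h2 : (25 : ℝ) < Real.sqrt q := by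
    rw [Real.lt_sqrt (by norm_num)]
    linarith
  have h3 : (q : ℝ) ^ 3 = (q : ℝ) ^ 2 * Real.sqrt q * Real.sqrt q := by
    rw [mul_assoc, h1]; ring
  have h4 : 0 < (q : ℝ) ^ 2 * Real.sqrt q := by positivity
  nlinarith
end
end

section
/- Let q be a power of 2, let F be a finite field with q^6 elements, and let c ∈ F satisfy c^{q^2} ≠ c, F1(c) = 0, F2(c) = 0 and F3(c) ≠ 0. Set α = (c^{q^2+q+1}+1)^{q^3} (which is nonzero), β = A3(c)/α^q and γ = A4(c)/α. Then in the polynomial ring F[X,Y,Z] one has the identity A1(c)·Z + A1(c)^q·X + A2(c)·X·Y·Z + A3(c)·Y·Z^2 + (c^{q^2+q+1}+1)^{q^4}·X·Y^2·Z^2 + A4(c)·X^2·Y + (c^{q^2+q+1}+1)^{q^3}·X^2·Y^2·Z = (α·X + α^q·Z)·(X·Y + β)·(Y·Z + γ). -/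
noncomputable section

def A1 (q : ℕ) {F : Type*} [Field F] (c : F) : F :=
  c ^ (q ^ 5 + q ^ 4 + q ^ 3 + q ^ 2 + 2 * q + 1) + c ^ (q ^ 5 + q ^ 3 + q ^ 2 + 2 * q + 1)
    + c ^ (q ^ 2 + 2 * q + 1) + c ^ (2 * q + 1) + c ^ (q ^ 4 + q ^ 3 + q ^ 2 + q + 1)
    + c ^ (q ^ 3 + q ^ 2 + q + 1) + c ^ (q ^ 5 + q ^ 4 + q ^ 2 + q + 1)
    + c ^ (q ^ 5 + q ^ 2 + q + 1) + c ^ (q ^ 4 + q ^ 2 + 1) + c + c ^ (q ^ 2 + 2 * q)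
    + c ^ (q ^ 5 + q ^ 4 + q ^ 3 + 2 * q) + c ^ (q ^ 5 + q ^ 3 + 2 * q) + c ^ (2 * q)
    + c ^ (q ^ 4 + q ^ 3 + q) + c ^ (q ^ 3 + q) + c ^ (q ^ 5 + q ^ 4 + q) + c ^ (q ^ 5 + q)
    + c ^ (q ^ 2) + c ^ (q ^ 4)

def A2 (q : ℕ) {F : Type*} [Field F] (c : F) : F :=
  c ^ (q ^ 5 + q ^ 4 + q ^ 3 + q ^ 2 + q + 1) + c ^ (q + 1) + c ^ (q ^ 4 + q ^ 2 + 1)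
    + c ^ (q ^ 5 + 1) + c ^ (q ^ 2 + q) + c ^ (q ^ 5 + q ^ 3 + q) + c ^ (q ^ 3 + q ^ 2)
    + c ^ (q ^ 4 + q ^ 3) + c ^ (q ^ 5 + q ^ 4) + 1

def A3 (q : ℕ) {F : Type*} [Field F] (c : F) : F :=
  c ^ (q ^ 5 + q ^ 4 + q + 1) + c ^ (q ^ 5 + q + 1) + c ^ (q + 1) + c ^ (q ^ 4 + 1)
    + c ^ q + 1

def A4 (q : ℕ) {F : Type*} [Field F] (c : F) : F :=
  c ^ (q ^ 5 + q ^ 4 + q ^ 3 + q ^ 2) + c ^ (q ^ 4 + q ^ 3 + q ^ 2) + c ^ (q ^ 3 + q ^ 2)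
    + c ^ (q ^ 2) + c ^ (q ^ 5 + q ^ 3) + 1

theorem s7_dummy_two {F : Type} [Field F] [CharP F 2] : (2 : F) = 0 := CharTwo.two_eq_zero

theorem s7_g3 {F : Type} [Field F] [CharP F 2] (X Z U w w' : F) (hw : w ≠ 0) (hw' : w' ≠ 0)
    (h3 : X*Z*U = w'^2*(1+w))
    (h12 : X+Z+U+X*Z+X*U+Z*U = 1+w^2+w'^2+w^2*w'+w'^2*w)
    (x y z t u v : F) (hx : x = X/w') (hz : z = Z/w') (hu : u=U/w')
    (hy : y=(1+U)/w) (ht : t = (1+X)/w) (hv : v=(1+Z)/w) :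
    x*y*u*v+x*y*v+x*y+x*u+y+1 = (u*v*x+1)*(y+w+w'*x*y*z) := by
  subst hx hz hu hy ht hv
  field_simp
  grind

theorem s7_g4 {F : Type} [Field F] [CharP F 2] (X Z U w w' : F) (hw : w ≠ 0) (hw' : w' ≠ 0)
    (h3 : X*Z*U = w'^2*(1+w))
    (h12 : X+Z+U+X*Z+X*U+Z*U = 1+w^2+w'^2+w^2*w'+w'^2*w)
    (x y z t u v : F) (hx : x = X/w') (hz : z = Z/w') (hu : u=U/w')
    (hy : y=(1+U)/w) (ht : t = (1+X)/w) (hv : v=(1+Z)/w) :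
    z*t*u*v+z*t*u+z*t+z+t*v+1 = (t*u*v+1)*(z+w'+w*y*z*t) := by
  subst hx hz hu hy ht hv
  field_simp
  grind

theorem s7_g2 {F : Type} [Field F] [CharP F 2] (X Z U w w' : F) (hw : w ≠ 0) (hw' : w' ≠ 0)
    (h3 : X*Z*U = w'^2*(1+w))
    (h12 : X+Z+U+X*Z+X*U+Z*U = 1+w^2+w'^2+w^2*w'+w'^2*w)
    (x y z t u v : F) (hx : x = X/w') (hz : z = Z/w') (hu : u=U/w')
    (hy : y=(1+U)/w) (ht : t = (1+X)/w) (hv : v=(1+Z)/w) :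
    x*y*z*t*u*v+x*y+x*z*u+x*v+y*z+y*t*v+z*t+t*u+u*v+1=(t*u*v+1)*(y+w+w'*x*y*z)+(u*v*x+1)*(z+w'+w*y*z*t) := by
  subst hx hz hu hy ht hv
  field_simp
  grind

theorem s7_g1 {F : Type} [Field F] [CharP F 2] (X Z U w w' : F) (hw : w ≠ 0) (hw' : w' ≠ 0)
    (h3 : X*Z*U = w'^2*(1+w))
    (h12 : X+Z+U+X*Z+X*U+Z*U = 1+w^2+w'^2+w^2*w'+w'^2*w)
    (x y z t u v : F) (hx : x = X/w') (hz : z = Z/w') (hu : u=U/w')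
    (hy : y=(1+U)/w) (ht : t = (1+X)/w) (hv : v=(1+Z)/w) :
    x*y^2*z*t*u*v + x*y^2*z*t*v + x*y^2*z + x*y^2 + x*y*z*t*u+x*y*z*t+x*y*z*u*v+x*y*z*v+x*z*u+x+y^2*z+y^2*t*u*v+y^2*t*v+y^2+y*t*u+y*t+y*u*v+y*v+z+u = (u*v*x+1)*(y+w+w'*x*y*z)*(z+w'+w*y*z*t) := by
  subst hx hz hu hy ht hv
  field_simp
  grind

theorem s7_g1q {F : Type} [Field F] [CharP F 2] (X Z U w w' : F) (hw : w ≠ 0) (hw' : w' ≠ 0)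
    (h3 : X*Z*U = w'^2*(1+w))
    (h12 : X+Z+U+X*Z+X*U+Z*U = 1+w^2+w'^2+w^2*w'+w'^2*w)
    (x y z t u v : F) (hx : x = X/w') (hz : z = Z/w') (hu : u=U/w')
    (hy : y=(1+U)/w) (ht : t = (1+X)/w) (hv : v=(1+Z)/w) :
    y*z^2*t*u*v*x + y*z^2*t*u*x + y*z^2*t + y*z^2 + y*z*t*u*v+y*z*t*u+y*z*t*v*x+y*z*t*x+y*t*v+y+z^2*t+z^2*u*v*x+z^2*u*x+z^2+z*u*v+z*u+z*v*x+z*x+t+v = (t*u*v+1)*(y+w+w'*x*y*z)*(z+w'+w*y*z*t) := by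
  subst hx hz hu hy ht hv
  field_simp
  grind

theorem s7_step {F : Type} [Field F] [CharP F 2] (x y z t u : F) (hz : z ≠ 0) (ht : t ≠ 0)
    (a0 : x*y*z+1 ≠ 0) (a1 : y*z*t+1 ≠ 0) (a2 : z*t*u+1 ≠ 0)
    (h1 : x*(y*t+1)*(z*t*u+1) + (t+1)*(y*z*t+1) = 0)
    (h2 : (x*y*z+1)*(x*(y*t+1)+(y*z*t+1)) + t*(1+x*z)*(y*z*t+1) = 0) :
    (1+x*z)/(x*y*z+1) = (1+z*u)/(z*t*u+1) := by
  have h0 := s7_dummy_two (F := F)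
  rw [div_eq_div_iff a0 a2]
  apply mul_left_cancel₀ (mul_ne_zero a1 ht)
  linear_combination (z*t*u+1)*h2 - (x*y*z+1)*h1 - (y*z^2*t*x*u + y*z^2*t^2*u + y^2*z^3*t^2*x*u + z*t*u)*h0

theorem s7_core {F : Type} [Field F] [CharP F 2] (φ : F →+* F) (x y z t u v : F)
    (px : φ x = y) (py : φ y = z) (pz : φ z = t) (pt : φ t = u) (pu : φ u = v) (pv : φ v = x)
    (hxz : z ≠ x) (a0 : x*y*z+1 ≠ 0)
    (h1 : x*(y*t+1)*(z*t*u+1) + (t+1)*(y*z*t+1) = 0)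
    (h2 : (x*y*z+1)*(x*(y*t+1)+(y*z*t+1)) + t*(1+x*z)*(y*z*t+1) = 0) :
    u*v*x+1 ≠ 0 ∧ t*u*v+1 ≠ 0 ∧ ∃ b g : F,
      x*y*u*v+x*y*v+x*y+x*u+y+1 = (u*v*x+1)*b ∧
      z*t*u*v+z*t*u+z*t+z+t*v+1 = (t*u*v+1)*g ∧
      x*y*z*t*u*v+x*y+x*z*u+x*v+y*z+y*t*v+z*t+t*u+u*v+1=(t*u*v+1)*b+(u*v*x+1)*g ∧
      x*y^2*z*t*u*v + x*y^2*z*t*v + x*y^2*z + x*y^2 + x*y*z*t*u+x*y*z*t+x*y*z*u*v+x*y*z*v+x*z*u+x+y^2*z+y^2*t*u*v+y^2*t*v+y^2+y*t*u+y*t+y*u*v+y*v+z+u = (u*v*x+1)*b*g ∧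
      y*z^2*t*u*v*x + y*z^2*t*u*x + y*z^2*t + y*z^2 + y*z*t*u*v+y*z*t*u+y*z*t*v*x+y*z*t*x+y*t*v+y+z^2*t+z^2*u*v*x+z^2*u*x+z^2+z*u*v+z*u+z*v*x+z*x+t+v = (t*u*v+1)*b*g := by
  have h0 := s7_dummy_two (F := F)
  have inj : ∀ s : F, s ≠ 0 → φ s ≠ 0 := fun s hs => (map_ne_zero φ).2 hs
  have a1 : y*z*t+1 ≠ 0 := by simpa [px, py, pz] using inj _ a0
  have a2 : z*t*u+1 ≠ 0 := by simpa [pt, py, pz] using inj _ a1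
  have a3 : t*u*v+1 ≠ 0 := by simpa [pt, pu, pz] using inj _ a2
  have a4 : u*v*x+1 ≠ 0 := by simpa [pt, pu, pv] using inj _ a3
  have hx : x ≠ 0 := by
    rintro rfl
    apply hxz
    rw [← py, ← px, map_zero, map_zero]
  have hy : y ≠ 0 := px ▸ inj _ hx
  have hz : z ≠ 0 := py ▸ inj _ hy
  have ht : t ≠ 0 := pz ▸ inj _ hz
  have hu : u ≠ 0 := pt ▸ inj _ ht
  have hs := s7_step x y z t u hz ht a0 a1 a2 h1 h2
  obtain ⟨w, hwd⟩ : ∃ w, w = (1+x*z)/(x*y*z+1) := ⟨_, rfl⟩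
  obtain ⟨w', hwd'⟩ : ∃ w', w' = (1+y*t)/(y*z*t+1) := ⟨_, rfl⟩
  have pw : φ w = w' := by rw [hwd, hwd']; simp [px, py, pz]
  have pw' : φ w' = w := by rw [hwd, hs, hwd']; simp [pt, py, pz]
  have r0 : w*(x*y*z+1) = 1+x*z := by rw [hwd]; exact div_mul_cancel₀ _ a0
  have r2 : w*(z*t*u+1) = 1+z*u := by rw [hwd, hs]; exact div_mul_cancel₀ _ a2
  have r1 : w'*(y*z*t+1) = 1+y*t := by rw [hwd']; exact div_mul_cancel₀ _ a1
  have s0 : x*w'*(z*t*u+1) = t+1 := by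
    apply mul_left_cancel₀ a1
    linear_combination x*(z*t*u+1)*r1 + h1 - (t+1)*(y*z*t+1)*h0
  have hw : w ≠ 0 := by
    intro hw
    have hw' : w' = 0 := by rw [← pw, hw, map_zero]
    have t1 : t = 1 := by
      rw [hw'] at s0
      linear_combination -s0 + (-1)*h0
    have u1 : u = 1 := by rw [← pt, t1, map_one]
    have v1 : v = 1 := by rw [← pu, u1, map_one]
    have x1 : x = 1 := by rw [← pv, v1, map_one]
    have y1 : y = 1 := by rw [← px, x1, map_one]
    have z1 : z = 1 := by rw [← py, y1, map_one]
    exact hxz (z1.trans x1.symm)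
  have hw' : w' ≠ 0 := pw ▸ inj _ hw
  have p : x*z*u*w' = 1+w := by
    have : 1+z*u ≠ 0 := r2 ▸ mul_ne_zero hw a2
    apply mul_left_cancel₀ this
    linear_combination (-x*z*u*w')*r2 + z*u*w*s0 + r2 - w*h0
  have p' : y*t*v*w = 1+w' := by simpa [px, pz, pu, pw, pw'] using congrArg φ p
  have e1 : w*y = 1+w'*u := by
    apply mul_left_cancel₀ (mul_ne_zero hx hz)
    linear_combination r0 - p - w*h0
  have e3 : w*v = 1+w'*z := by
    have : w'*z = 1+w*v := by simpa [py, pu, pw, pw'] using congrArg φ e1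
    linear_combination -this - h0
  have e2 : w*t = 1+w'*x := by simpa [pz, pv, pw, pw'] using congrArg φ ((by linear_combination -e3 - h0) : w'*z = 1+w*v)
  have h3 : (w'*x)*(w'*z)*(w'*u) = w'^2*(1+w) := by linear_combination w'^2*p
  have h12 : (w'*x)+(w'*z)+(w'*u)+(w'*x)*(w'*z)+(w'*x)*(w'*u)+(w'*z)*(w'*u)
      = 1+w^2+w'^2+w^2*w'+w'^2*w := by
    have e : (1+w'*x)*(1+w'*z)*(1+w'*u) = w^2*(1+w') := by
      rw [← e1, ← e2, ← e3]; linear_combination w^2*p'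
    linear_combination e - h3 - (1+w'^2*(1+w))*h0
  have hx' : x = (w'*x)/w' := by field_simp
  have hz' : z = (w'*z)/w' := by field_simp
  have hu' : u = (w'*u)/w' := by field_simp
  have hy' : y = (1+w'*u)/w := by rw [← e1]; field_simp
  have ht' : t = (1+w'*x)/w := by rw [← e2]; field_simp
  have hv' : v = (1+w'*z)/w := by rw [← e3]; field_simp
  exact ⟨a4, a3, (y+w+w'*x*y*z), (z+w'+w*y*z*t),
    s7_g3 _ _ _ w w' hw hw' h3 h12 x y z t u v hx' hz' hu' hy' ht' hv',
    s7_g4 _ _ _ w w' hw hw' h3 h12 x y z t u v hx' hz' hu' hy' ht' hv',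
    s7_g2 _ _ _ w w' hw hw' h3 h12 x y z t u v hx' hz' hu' hy' ht' hv',
    s7_g1 _ _ _ w w' hw hw' h3 h12 x y z t u v hx' hz' hu' hy' ht' hv',
    s7_g1q _ _ _ w w' hw hw' h3 h12 x y z t u v hx' hz' hu' hy' ht' hv'⟩


open MvPolynomial in
theorem statement7 (e q : ℕ) (he : 1 ≤ e) (hq : q = 2 ^ e)
    (F : Type) [Field F] [Fintype F] (hF : Fintype.card F = q ^ 6)
    (c : F) (hc2 : c ^ (q ^ 2) ≠ c) (h1 : F1 q c = 0) (h2 : F2 q c = 0) (h3 : F3 q c ≠ 0) :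
    let α : F := (c ^ (q ^ 2 + q + 1) + 1) ^ (q ^ 3)
    let β : F := A3 q c / α ^ q
    let γ : F := A4 q c / α
    let X : MvPolynomial (Fin 3) F := MvPolynomial.X 0
    let Y : MvPolynomial (Fin 3) F := MvPolynomial.X 1
    let Z : MvPolynomial (Fin 3) F := MvPolynomial.X 2
    α ≠ 0 ∧
      C (A1 q c) * Z + C ((A1 q c) ^ q) * X + C (A2 q c) * (X * Y * Z)
          + C (A3 q c) * (Y * Z ^ 2)
          + C ((c ^ (q ^ 2 + q + 1) + 1) ^ (q ^ 4)) * (X * Y ^ 2 * Z ^ 2)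
          + C (A4 q c) * (X ^ 2 * Y)
          + C ((c ^ (q ^ 2 + q + 1) + 1) ^ (q ^ 3)) * (X ^ 2 * Y ^ 2 * Z) =
        (C α * X + C (α ^ q) * Z) * (X * Y + C β) * (Y * Z + C γ) := by
  intro α β γ X Y Z
  haveI : Fact (Nat.Prime 2) := ⟨Nat.prime_two⟩
  haveI : CharP F 2 := by
    refine charP_of_card_eq_prime_pow (f := e * 6) ?_
    rw [hF, hq, pow_mul]
  have h0 := s7_dummy_two (F := F)
  let φ : F →+* F := iterateFrobenius F 2 e
  have hφ : ∀ s, φ s = s ^ q := fun s => by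
    rw [hq]; exact iterateFrobenius_def 2 e s
  have hit : ∀ (s : F) (k : ℕ), φ (s ^ q ^ k) = s ^ q ^ (k + 1) := fun s k => by
    rw [hφ, ← pow_mul, ← pow_succ]
  obtain ⟨y, hy⟩ : ∃ y, y = c ^ q := ⟨_, rfl⟩
  obtain ⟨z, hz⟩ : ∃ z, z = c ^ q ^ 2 := ⟨_, rfl⟩
  obtain ⟨t, ht⟩ : ∃ t, t = c ^ q ^ 3 := ⟨_, rfl⟩
  obtain ⟨u, hu⟩ : ∃ u, u = c ^ q ^ 4 := ⟨_, rfl⟩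
  obtain ⟨v, hv⟩ : ∃ v, v = c ^ q ^ 5 := ⟨_, rfl⟩
  have px : φ c = y := by rw [hφ, hy]
  have py : φ y = z := by rw [hy, hz]; simpa using hit c 1
  have pz : φ z = t := by rw [hz, ht]; exact hit c 2
  have pt : φ t = u := by rw [ht, hu]; exact hit c 3
  have pu : φ u = v := by rw [hu, hv]; exact hit c 4
  have pv : φ v = c := by rw [hv, hit, ← hF]; exact FiniteField.pow_card c
  have d : ∀ k, c ^ (2 * k) = (c ^ k) ^ 2 := fun k => by rw [mul_comm, pow_mul]
  rw [F3] at h3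
  simp only [F1, F2, pow_add, d, pow_one, ← hy, ← hz, ← ht, ← hu, ← hv] at h1 h2 h3
  have ha : c ^ (q ^ 2 + q + 1) + 1 = c * y * z + 1 := by
    simp only [pow_add, pow_one, ← hy, ← hz]; ring
  have hα : α = t * u * v + 1 := by
    have : α = φ (φ (φ (c * y * z + 1))) := by
      simp only [hφ, ← pow_mul]
      change (c ^ (q ^ 2 + q + 1) + 1) ^ (q ^ 3) = _
      rw [ha]; congr 1; ring
    rw [this]; simp [px, py, pz, pt, pu]
  have hαq : α ^ q = u * v * c + 1 := by
    rw [← hφ, hα]; simp [pt, pu, pv]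
  have hα4 : (c ^ (q ^ 2 + q + 1) + 1) ^ (q ^ 4) = α ^ q := by
    rw [pow_succ q 3, pow_mul]
  obtain ⟨a4, a3, b, g, g3, g4, g2, g1, g1q⟩ := s7_core φ c y z t u v px py pz pt pu pv
    (hz ▸ hc2) (by rw [← ha]; simpa only [pow_add, pow_one, ← hy, ← hz] using h3)
    (by linear_combination h1) (by linear_combination h2)
  have A3e : A3 q c = α ^ q * b := by
    rw [hαq, ← g3]
    simp only [A3, pow_add, d, pow_one, ← hy, ← hz, ← ht, ← hu, ← hv]; ring
  have A4e : A4 q c = α * g := by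
    rw [hα, ← g4]
    simp only [A4, pow_add, d, pow_one, ← hy, ← hz, ← ht, ← hu, ← hv]; ring
  have A2e : A2 q c = α * b + α ^ q * g := by
    rw [hαq, hα, ← g2]
    simp only [A2, pow_add, d, pow_one, ← hy, ← hz, ← ht, ← hu, ← hv]; ring
  have A1e : A1 q c = α ^ q * b * g := by
    rw [hαq, ← g1]
    simp only [A1, pow_add, d, pow_one, ← hy, ← hz, ← ht, ← hu, ← hv]; ring
  have A1qe : A1 q c ^ q = α * b * g := by
    rw [← hφ, hα, ← g1q]
    simp only [A1, pow_add, d, pow_one, ← hy, ← hz, ← ht, ← hu, ← hv, map_add, map_mul, map_pow,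
      px, py, pz, pt, pu, pv]
    ring
  have α0 : α ≠ 0 := hα ▸ a3
  have βe : β = b := by
    change A3 q c / α ^ q = b
    rw [A3e, mul_div_cancel_left₀ _ (pow_ne_zero q α0)]
  have γe : γ = g := by
    change A4 q c / α = g
    rw [A4e, mul_div_cancel_left₀ _ α0]
  refine ⟨α0, ?_⟩
  rw [hα4, βe, γe, A1qe, A1e, A2e, A3e, A4e]
  change _ + C α * (X ^ 2 * Y ^ 2 * Z) = _
  simp only [map_add, map_mul]
  ring
end
end

section
/- Let q be a power of 2, let F be a finite field with q^6 elements, and let c ∈ 𝔠. Then c^{q^4+q^2+1} + c^{q^4} + c^{q^2} + c ≠ 0 (that is, the norm of c over 𝔽_{q^2} plus the trace of c over 𝔽_{q^2} is nonzero). -/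
noncomputable section

/-- `F1` in terms of the conjugates, rewritten in the coordinates `y = 1 / (x + 1)`. -/
theorem F1_coord {F : Type} [Field F] [CharP F 2] (a b c d e A B C D E G : F)
    (ha : a * A = A + 1) (hb : b * B = B + 1) (hc : c * C = C + 1) (hd : d * D = D + 1)
    (he : e * E = E + 1) (hs : A + C + E = 1) (ht : B + D + G = 1)
    (h : a * b * c * d ^ 2 * e + a * c * d * e + a * b * d + a + b * c * d ^ 2 + b * c * d
      + d + 1 = 0) :
    G * C * E + D * (1 + D) * A * E + (1 + D) * G * A * C = 0 := by
  have h2 : (2 : F) = 0 := CharTwo.two_eq_zero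
  have key : (A+1)*(B+1)*(C+1)*(D+1)^2*(E+1) + (A+1)*(C+1)*(D+1)*(E+1)*B*D
      + (A+1)*(B+1)*(D+1)*C*D*E + (A+1)*B*C*D^2*E + (B+1)*(C+1)*(D+1)^2*A*E
      + (B+1)*(C+1)*(D+1)*A*D*E + (D+1)*A*B*C*D*E + A*B*C*D^2*E = 0 := by
    rw [← ha, ← hb, ← hc, ← hd, ← he]
    linear_combination A * B * C * D ^ 2 * E * h
  have hE : E = 1 + A + C := by grind
  have hG : G = 1 + B + D := by grind
  subst hE hG
  grind

theorem sum_coord {F : Type} [Field F] [CharP F 2] (a c e A C E : F)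
    (ha : a * A = A + 1) (hc : c * C = C + 1) (he : e * E = E + 1)
    (h : a * c * e + e + c + a = 0) : A + C + E = 1 := by
  have key : (A+1)*(C+1)*(E+1) + (E+1)*A*C + (C+1)*A*E + (A+1)*C*E = 0 := by
    rw [← ha, ← hc, ← he]
    linear_combination A * C * E * h
  grind

theorem det_coord {F : Type} [Field F] [CharP F 2] (A B C D E G : F)
    (hC : C ≠ 0) (hE : E ≠ 0) (ht : B + D + G = 1)
    (h1 : G * C * E + D * (1 + D) * A * E + (1 + D) * G * A * C = 0)
    (h2 : B * E * A + G * (1 + G) * C * A + (1 + G) * B * C * E = 0)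
    (h3 : D * A * C + B * (1 + B) * E * C + (1 + B) * D * E * A = 0) :
    B * D + D * G + G * B = 0 := by
  have hG : G = 1 + B + D := by grind
  have key : C * E * (B * D + D * G + G * B) ^ 2 = 0 := by
    have e1 : C * E * (G * (B * D + G * (1 + G) * D * (1 + B))
        + D * (1 + D) * (B * (1 + G) * D + G * (1 + G) * B * (1 + B))
        + (1 + D) * G * (B * (1 + G) * D * (1 + B) + B * B * (1 + B))) = 0 := by
      have m : ∀ A B C D E G : F, C * E * (G * (B * D + G * (1 + G) * D * (1 + B))
        + D * (1 + D) * (B * (1 + G) * D + G * (1 + G) * B * (1 + B))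
        + (1 + D) * G * (B * (1 + G) * D * (1 + B) + B * B * (1 + B))) =
          (G * C * E + D * (1 + D) * A * E + (1 + D) * G * A * C)
            * (B * D + G * (1 + G) * D * (1 + B))
          + (B * E * A + G * (1 + G) * C * A + (1 + G) * B * C * E)
            * (D * (1 + D) * D + (1 + D) * G * D * (1 + B))
          + (D * A * C + B * (1 + B) * E * C + (1 + B) * D * E * A)
            * (D * (1 + D) * G * (1 + G) + (1 + D) * G * B) := by
        clear * -
        intros
        grind
      rw [m A B C D E G, h1, h2, h3]
      ring
    have m' : ∀ B D : F, (B * D + D * (1 + B + D) + (1 + B + D) * B) ^ 2 =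
        ((1 + B + D) * (B * D + (1 + B + D) * (1 + (1 + B + D)) * D * (1 + B))
        + D * (1 + D) * (B * (1 + (1 + B + D)) * D
          + (1 + B + D) * (1 + (1 + B + D)) * B * (1 + B))
        + (1 + D) * (1 + B + D) * (B * (1 + (1 + B + D)) * D * (1 + B) + B * B * (1 + B))) := by
      clear * -
      intros
      grind
    subst hG
    rw [m', e1]
  have := mul_ne_zero hC hE
  exact pow_eq_zero_iff (two_ne_zero) |>.1 ((mul_eq_zero.1 key).resolve_left this)

theorem lin_coord {F : Type} [Field F] [CharP F 2] (A B C D E G : F)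
    (hA : A ≠ 0) (hC : C ≠ 0) (hG : G ≠ 0) (ht : B + D + G = 1)
    (k1 : B * D + D * G + G * B = 0) (k2 : C * E + E * A + A * C = 0)
    (h0 : G * C * E + D * (1 + D) * A * E + (1 + D) * G * A * C = 0) : D * C = G * A := by
  have hB : B = 1 + D + G := by clear * - ht; grind
  have s1 : G * A * ((D + G) * E + D * C) = 0 := by
    clear hA hC hG ht
    subst hB
    grind
  have s2 := (mul_eq_zero.1 s1).resolve_left (mul_ne_zero hG hA)
  have s3 : C * (D * C + G * A) = 0 := by
    clear * - s2 k2
    grind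
  exact CharTwo.add_eq_zero.1 ((mul_eq_zero.1 s3).resolve_left hC)

theorem core_s8 {F : Type} [Field F] [CharP F 2] (A B C D E G : F)
    (hA : A ≠ 0) (hB : B ≠ 0) (hC : C ≠ 0) (hD : D ≠ 0) (hE : E ≠ 0) (hG : G ≠ 0)
    (hs : A + C + E = 1) (ht : B + D + G = 1)
    (h0 : G * C * E + D * (1 + D) * A * E + (1 + D) * G * A * C = 0)
    (h1 : A * D * G + E * (1 + E) * B * G + (1 + E) * A * B * D = 0)
    (h2 : B * E * A + G * (1 + G) * C * A + (1 + G) * B * C * E = 0)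
    (h3 : C * G * B + A * (1 + A) * D * B + (1 + A) * C * D * G = 0)
    (h4 : D * A * C + B * (1 + B) * E * C + (1 + B) * D * E * A = 0)
    (h5 : E * B * D + C * (1 + C) * G * D + (1 + C) * E * G * B = 0) :
    A + B + C = 1 ∧ A * B + B * C + C * A = 0 := by
  have k1 := det_coord A B C D E G hC hE ht h0 h2 h4
  have k2 : C * E + E * A + A * C = 0 :=
    det_coord B C D E G A hD hG (by linear_combination hs) h1 h3 h5
  -- reduced linear relations
  have r1 : D * C = G * A := lin_coord A B C D E G hA hC hG ht k1 k2 h0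
  have r2 : G * E = B * C :=
    lin_coord C D E G A B hC hE hB (by linear_combination ht) (by linear_combination k1)
      (by linear_combination k2) (by linear_combination h2)
  have r3 : G = C := by
    linear_combination C * ht - r1 + r2 - G * hs
  have r4 : B = E := by
    subst r3
    exact (mul_right_cancel₀ hG (by linear_combination r2)).symm
  subst r3 r4
  exact ⟨by linear_combination hs, by linear_combination k2⟩

theorem statement8 (e q : ℕ) (he : 1 ≤ e) (hq : q = 2 ^ e)
    (F : Type) [Field F] [Fintype F] (hF : Fintype.card F = q ^ 6)
    (c : F) (hc : c ∈ frakC q F) :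
    c ^ (q ^ 4 + q ^ 2 + 1) + c ^ (q ^ 4) + c ^ (q ^ 2) + c ≠ 0 := by
  intro hN
  obtain ⟨hne, hF1, -, hprod⟩ := hc
  have hF3 : F3 q c ≠ 0 := left_ne_zero_of_mul (left_ne_zero_of_mul hprod)
  have hchar : CharP F 2 := by
    apply charP_of_card_eq_prime_pow (f := e * 6)
    rw [← Nat.card_eq_fintype_card, Nat.card_eq_fintype_card, hF, hq, ← pow_mul]
  have : ExpChar F 2 := ExpChar.prime Nat.prime_two
  have hphi : ∀ x : F, iterateFrobenius F 2 e x = x ^ q := fun x => by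
    rw [iterateFrobenius_def, hq]
  have h6 : c ^ (q ^ 6) = c := by rw [← hF]; exact FiniteField.pow_card c
  obtain ⟨x1, hx1⟩ : ∃ x, x = c ^ q := ⟨_, rfl⟩
  obtain ⟨x2, hx2⟩ : ∃ x, x = c ^ (q ^ 2) := ⟨_, rfl⟩
  obtain ⟨x3, hx3⟩ : ∃ x, x = c ^ (q ^ 3) := ⟨_, rfl⟩
  obtain ⟨x4, hx4⟩ : ∃ x, x = c ^ (q ^ 4) := ⟨_, rfl⟩
  obtain ⟨x5, hx5⟩ : ∃ x, x = c ^ (q ^ 5) := ⟨_, rfl⟩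
  obtain ⟨φ, hφ⟩ : ∃ φ : F →+* F, φ = iterateFrobenius F 2 e := ⟨_, rfl⟩
  rw [← hφ] at hphi
  have p0 : φ c = x1 := by rw [hphi, hx1]
  have p1 : φ x1 = x2 := by rw [hphi, hx1, hx2, ← pow_mul]; congr 1; ring
  have p2 : φ x2 = x3 := by rw [hphi, hx2, hx3, ← pow_mul]; congr 1
  have p3 : φ x3 = x4 := by rw [hphi, hx3, hx4, ← pow_mul]; congr 1
  have p4 : φ x4 = x5 := by rw [hphi, hx4, hx5, ← pow_mul]; congr 1
  have p5 : φ x5 = c := by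
    rw [hphi, hx5, ← pow_mul]; exact h6
  have g0 : c * x1 * x2 * x3 ^ 2 * x4 + c * x2 * x3 * x4 + c * x1 * x3 + c + x1 * x2 * x3 ^ 2
      + x1 * x2 * x3 + x3 + 1 = 0 := by
    rw [← hF1, F1, hx1, hx2, hx3, hx4]; ring
  have g1 := congrArg φ g0
  simp only [map_add, map_mul, map_pow, map_one, map_zero, p0, p1, p2, p3, p4, p5] at g1
  have g2 := congrArg φ g1
  simp only [map_add, map_mul, map_pow, map_one, map_zero, p0, p1, p2, p3, p4, p5] at g2
  have g3 := congrArg φ g2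
  simp only [map_add, map_mul, map_pow, map_one, map_zero, p0, p1, p2, p3, p4, p5] at g3
  have g4 := congrArg φ g3
  simp only [map_add, map_mul, map_pow, map_one, map_zero, p0, p1, p2, p3, p4, p5] at g4
  have g5 := congrArg φ g4
  simp only [map_add, map_mul, map_pow, map_one, map_zero, p0, p1, p2, p3, p4, p5] at g5
  have n0 : c * x2 * x4 + x4 + x2 + c = 0 := by
    rw [← hN, hx2, hx4]; ring
  have n1 := congrArg φ n0
  simp only [map_add, map_mul, map_zero, p0, p1, p2, p3, p4, p5] at n1
  have hc1 : c + 1 ≠ 0 := by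
    intro h
    have : c = 1 := CharTwo.add_eq_zero.1 h
    apply hne
    rw [this, one_pow]
  have step : ∀ x y : F, φ x = y → x + 1 ≠ 0 → y + 1 ≠ 0 := by
    intro x y hxy hx h
    apply hx
    apply φ.injective
    rw [map_add, map_one, hxy, h, map_zero]
  have i1 := step _ _ p0 hc1
  have i2 := step _ _ p1 i1
  have i3 := step _ _ p2 i2
  have i4 := step _ _ p3 i3
  have i5 := step _ _ p4 i4
  have ex : ∀ x : F, x + 1 ≠ 0 → ∃ y, y ≠ 0 ∧ x * y = y + 1 := by
    intro x hx
    refine ⟨(x + 1)⁻¹, inv_ne_zero hx, ?_⟩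
    have := mul_inv_cancel₀ hx
    have h0 : (2 : F) = 0 := CharTwo.two_eq_zero
    linear_combination this - (x + 1)⁻¹ * h0
  obtain ⟨A, nA, eA⟩ := ex _ hc1
  obtain ⟨B, nB, eB⟩ := ex _ i1
  obtain ⟨C, nC, eC⟩ := ex _ i2
  obtain ⟨D, nD, eD⟩ := ex _ i3
  obtain ⟨E, nE, eE⟩ := ex _ i4
  obtain ⟨G, nG, eG⟩ := ex _ i5
  have hs := sum_coord _ _ _ _ _ _ eA eC eE n0
  have ht := sum_coord _ _ _ _ _ _ eB eD eG n1
  have k0 := F1_coord _ _ _ _ _ A B C D E G eA eB eC eD eE hs ht g0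
  have k1 := F1_coord _ _ _ _ _ B C D E G A eB eC eD eE eG ht (by linear_combination hs) g1
  have k2 := F1_coord _ _ _ _ _ C D E G A B eC eD eE eG eA (by linear_combination hs)
    (by linear_combination ht) g2
  have k3 := F1_coord _ _ _ _ _ D E G A B C eD eE eG eA eB (by linear_combination ht)
    (by linear_combination hs) g3
  have k4 := F1_coord _ _ _ _ _ E G A B C D eE eG eA eB eC (by linear_combination hs)
    (by linear_combination ht) g4
  have k5 := F1_coord _ _ _ _ _ G A B C D E eG eA eB eC eD (by linear_combination ht)
    (by linear_combination hs) g5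
  obtain ⟨s1, s2⟩ := core_s8 A B C D E G nA nB nC nD nE nG hs ht
    (by linear_combination k0) (by linear_combination k1) (by linear_combination k2)
    (by linear_combination k3) (by linear_combination k4) (by linear_combination k5)
  apply hF3
  have hF3' : F3 q c = c * x1 * x2 + 1 := by
    rw [F3, hx1, hx2]; ring
  rw [hF3']
  have h0 : (2 : F) = 0 := CharTwo.two_eq_zero
  have key : A * B * C * (c * x1 * x2 + 1) = 0 := by
    have : A * B * C * (c * x1 * x2 + 1) = (c * A) * (x1 * B) * (x2 * C) + A * B * C := by ring
    rw [this, eA, eB, eC]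
    linear_combination s1 + s2 + (A * B * C + 1) * h0
  exact (mul_eq_zero.1 key).resolve_left (mul_ne_zero (mul_ne_zero nA nB) nC)
end
end

section
/- There exists a constant Q such that for every power of two q = 2^e with q ≥ Q, every finite field F with q^6 elements, all c₁, c₂ ∈ 𝔠 and all s, t ∈ {1,5}, the codes D_{c₁,s} and D_{c₂,t} are equivalent if and only if there exists a field automorphism ρ of F such that either (i) s = t and ρ(c₁) = c₂, or (ii) s + t = 6 and ρ(c₁)·(c₂ + 1)^{q^s + q^{3s}} = (c₂^{q^{3s}+q^s} + 1)·(c₂^{q^{5s}} + 1). -/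
noncomputable section

def Dcode (q : ℕ) {F : Type*} [Field F] (c : F) (s : ℕ) : Set (F → F) :=
  {g | ∃ a b : F,
    g = fun x => a * x + b * (x ^ (q ^ s) + x ^ (q ^ (3 * s)) + c * x ^ (q ^ (5 * s)))}

def CodeEquiv (q : ℕ) {F : Type*} [Field F] (D D' : Set (F → F)) : Prop :=
  ∃ ρ : F ≃+* F, ∃ g h : F → F,
    Function.Bijective g ∧ Function.Bijective h ∧
    (∀ x y : F, g (x + y) = g x + g y) ∧ (∀ l x : F, l ^ q = l → g (l * x) = l * g x) ∧
    (∀ x y : F, h (x + y) = h x + h y) ∧ (∀ l x : F, l ^ q = l → h (l * x) = l * h x) ∧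
    D' = {f' | ∃ f ∈ D, f' = g ∘ ⇑ρ ∘ f ∘ ⇑ρ.symm ∘ h}


set_option linter.unusedSimpArgs false

theorem st_RL {F : Type*} [Field F] [CharP F 2] (x0 x1 x2 x3 x4 : F)
    (n0 : x0 ≠ 0) (n2 : x2 ≠ 0) (n3 : x3 ≠ 0)
    (h1 : x4 * x3 ^ 2 * x2 * x1 * x0 + x4 * x3 * x2 * x0 + x3 * x1 * x0 + x0
      + x3 ^ 2 * x2 * x1 + x3 * x2 * x1 + x3 + 1 = 0)
    (h2 : x3 * x2 * x1 ^ 2 * x0 ^ 2 + x2 * x1 * x0 ^ 2 + x3 * x2 ^ 2 * x1 ^ 2 * x0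
      + x3 ^ 2 * x2 ^ 2 * x1 * x0 + x2 * x1 * x0 + x3 * x1 * x0 + x3 * x2 * x0 + x0
      + x3 ^ 2 * x2 * x1 + x3 * x2 * x1 + x3 + 1 = 0) :
    x0 * (1 + x1 * x3) * (1 + x2 * x3 * x4) = (x3 + 1) * (1 + x1 * x2 * x3) ∧
    x4 * (1 + x1 * x3) * (1 + x0 * x1 * x2) = (x1 + 1) * (1 + x1 * x2 * x3) := by
  have R : x0 * (1 + x1 * x3) * (1 + x2 * x3 * x4) = (x3 + 1) * (1 + x1 * x2 * x3) := by
    linear_combination (norm := (ring_nf; reduce_mod_char!)) h1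
  refine ⟨R, ?_⟩
  have G : x0 * x2 * ((1 + x1 * x3) * (x0 * x1 + x3 * x4)
      - (x1 + x3) * (1 + x1 * x2 * x3)) = 0 := by
    linear_combination (norm := (ring_nf; reduce_mod_char!)) h1 + h2
  have G' : (1 + x1 * x3) * (x0 * x1 + x3 * x4) = (x1 + x3) * (1 + x1 * x2 * x3) := by
    rcases mul_eq_zero.1 G with h | h
    · exact absurd h (mul_ne_zero n0 n2)
    · exact sub_eq_zero.1 h
  apply mul_left_cancel₀ n3
  linear_combination (norm := (ring_nf; reduce_mod_char!)) x1 * R + G'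

/-- the ratio `P i / u i` is invariant under the square of the shift -/
theorem st_ratio {F : Type*} [Field F] {y P u1 u3 P1 P3 z : F} (hy : y ≠ 0) (hP : P ≠ 0)
    (hR : y * u1 * P = z * P1) (hL : y * u3 * P = z * P3) : u1 * P3 = u3 * P1 := by
  apply mul_left_cancel₀ (mul_ne_zero hy hP)
  linear_combination P3 * hR - P1 * hL

theorem st_core {F : Type*} [Field F] [CharP F 2] (x0 x1 x2 x3 x4 x5 r0 r1 : F)
    (hr0 : r0 ≠ 0) (hr1 : r1 ≠ 0)
    (P0 : 1 + x0 * x1 * x2 = r0 * (1 + x0 * x2))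
    (Q0 : x0 * r0 * (1 + x2 * x4) = r1 * (1 + x3))
    (Q2 : x2 * r0 * (1 + x4 * x0) = r1 * (1 + x5))
    (Q4 : x4 * r0 * (1 + x0 * x2) = r1 * (1 + x1))
    (y4 : 1 + x4 ≠ 0)
    (N0 : x0 * x2 * x4 = 1) (N1 : x1 * x3 * x5 = 1) :
    x0 * x1 * x2 * (x0 + 1) * (x2 + 1) + (x0 * x2 + 1) ^ 2 = 0 := by
  obtain ⟨ρ, hρ⟩ : ∃ ρ, r0 = ρ * r1 := ⟨r0 / r1, by field_simp⟩
  have e3 : x3 = 1 + ρ * (1 + x0) := by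
    apply mul_left_cancel₀ hr1
    linear_combination (norm := (ring_nf; reduce_mod_char!)) Q0 + r0 * N0 + (1 + x0) * hρ
  have e5 : x5 = 1 + ρ * (1 + x2) := by
    apply mul_left_cancel₀ hr1
    linear_combination (norm := (ring_nf; reduce_mod_char!)) Q2 + r0 * N0 + (1 + x2) * hρ
  have e1 : x1 = 1 + ρ * (1 + x4) := by
    apply mul_left_cancel₀ hr1
    linear_combination (norm := (ring_nf; reduce_mod_char!)) Q4 + r0 * N0 + (1 + x4) * hρ
  have n4 : x4 ≠ 0 := by rintro rfl; simp at N0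
  have e0 : r0 = 1 + ρ := by
    apply mul_right_cancel₀ y4
    linear_combination (norm := (ring_nf; reduce_mod_char!)) x4 * P0 + x1 * N0 + r0 * N0 + e1
  have hρ1 : 1 + ρ ≠ 0 := by rwa [← e0]
  have hρ0 : ρ ≠ 0 := by rintro rfl; simp at hρ; exact hr0 hρ
  obtain ⟨a, ha⟩ : ∃ a, a = 1 + x0 := ⟨_, rfl⟩
  obtain ⟨b, hb⟩ : ∃ a, a = 1 + x2 := ⟨_, rfl⟩
  obtain ⟨c, hc⟩ : ∃ a, a = 1 + x4 := ⟨_, rfl⟩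
  rw [← ha] at e3
  rw [← hb] at e5
  rw [← hc] at e1 y4
  have ha' : x0 = 1 + a := by rw [ha]; ring_nf; reduce_mod_char!
  have hb' : x2 = 1 + b := by rw [hb]; ring_nf; reduce_mod_char!
  have hc' : x4 = 1 + c := by rw [hc]; ring_nf; reduce_mod_char!
  clear ha hb hc
  subst ha' hb' hc' e1 e3 e5
  have s1 : (a + b + c) + (a * b + b * c + c * a) + a * b * c = 0 := by
    linear_combination N0
  have s2 : ρ * ((a + b + c) + ρ * (a * b + b * c + c * a) + ρ ^ 2 * (a * b * c)) = 0 := by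
    linear_combination N1
  have s2' := (mul_eq_zero.1 s2).resolve_left hρ0
  have s3 : (a * b + b * c + c * a) = (1 + ρ) * (a * b * c) := by
    apply mul_left_cancel₀ hρ1
    linear_combination (norm := (ring_nf; reduce_mod_char!)) s1 + s2'
  have s4 : a + b + c = ρ * (a * b * c) := by
    linear_combination (norm := (ring_nf; reduce_mod_char!)) s1 + s3
  have key : (1 + ρ * c) * (1 + c) * a * b = c ^ 2 := by
    apply mul_right_cancel₀ y4
    linear_combination (norm := (ring_nf; reduce_mod_char!)) c * s3 + c ^ 2 * s4
  have : (1 + c) ^ 2 * ((1 + a) * (1 + ρ * c) * (1 + b) * (1 + a + 1) * (1 + b + 1)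
      + ((1 + a) * (1 + b) + 1) ^ 2) = 0 := by
    linear_combination (norm := (ring_nf; reduce_mod_char!)) key +
      (1 + c) * (1 + ρ * c) * a * b * N0 + ((1 + a) * (1 + b) * (1 + c) + 1) * N0
  exact (mul_eq_zero.1 this).resolve_left (pow_ne_zero _ n4)

theorem st_frak_alg {F : Type*} [Field F] [CharP F 2] (σ : F →+* F) (x0 x1 x2 x3 x4 x5 : F)
    (s0 : σ x0 = x1) (s1 : σ x1 = x2) (s2 : σ x2 = x3) (s3 : σ x3 = x4) (s4 : σ x4 = x5)
    (s5 : σ x5 = x0)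
    (h1 : x4 * x3 ^ 2 * x2 * x1 * x0 + x4 * x3 * x2 * x0 + x3 * x1 * x0 + x0
      + x3 ^ 2 * x2 * x1 + x3 * x2 * x1 + x3 + 1 = 0)
    (h2 : x3 * x2 * x1 ^ 2 * x0 ^ 2 + x2 * x1 * x0 ^ 2 + x3 * x2 ^ 2 * x1 ^ 2 * x0
      + x3 ^ 2 * x2 ^ 2 * x1 * x0 + x2 * x1 * x0 + x3 * x1 * x0 + x3 * x2 * x0 + x0
      + x3 ^ 2 * x2 * x1 + x3 * x2 * x1 + x3 + 1 = 0)
    (h02 : x2 ≠ x0) (h3 : 1 + x0 * x1 * x2 ≠ 0)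
    (h5 : x0 * x1 * x2 * (x0 + 1) * (x2 + 1) + (x0 * x2 + 1) ^ 2 ≠ 0) :
    x0 * x2 * x4 ≠ 1 ∧ x0 + x2 + x4 ≠ x0 * x2 * x4 := by
  have inj : Function.Injective σ := σ.injective
  have nz0 : x0 ≠ 0 := by
    intro h
    have e1 : x1 = 0 := by rw [← s0, h, map_zero]
    have e2 : x2 = 0 := by rw [← s1, e1, map_zero]
    exact h02 (by rw [e2, h])
  have nz1 : x1 ≠ 0 := by rw [← s0]; exact (map_ne_zero σ).2 nz0
  have nz2 : x2 ≠ 0 := by rw [← s1]; exact (map_ne_zero σ).2 nz1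
  have nz3 : x3 ≠ 0 := by rw [← s2]; exact (map_ne_zero σ).2 nz2
  have nz4 : x4 ≠ 0 := by rw [← s3]; exact (map_ne_zero σ).2 nz3
  have nz5 : x5 ≠ 0 := by rw [← s4]; exact (map_ne_zero σ).2 nz4
  have p0 := h3
  have p1 : 1 + x1 * x2 * x3 ≠ 0 := by
    have := (map_ne_zero σ).2 p0
    simpa only [map_add, map_mul, map_one, s0, s1, s2, s3, s4, s5] using this
  have p2 : 1 + x2 * x3 * x4 ≠ 0 := by
    have := (map_ne_zero σ).2 p1
    simpa only [map_add, map_mul, map_one, s0, s1, s2, s3, s4, s5] using this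
  have p3 : 1 + x3 * x4 * x5 ≠ 0 := by
    have := (map_ne_zero σ).2 p2
    simpa only [map_add, map_mul, map_one, s0, s1, s2, s3, s4, s5] using this
  have p4 : 1 + x4 * x5 * x0 ≠ 0 := by
    have := (map_ne_zero σ).2 p3
    simpa only [map_add, map_mul, map_one, s0, s1, s2, s3, s4, s5] using this
  have p5 : 1 + x5 * x0 * x1 ≠ 0 := by
    have := (map_ne_zero σ).2 p4
    simpa only [map_add, map_mul, map_one, s0, s1, s2, s3, s4, s5] using this
  obtain ⟨R0, L0⟩ := st_RL x0 x1 x2 x3 x4 nz0 nz2 nz3 h1 h2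
  have R1 := congrArg σ R0
  simp only [map_add, map_mul, map_one, s0, s1, s2, s3, s4, s5] at R1
  have R2 := congrArg σ R1
  simp only [map_add, map_mul, map_one, s0, s1, s2, s3, s4, s5] at R2
  have R3 := congrArg σ R2
  simp only [map_add, map_mul, map_one, s0, s1, s2, s3, s4, s5] at R3
  have R4 := congrArg σ R3
  simp only [map_add, map_mul, map_one, s0, s1, s2, s3, s4, s5] at R4
  have R5 := congrArg σ R4
  simp only [map_add, map_mul, map_one, s0, s1, s2, s3, s4, s5] at R5
  have L1 := congrArg σ L0
  simp only [map_add, map_mul, map_one, s0, s1, s2, s3, s4, s5] at L1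
  have L2 := congrArg σ L1
  simp only [map_add, map_mul, map_one, s0, s1, s2, s3, s4, s5] at L2
  have L3 := congrArg σ L2
  simp only [map_add, map_mul, map_one, s0, s1, s2, s3, s4, s5] at L3
  have L4 := congrArg σ L3
  simp only [map_add, map_mul, map_one, s0, s1, s2, s3, s4, s5] at L4
  have L5 := congrArg σ L4
  simp only [map_add, map_mul, map_one, s0, s1, s2, s3, s4, s5] at L5
  have ne1 : x4 ≠ 1 := by
    intro h
    have e5 : x5 = 1 := by rw [← s4, h, map_one]
    have e0 : x0 = 1 := by rw [← s5, e5, map_one]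
    have e1 : x1 = 1 := by rw [← s0, e0, map_one]
    have e2 : x2 = 1 := by rw [← s1, e1, map_one]
    exact h02 (by rw [e2, e0])
  have y4 : 1 + x4 ≠ 0 := fun h => ne1 (CharTwo.add_eq_zero.1 h).symm
  have y5 : 1 + x5 ≠ 0 := by
    have := (map_ne_zero σ).2 y4
    simpa only [map_add, map_mul, map_one, s0, s1, s2, s3, s4, s5] using this
  have y0 : 1 + x0 ≠ 0 := by
    have := (map_ne_zero σ).2 y5
    simpa only [map_add, map_mul, map_one, s0, s1, s2, s3, s4, s5] using this
  have y1 : 1 + x1 ≠ 0 := by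
    have := (map_ne_zero σ).2 y0
    simpa only [map_add, map_mul, map_one, s0, s1, s2, s3, s4, s5] using this
  have u1 : 1 + x1 * x3 ≠ 0 := by
    intro h
    rw [h] at L0
    simp only [mul_zero, zero_mul] at L0
    rcases mul_eq_zero.1 L0.symm with h | h
    · exact y1 (by rw [add_comm]; exact h)
    · exact p1 h
  have u2 : 1 + x2 * x4 ≠ 0 := by
    have := (map_ne_zero σ).2 u1
    simpa only [map_add, map_mul, map_one, s0, s1, s2, s3, s4, s5] using this
  have u3 : 1 + x3 * x5 ≠ 0 := by
    have := (map_ne_zero σ).2 u2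
    simpa only [map_add, map_mul, map_one, s0, s1, s2, s3, s4, s5] using this
  have u4 : 1 + x4 * x0 ≠ 0 := by
    have := (map_ne_zero σ).2 u3
    simpa only [map_add, map_mul, map_one, s0, s1, s2, s3, s4, s5] using this
  have u5 : 1 + x5 * x1 ≠ 0 := by
    have := (map_ne_zero σ).2 u4
    simpa only [map_add, map_mul, map_one, s0, s1, s2, s3, s4, s5] using this
  have u0 : 1 + x0 * x2 ≠ 0 := by
    have := (map_ne_zero σ).2 u5
    simpa only [map_add, map_mul, map_one, s0, s1, s2, s3, s4, s5] using this
  -- the ratios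
  have c13 := st_ratio nz0 p2 R0 L2
  have c24 := st_ratio nz1 p3 R1 L3
  have c35 := st_ratio nz2 p4 R2 L4
  have c40 := st_ratio nz3 p5 R3 L5
  obtain ⟨r0, hr0⟩ : ∃ r, 1 + x0 * x1 * x2 = r * (1 + x0 * x2) :=
    ⟨(1 + x0 * x1 * x2) / (1 + x0 * x2), by field_simp⟩
  obtain ⟨r1, hr1⟩ : ∃ r, 1 + x1 * x2 * x3 = r * (1 + x1 * x3) :=
    ⟨(1 + x1 * x2 * x3) / (1 + x1 * x3), by field_simp⟩
  have hr3 : 1 + x3 * x4 * x5 = r1 * (1 + x3 * x5) := by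
    apply mul_left_cancel₀ u1
    linear_combination c13 + (1 + x3 * x5) * hr1
  have hr5 : 1 + x5 * x0 * x1 = r1 * (1 + x5 * x1) := by
    apply mul_left_cancel₀ u3
    linear_combination c35 + (1 + x5 * x1) * hr3
  have hr4 : 1 + x4 * x5 * x0 = r0 * (1 + x4 * x0) := by
    apply mul_left_cancel₀ u0
    linear_combination -c40 + (1 + x4 * x0) * hr0
  have hr2 : 1 + x2 * x3 * x4 = r0 * (1 + x2 * x4) := by
    apply mul_left_cancel₀ u4
    linear_combination -c24 + (1 + x2 * x4) * hr4
  have Q0 : x0 * r0 * (1 + x2 * x4) = r1 * (1 + x3) := by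
    apply mul_left_cancel₀ u1
    linear_combination R0 - x0 * (1 + x1 * x3) * hr2 + (1 + x3) * hr1
  have Q2 : x2 * r0 * (1 + x4 * x0) = r1 * (1 + x5) := by
    apply mul_left_cancel₀ u3
    linear_combination R2 - x2 * (1 + x3 * x5) * hr4 + (1 + x5) * hr3
  have Q4 : x4 * r0 * (1 + x0 * x2) = r1 * (1 + x1) := by
    apply mul_left_cancel₀ u5
    linear_combination R4 - x4 * (1 + x5 * x1) * hr0 + (1 + x1) * hr5
  have z0 : r0 ≠ 0 := by rintro rfl; rw [zero_mul] at hr0; exact p0 hr0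
  have z1 : r1 ≠ 0 := by rintro rfl; rw [zero_mul] at hr1; exact p1 hr1
  have A : x0 * x2 * x4 ≠ 1 := by
    intro N0
    have N1 := congrArg σ N0
    simp only [map_mul, map_one, s0, s1, s2, s3, s4, s5] at N1
    exact h5 (st_core x0 x1 x2 x3 x4 x5 r0 r1 z0 z1 hr0 Q0 Q2 Q4 y4 N0 N1)
  refine ⟨A, fun B => ?_⟩
  have T1 : x1 + x3 + x5 = 1 := by
    apply mul_left_cancel₀ z1
    linear_combination (norm := (ring_nf; reduce_mod_char!)) Q0 + Q2 + Q4 + r0 * B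
  have T0 := congrArg σ T1
  simp only [map_add, map_one, s0, s1, s2, s3, s4, s5] at T0
  exact A (by rw [← B, ← T0]; ring)

theorem st_frak {F : Type*} [Field F] [CharP F 2] (q : ℕ) (σ : F →+* F)
    (hσ : ∀ x, σ x = x ^ q) (h6 : ∀ x : F, x ^ (q ^ 6) = x) (d : F) (hd : d ∈ frakC q F) :
    d * d ^ (q ^ 2) * d ^ (q ^ 4) ≠ 1 ∧
      d + d ^ (q ^ 2) + d ^ (q ^ 4) ≠ d * d ^ (q ^ 2) * d ^ (q ^ 4) := by
  obtain ⟨h02, h1, h2, h345⟩ := hd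
  have hs : ∀ k, σ (d ^ (q ^ k)) = d ^ (q ^ (k + 1)) := by
    intro k
    rw [hσ, ← pow_mul, ← pow_succ]
  have s0 := hs 0
  rw [pow_zero, pow_one, zero_add, pow_one] at s0
  have s5 := hs 5
  rw [show 5 + 1 = 6 from rfl, h6] at s5
  have s1 := hs 1
  rw [pow_one] at s1
  have h3 : F3 q d ≠ 0 := fun h => h345 (by rw [h]; ring)
  have h5 : F5 q d ≠ 0 := fun h => h345 (by rw [h]; ring)
  simp only [F1, F2, F3, F5, pow_add, pow_mul', pow_one] at h1 h2 h3 h5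
  refine st_frak_alg σ d (d ^ q) (d ^ (q ^ 2)) (d ^ (q ^ 3)) (d ^ (q ^ 4)) (d ^ (q ^ 5))
    s0 s1 (hs 2) (hs 3) (hs 4) s5 ?_ ?_ h02 ?_ ?_
  · linear_combination h1
  · linear_combination h2
  · intro h; apply h3; linear_combination h
  · intro h; apply h5
    linear_combination (norm := (ring_nf; reduce_mod_char!)) h

/-- The code spanned by the identity and `f`. -/
def stE {F : Type*} [Field F] (f : F → F) : Set (F → F) :=
  {g | ∃ a b : F, g = fun x => a * x + b * f x}

/-- Linear independence of the first six iterates of `σ`. -/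
def stInd {F : Type*} [Field F] (σ : F →+* F) : Prop :=
  ∀ a0 a1 a2 a3 a4 a5 : F,
    (∀ x, a0 * x + a1 * σ x + a2 * σ (σ x) + a3 * σ (σ (σ x)) + a4 * σ (σ (σ (σ x)))
      + a5 * σ (σ (σ (σ (σ x)))) = 0) →
    a0 = 0 ∧ a1 = 0 ∧ a2 = 0 ∧ a3 = 0 ∧ a4 = 0 ∧ a5 = 0

theorem st_semi {F : Type*} [Field F] (f f' : F → F) (ρ : F ≃+* F) (g h : F → F)
    (gb : Function.Bijective g) (hb : Function.Bijective h)
    (ga : ∀ x y, g (x + y) = g x + g y)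
    (hD : stE f' = {p | ∃ p0 ∈ stE f, p = g ∘ ⇑ρ ∘ p0 ∘ ⇑ρ.symm ∘ h})
    (hf : ∀ β : F, (∀ b : F, ∃ α' β' : F, ∀ x, β * f' (b * x) = α' * x + β' * f' x) → β = 0) :
    ∃ τ : F ≃+* F, ∃ h' : F → F, Function.Bijective h' ∧ h' ∈ stE f' ∧
      (fun x => τ (f (τ.symm (h' x)))) ∈ stE f' := by
  have key : ∀ a : F, ∃ α : F, ∀ y, g (a * y) = α * g y := by
    intro a
    have cl : ∀ p ∈ stE f', ∃ r ∈ stE f', ∀ x y, g y = p x → r x = g (a * y) := by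
      intro p hp
      rw [hD] at hp
      obtain ⟨p0, ⟨u, v, rfl⟩, rfl⟩ := hp
      refine ⟨g ∘ ⇑ρ ∘ (fun x => (ρ.symm a * u) * x + (ρ.symm a * v) * f x) ∘ ⇑ρ.symm ∘ h,
        ?_, ?_⟩
      · rw [hD]
        exact ⟨_, ⟨_, _, rfl⟩, rfl⟩
      · intro x y hy
        have := gb.1 hy
        rw [this]
        simp only [Function.comp, map_add, map_mul, RingEquiv.apply_symm_apply]
        congr 1
        ring
    obtain ⟨r, ⟨α, β, rfl⟩, hr⟩ := cl (fun x => x) ⟨1, 0, by funext x; ring⟩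
    have hβ : β = 0 := by
      apply hf
      intro b
      obtain ⟨r', ⟨α', β', rfl⟩, hr'⟩ := cl (fun x => b * x) ⟨b, 0, by funext x; ring⟩
      refine ⟨α' - α * b, β', fun x => ?_⟩
      obtain ⟨y, hy⟩ := gb.2 (b * x)
      have e1 := hr (b * x) y hy
      have e2 := hr' x y hy
      simp only at e1 e2
      linear_combination e1 - e2
    refine ⟨α, fun y => ?_⟩
    have := hr (g y) y rfl
    rw [← this, hβ]
    ring
  have g0 : g 0 = 0 := by
    have := ga 0 0
    simpa using this
  have g1 : g 1 ≠ 0 := fun h => one_ne_zero (gb.1 (h.trans g0.symm))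
  have hmul : ∀ a b, g (a * b) * g 1 = g a * g b := by
    intro a b
    obtain ⟨α, hα⟩ := key a
    have := hα 1
    rw [mul_one] at this
    rw [hα b, this]
    ring
  let t : F →+* F :=
    { toFun := fun x => g x / g 1
      map_one' := div_self g1
      map_mul' := by
        intro x y
        field_simp
        exact hmul x y
      map_zero' := by simp [g0]
      map_add' := by intro x y; rw [ga]; ring }
  have tg : ∀ x, g x = g 1 * t x := by
    intro x
    change g x = g 1 * (g x / g 1)
    field_simp
  have tb : Function.Bijective t := by
    refine ⟨t.injective, fun y => ?_⟩
    obtain ⟨x, hx⟩ := gb.2 (g 1 * y)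
    refine ⟨x, ?_⟩
    rw [tg] at hx
    exact mul_left_cancel₀ g1 hx
  let τ0 : F ≃+* F := RingEquiv.ofBijective t tb
  have τg : ∀ x, g x = g 1 * τ0 x := tg
  refine ⟨ρ.trans τ0, fun x => τ0 (h x), τ0.bijective.comp hb, ?_, ?_⟩
  · have hm : (g ∘ ⇑ρ ∘ (fun x => x) ∘ ⇑ρ.symm ∘ h) ∈ stE f' := by
      rw [hD]
      exact ⟨_, ⟨1, 0, by funext x; ring⟩, rfl⟩
    obtain ⟨u, v, huv⟩ := hm
    refine ⟨u / g 1, v / g 1, ?_⟩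
    funext x
    have := congrFun huv x
    simp only [Function.comp, RingEquiv.apply_symm_apply] at this
    rw [τg] at this
    field_simp
    linear_combination this
  · have hm : (g ∘ ⇑ρ ∘ f ∘ ⇑ρ.symm ∘ h) ∈ stE f' := by
      rw [hD]
      exact ⟨_, ⟨0, 1, by funext x; ring⟩, rfl⟩
    obtain ⟨u, v, huv⟩ := hm
    refine ⟨u / g 1, v / g 1, ?_⟩
    funext x
    have := congrFun huv x
    simp only [Function.comp] at this
    rw [τg] at this
    simp only [RingEquiv.symm_trans_apply, RingEquiv.symm_apply_apply, RingEquiv.trans_apply]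
    field_simp
    linear_combination this

/-- The idealiser hypothesis for trinomials. -/
theorem st_ideal {F : Type*} [Field F] (σ : F →+* F) (ind : stInd σ) (k1 k5 : F)
    (hk : k1 = 1 ∨ k5 = 1) (β : F)
    (H : ∀ b : F, ∃ α' β' : F, ∀ x,
      β * (k1 * σ (b * x) + σ (σ (σ (b * x))) + k5 * σ (σ (σ (σ (σ (b * x)))))) =
      α' * x + β' * (k1 * σ x + σ (σ (σ x)) + k5 * σ (σ (σ (σ (σ x)))))) : β = 0 := by
  by_contra hβ
  have inv : ∀ b, σ (σ b) = b := by
    intro b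
    obtain ⟨α', β', h⟩ := H b
    obtain ⟨-, h1, -, h3, -, h5⟩ := ind (-α') (β * k1 * σ b - β' * k1) 0
      (β * σ (σ (σ b)) - β') 0 (β * k5 * σ (σ (σ (σ (σ b)))) - β' * k5) (by
        intro x
        have := h x
        simp only [map_mul] at this
        linear_combination this)
    rcases hk with rfl | rfl
    · have : β * (σ (σ (σ b))) = β * (σ b) := by linear_combination h3 - h1
      exact σ.injective (mul_left_cancel₀ hβ this)
    · have : β * (σ (σ (σ (σ (σ b))))) = β * (σ (σ (σ b))) := by linear_combination h5 - h3
      exact σ.injective (σ.injective (σ.injective (mul_left_cancel₀ hβ this)))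
  have := ind 1 0 (-1) 0 0 0 (by intro x; rw [inv]; ring)
  exact one_ne_zero this.1

theorem st_case1 {F : Type*} [Field F] [CharP F 2] (σ : F →+* F)
    (h6 : ∀ x, σ (σ (σ (σ (σ (σ x))))) = x) (ind : stInd σ) (c d a b C D : F)
    (hA : d * σ (σ d) * σ (σ (σ (σ d))) ≠ 1)
    (hB : d + σ (σ d) + σ (σ (σ (σ d))) ≠ d * σ (σ d) * σ (σ (σ (σ d))))
    (hab : ¬ (a = 0 ∧ b = 0))
    (H : ∀ x, σ (a * x + b * (σ x + σ (σ (σ x)) + d * σ (σ (σ (σ (σ x))))))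
      + σ (σ (σ (a * x + b * (σ x + σ (σ (σ x)) + d * σ (σ (σ (σ (σ x)))))))) 
      + c * σ (σ (σ (σ (σ (a * x + b * (σ x + σ (σ (σ x)) + d * σ (σ (σ (σ (σ x)))))))))) 
      = C * x + D * (σ x + σ (σ (σ x)) + d * σ (σ (σ (σ (σ x)))))) : c = d := by
  obtain ⟨-, h1, h2, h3, h4, h5⟩ := ind
    (σ b * σ d + σ (σ (σ b)) + c * σ (σ (σ (σ (σ b)))) - C)
    (σ a - D)
    (σ b + σ (σ (σ b)) * σ (σ (σ d)) + c * σ (σ (σ (σ (σ b)))))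
    (σ (σ (σ a)) - D)
    (σ b + σ (σ (σ b)) + c * σ (σ (σ (σ (σ b)))) * σ (σ (σ (σ (σ d)))))
    (c * σ (σ (σ (σ (σ a)))) - D * d) (by
      intro x
      have := H x
      simp only [map_add, map_mul, h6] at this
      linear_combination this)
  by_cases ha : a = 0
  · exfalso
    have hb : b ≠ 0 := fun h => hab ⟨ha, h⟩
    have E0 : σ b * (1 + σ (σ (σ (σ (σ d))))) =
        σ (σ (σ b)) * (1 + σ (σ (σ d)) * σ (σ (σ (σ (σ d))))) := by
      linear_combination (norm := (ring_nf; reduce_mod_char!))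
        (1 + σ (σ (σ (σ (σ d))))) * h2 + h2 + h4
    have E2 := congrArg (fun z => σ (σ z)) E0
    have E4 := congrArg (fun z => σ (σ (σ (σ z)))) E0
    simp only [map_add, map_mul, map_one, h6] at E2 E4
    have nb1 : σ b ≠ 0 := (map_ne_zero σ).2 hb
    have nb3 : σ (σ (σ b)) ≠ 0 := (map_ne_zero σ).2 ((map_ne_zero σ).2 nb1)
    have nb5 : σ (σ (σ (σ (σ b)))) ≠ 0 := (map_ne_zero σ).2 ((map_ne_zero σ).2 nb3)
    have nA : σ d * σ (σ (σ d)) * σ (σ (σ (σ (σ d)))) ≠ 1 := by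
      intro h
      rw [← map_mul, ← map_mul, ← map_one σ] at h
      exact hA (σ.injective h)
    have nB : σ d + σ (σ (σ d)) + σ (σ (σ (σ (σ d)))) ≠
        σ d * σ (σ (σ d)) * σ (σ (σ (σ (σ d)))) := by
      intro h
      rw [← map_mul, ← map_mul, ← map_add, ← map_add] at h
      exact hB (σ.injective h)
    clear H hA hB h1 h2 h3 h4 h5
    generalize σ (σ (σ (σ (σ d)))) = z at *
    generalize σ (σ (σ d)) = y at *
    generalize σ d = x at *
    have E : (1 + x) * (1 + y) * (1 + z) = (1 + x * y) * (1 + y * z) * (1 + z * x) := by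
      apply mul_left_cancel₀ (mul_ne_zero nb1 (mul_ne_zero nb3 nb5))
      generalize σ (σ (σ (σ (σ b)))) = B4 at *
      generalize σ (σ (σ b)) = B2 at *
      generalize σ b = B0 at *
      linear_combination B2 * (1 + x) * (B4 * (1 + y)) * E0
        + B2 * (1 + y * z) * (B4 * (1 + y)) * E2
        + B2 * (1 + y * z) * (B4 * (1 + z * x)) * E4
    have E' : (x * y * z - 1) * (x + y + z - x * y * z) = 0 := by
      linear_combination (norm := (ring_nf; reduce_mod_char!)) E
    rcases mul_eq_zero.1 E' with h | h
    · exact nA (sub_eq_zero.1 h)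
    · exact nB (sub_eq_zero.1 h)
  · have e1 : σ (σ (σ a)) = σ a := by linear_combination h3 - h1
    have e2 : σ (σ (σ (σ (σ a)))) = σ a := by rw [e1, e1]
    have na : σ a ≠ 0 := (map_ne_zero σ).2 ha
    apply mul_right_cancel₀ na
    rw [e2] at h5
    linear_combination h5 - d * h1

theorem st_case2 {F : Type*} [Field F] [CharP F 2] (σ : F →+* F)
    (h6 : ∀ x, σ (σ (σ (σ (σ (σ x))))) = x) (ind : stInd σ) (c d a b C D : F)
    (hA : d * σ (σ d) * σ (σ (σ (σ d))) ≠ 1)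
    (hab : ¬ (a = 0 ∧ b = 0))
    (H : ∀ x, σ (a * x + b * (σ (σ (σ (σ (σ x)))) + σ (σ (σ x)) + d * σ x))
      + σ (σ (σ (a * x + b * (σ (σ (σ (σ (σ x)))) + σ (σ (σ x)) + d * σ x)))) 
      + c * σ (σ (σ (σ (σ (a * x + b * (σ (σ (σ (σ (σ x)))) + σ (σ (σ x)) + d * σ x)))))) 
      = C * x + D * (σ (σ (σ (σ (σ x)))) + σ (σ (σ x)) + d * σ x)) :
    c * (σ (d + 1) * σ (σ (σ (d + 1)))) =
      (σ (σ (σ d)) * σ d + 1) * (σ (σ (σ (σ (σ d)))) + 1) := by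
  obtain ⟨-, h1, h2, h3, h4, h5⟩ := ind
    (σ b + σ (σ (σ b)) + c * σ (σ (σ (σ (σ b)))) * σ (σ (σ (σ (σ d)))) - C)
    (σ a - D * d)
    (σ b * σ d + σ (σ (σ b)) + c * σ (σ (σ (σ (σ b)))))
    (σ (σ (σ a)) - D)
    (σ b + σ (σ (σ b)) * σ (σ (σ d)) + c * σ (σ (σ (σ (σ b)))))
    (c * σ (σ (σ (σ (σ a)))) - D) (by
      intro x
      have := H x
      simp only [map_add, map_mul, h6] at this
      linear_combination this)
  by_cases ha : a = 0
  · have hb : b ≠ 0 := fun h => hab ⟨ha, h⟩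
    have E0 : σ b * (1 + σ d) = σ (σ (σ b)) * (1 + σ (σ (σ d))) := by
      linear_combination (norm := (ring_nf; reduce_mod_char!)) h2 + h4
    have E2 := congrArg (fun z => σ (σ z)) E0
    simp only [map_add, map_mul, map_one, h6] at E2
    have nb1 : σ b ≠ 0 := (map_ne_zero σ).2 hb
    have nd : 1 + d ≠ 0 := by
      intro h
      have h' : d = 1 := (CharTwo.add_eq_zero.1 h).symm
      apply hA
      rw [h']
      simp
    have nd1 : 1 + σ d ≠ 0 := by
      rw [← map_one σ, ← map_add]
      exact (map_ne_zero σ).2 nd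
    simp only [map_add, map_one]
    apply mul_left_cancel₀ (mul_ne_zero nb1 nd1)
    obtain ⟨k, hk⟩ : ∃ k, k = σ b * (1 + σ d) := ⟨_, rfl⟩
    have k0 := hk.symm
    have k2 := E0.symm.trans k0
    have k4 := E2.symm.trans k2
    rw [k0]
    clear hA hab H h1 h3 h5 E0 E2 nb1 nd nd1 hk hb
    generalize σ (σ (σ (σ (σ b)))) = B4 at *
    generalize σ (σ (σ (σ (σ d)))) = z at *
    generalize σ (σ (σ b)) = B2 at *
    generalize σ (σ (σ d)) = y at *
    generalize σ b = B0 at *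
    generalize σ d = x at *
    linear_combination (norm := (ring_nf; reduce_mod_char!))
      c * (1 + x) * (1 + y) * k4 + (1 + z) * (1 + x) * (1 + y) * h4
        + (1 + z) * (1 + y) * k0 + (1 + z) * y * (1 + x) * k2
  · exfalso
    have na : σ a ≠ 0 := (map_ne_zero σ).2 ha
    have na3 : σ (σ (σ a)) ≠ 0 := (map_ne_zero σ).2 ((map_ne_zero σ).2 na)
    have na5 : σ (σ (σ (σ (σ a)))) ≠ 0 := (map_ne_zero σ).2 ((map_ne_zero σ).2 na3)
    have e0 : σ a = σ (σ (σ a)) * d := by linear_combination h1 - d * h3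
    have e2 := congrArg (fun z => σ (σ z)) e0
    have e4 := congrArg (fun z => σ (σ (σ (σ z)))) e0
    simp only [map_mul, h6] at e2 e4
    apply hA
    apply mul_left_cancel₀ na
    generalize σ (σ (σ (σ d))) = z at *
    generalize σ (σ d) = y at *
    generalize σ (σ (σ (σ (σ a)))) = a5 at *
    generalize σ (σ (σ a)) = a3 at *
    generalize σ a = a1 at *
    rw [mul_one]
    linear_combination -e0 - d * e2 - d * y * e4

theorem st_inv {F : Type*} [Field F] [CharP F 2] (σ : F →+* F)
    (h6 : ∀ x, σ (σ (σ (σ (σ (σ x))))) = x) (c d : F)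
    (hA : d * σ (σ d) * σ (σ (σ (σ d))) ≠ 1)
    (hB : d + σ (σ d) + σ (σ (σ (σ d))) ≠ d * σ (σ d) * σ (σ (σ (σ d))))
    (hc : c * (σ (d + 1) * σ (σ (σ (d + 1)))) =
      (σ (σ (σ d)) * σ d + 1) * (σ (σ (σ (σ (σ d)))) + 1)) :
    d + 1 ≠ 0 ∧ ∃ C : F, C ≠ 0 ∧ ∀ x,
      σ ((d + 1)⁻¹ * (σ (σ (σ (σ (σ x)))) + σ (σ (σ x)) + d * σ x))
      + σ (σ (σ ((d + 1)⁻¹ * (σ (σ (σ (σ (σ x)))) + σ (σ (σ x)) + d * σ x)))) 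
      + c * σ (σ (σ (σ (σ ((d + 1)⁻¹ * (σ (σ (σ (σ (σ x)))) + σ (σ (σ x)) + d * σ x)))))) 
      = C * x := by
  have nd : d + 1 ≠ 0 := by
    intro h
    have h' : d = 1 := CharTwo.add_eq_zero.1 h
    apply hA
    rw [h']
    simp
  have n1 : σ d + 1 ≠ 0 := by
    rw [← map_one σ, ← map_add]
    exact (map_ne_zero σ).2 nd
  have n2 : σ (σ d) + 1 ≠ 0 := by
    rw [← map_one σ, ← map_add]
    exact (map_ne_zero σ).2 n1
  have n3 : σ (σ (σ d)) + 1 ≠ 0 := by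
    rw [← map_one σ, ← map_add]
    exact (map_ne_zero σ).2 n2
  have n4 : σ (σ (σ (σ d))) + 1 ≠ 0 := by
    rw [← map_one σ, ← map_add]
    exact (map_ne_zero σ).2 n3
  have n5 : σ (σ (σ (σ (σ d)))) + 1 ≠ 0 := by
    rw [← map_one σ, ← map_add]
    exact (map_ne_zero σ).2 n4
  have nB : σ d + σ (σ (σ d)) + σ (σ (σ (σ (σ d))))
      - σ d * σ (σ (σ d)) * σ (σ (σ (σ (σ d)))) ≠ 0 := by
    intro h
    have h := sub_eq_zero.1 h
    rw [← map_mul, ← map_mul, ← map_add, ← map_add] at h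
    exact hB (σ.injective h)
  simp only [map_add, map_one] at hc
  refine ⟨nd, (σ d + σ (σ (σ d)) + σ (σ (σ (σ (σ d))))
      - σ d * σ (σ (σ d)) * σ (σ (σ (σ (σ d))))) / ((σ d + 1) * (σ (σ (σ d)) + 1)),
      div_ne_zero nB (mul_ne_zero n1 n3), fun x => ?_⟩
  simp only [map_add, map_mul, map_inv₀, map_one, h6]
  have hc' : c = (σ (σ (σ d)) * σ d + 1) * (σ (σ (σ (σ (σ d)))) + 1) /
      ((σ d + 1) * (σ (σ (σ d)) + 1)) := by
    rw [eq_div_iff (mul_ne_zero n1 n3), hc]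
  rw [hc']
  clear hA hB hc hc' n2 n4 nB nd
  generalize σ (σ (σ (σ x))) = x4
  generalize σ (σ x) = x2
  generalize σ (σ (σ (σ (σ d)))) = z at *
  generalize σ (σ (σ d)) = y at *
  generalize σ d = w at *
  field_simp
  ring_nf
  reduce_mod_char!

theorem st_ind0 {F : Type*} [Field F] [Fintype F] (q : ℕ) (hq : 2 ≤ q)
    (hcard : Fintype.card F = q ^ 6) (a0 a1 a2 a3 a4 a5 : F)
    (h : ∀ x : F, a0 * x + a1 * x ^ q + a2 * x ^ (q ^ 2) + a3 * x ^ (q ^ 3) + a4 * x ^ (q ^ 4)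
      + a5 * x ^ (q ^ 5) = 0) :
    a0 = 0 ∧ a1 = 0 ∧ a2 = 0 ∧ a3 = 0 ∧ a4 = 0 ∧ a5 = 0 := by
  classical
  let p : Polynomial F := ∑ i : Fin 6, Polynomial.C (![a0, a1, a2, a3, a4, a5] i)
    * Polynomial.X ^ (q ^ (i : ℕ))
  have hdeg : p.natDegree < Fintype.card F := by
    refine lt_of_le_of_lt (b := q ^ 5) ?_ ?_
    · apply Polynomial.natDegree_sum_le_of_forall_le
      intro i _
      refine (Polynomial.natDegree_C_mul_X_pow_le _ _).trans ?_
      exact Nat.pow_le_pow_right (by omega) (by omega)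
    · rw [hcard]
      exact Nat.pow_lt_pow_right (by omega) (by omega)
  have hp : p = 0 := by
    refine Polynomial.eq_zero_of_natDegree_lt_card_of_eval_eq_zero p
      (f := fun x : F => x) (fun _ _ h => h) ?_ hdeg
    intro x
    have := h x
    simp only [p, Polynomial.eval_finsetSum, Polynomial.eval_mul, Polynomial.eval_C,
      Polynomial.eval_pow, Polynomial.eval_X, Fin.sum_univ_six]
    simpa using this
  have hinj : ∀ i j : Fin 6, q ^ (i : ℕ) = q ^ (j : ℕ) ↔ i = j := by
    intro i j
    rw [Nat.pow_right_inj (by omega)]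
    exact Fin.ext_iff.symm
  have hco : ∀ j : Fin 6, ![a0, a1, a2, a3, a4, a5] j = 0 := by
    intro j
    have : p.coeff (q ^ (j : ℕ)) = 0 := by rw [hp]; simp
    simp only [p, Polynomial.finsetSum_coeff, Polynomial.coeff_C_mul, Polynomial.coeff_X_pow,
      hinj] at this
    simpa using this
  exact ⟨hco 0, hco 1, hco 2, hco 3, hco 4, hco 5⟩

/-- The trinomial `σ + σ³ + c σ⁵`. -/
def stf {F : Type*} [Field F] (σ : F →+* F) (c : F) (x : F) : F :=
  σ x + σ (σ (σ x)) + c * σ (σ (σ (σ (σ x))))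

/-- The trinomial `σ⁵ + σ³ + c σ`. -/
def stf' {F : Type*} [Field F] (σ : F →+* F) (c : F) (x : F) : F :=
  σ (σ (σ (σ (σ x)))) + σ (σ (σ x)) + c * σ x

theorem st_conj {F : Type*} [Field F] (σ : F →+* F)
    (hcomm : ∀ (τ : F ≃+* F) (x : F), τ (σ x) = σ (τ x)) (τ : F ≃+* F) (c y : F) :
    τ (stf σ c (τ.symm y)) = stf σ (τ c) y := by
  simp only [stf, map_add, map_mul, hcomm, RingEquiv.apply_symm_apply]

theorem st_gen1 {F : Type*} [Field F] [CharP F 2] (q : ℕ) (σ : F →+* F)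
    (h6 : ∀ x, σ (σ (σ (σ (σ (σ x))))) = x) (ind : stInd σ)
    (hcomm : ∀ (τ : F ≃+* F) (x : F), τ (σ x) = σ (τ x)) (c d : F)
    (hA : d * σ (σ d) * σ (σ (σ (σ d))) ≠ 1)
    (hB : d + σ (σ d) + σ (σ (σ (σ d))) ≠ d * σ (σ d) * σ (σ (σ (σ d)))) :
    CodeEquiv q (stE (stf σ c)) (stE (stf σ d)) ↔ ∃ ρ : F ≃+* F, ρ c = d := by
  constructor
  · rintro ⟨ρ, g, h, gb, hb, ga, -, -, -, hD⟩
    obtain ⟨τ, h', hb', ⟨a, b, hab⟩, ⟨C, D, hCD⟩⟩ := st_semi _ _ ρ g h gb hb ga hD (by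
      intro β H
      refine st_ideal σ ind 1 d (Or.inl rfl) β (fun b => ?_)
      obtain ⟨α', β', hh⟩ := H b
      refine ⟨α', β', fun x => ?_⟩
      have := hh x
      simp only [stf] at this
      linear_combination this)
    refine ⟨τ, st_case1 σ h6 ind (τ c) d a b C D hA hB ?_ ?_⟩
    · rintro ⟨rfl, rfl⟩
      have : h' 0 = h' 1 := by rw [hab]; simp
      exact zero_ne_one (hb'.1 this)
    · intro x
      have := congrFun hCD x
      simp only [st_conj σ hcomm, hab] at this
      simp only [stf] at this
      exact this
  · rintro ⟨ρ, rfl⟩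
    refine ⟨ρ, id, id, Function.bijective_id, Function.bijective_id, by simp, by simp, by simp,
      by simp, ?_⟩
    ext p
    constructor
    · rintro ⟨a, b, rfl⟩
      refine ⟨_, ⟨ρ.symm a, ρ.symm b, rfl⟩, ?_⟩
      funext x
      simp [st_conj σ hcomm]
    · rintro ⟨_, ⟨a, b, rfl⟩, rfl⟩
      refine ⟨ρ a, ρ b, ?_⟩
      funext x
      simp [st_conj σ hcomm]

theorem st_gen2 {F : Type*} [Field F] [Finite F] [CharP F 2] (q : ℕ) (σ : F →+* F)
    (h6 : ∀ x, σ (σ (σ (σ (σ (σ x))))) = x) (ind : stInd σ)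
    (hcomm : ∀ (τ : F ≃+* F) (x : F), τ (σ x) = σ (τ x))
    (hfix : ∀ l, l ^ q = l → σ l = l) (c d : F)
    (hA : d * σ (σ d) * σ (σ (σ (σ d))) ≠ 1)
    (hB : d + σ (σ d) + σ (σ (σ (σ d))) ≠ d * σ (σ d) * σ (σ (σ (σ d)))) :
    CodeEquiv q (stE (stf σ c)) (stE (stf' σ d)) ↔ ∃ ρ : F ≃+* F,
      ρ c * (σ (d + 1) * σ (σ (σ (d + 1)))) =
        (σ (σ (σ d)) * σ d + 1) * (σ (σ (σ (σ (σ d)))) + 1) := by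
  constructor
  · rintro ⟨ρ, g, h, gb, hb, ga, -, -, -, hD⟩
    obtain ⟨τ, h', hb', ⟨a, b, hab⟩, ⟨C, D, hCD⟩⟩ := st_semi _ _ ρ g h gb hb ga hD (by
      intro β H
      refine st_ideal σ ind d 1 (Or.inr rfl) β (fun b => ?_)
      obtain ⟨α', β', hh⟩ := H b
      refine ⟨α', β', fun x => ?_⟩
      have := hh x
      simp only [stf'] at this
      linear_combination this)
    refine ⟨τ, st_case2 σ h6 ind (τ c) d a b C D hA ?_ ?_⟩
    · rintro ⟨rfl, rfl⟩
      have : h' 0 = h' 1 := by rw [hab]; simp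
      exact zero_ne_one (hb'.1 this)
    · intro x
      have := congrFun hCD x
      simp only [st_conj σ hcomm, hab] at this
      simp only [stf, stf'] at this
      exact this
  · rintro ⟨ρ, hρ⟩
    obtain ⟨nd, C, hC, H⟩ := st_inv σ h6 (ρ c) d hA hB hρ
    have H' : ∀ x, stf σ (ρ c) ((d + 1)⁻¹ * stf' σ d x) = C * x := H
    have hinj : Function.Injective (fun x => (d + 1)⁻¹ * stf' σ d x) := by
      intro x y hxy
      simp only at hxy
      apply mul_left_cancel₀ hC
      rw [← H', ← H', hxy]
    refine ⟨ρ, id, fun x => (d + 1)⁻¹ * stf' σ d x, Function.bijective_id,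
      Finite.injective_iff_bijective.1 hinj, by simp, by simp, ?_, ?_, ?_⟩
    · intro x y
      simp only [stf', map_add]
      ring
    · intro l x hl
      simp only [stf', map_mul, hfix l hl]
      ring
    have K : ∀ x, ρ (stf σ c (ρ.symm ((d + 1)⁻¹ * stf' σ d x))) = C * x := by
      intro x
      rw [st_conj σ hcomm, H']
    have K2 : ∀ a b x, ρ (a * (ρ.symm ((d + 1)⁻¹ * stf' σ d x)) +
        b * stf σ c (ρ.symm ((d + 1)⁻¹ * stf' σ d x))) =
        ρ a * ((d + 1)⁻¹ * stf' σ d x) + ρ b * (C * x) := by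
      intro a b x
      rw [map_add, map_mul ρ a, map_mul ρ b, K, RingEquiv.apply_symm_apply]
    ext p
    constructor
    · rintro ⟨a, b, rfl⟩
      refine ⟨_, ⟨ρ.symm (b * (d + 1)), ρ.symm (a / C), rfl⟩, ?_⟩
      funext x
      refine Eq.trans ?_ (K2 _ _ x).symm
      rw [RingEquiv.apply_symm_apply, RingEquiv.apply_symm_apply]
      field_simp
      ring
    · rintro ⟨_, ⟨a, b, rfl⟩, rfl⟩
      refine ⟨ρ b * C, ρ a * (d + 1)⁻¹, ?_⟩
      funext x
      refine (K2 _ _ x).trans ?_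
      ring


theorem statement14 :
    ∃ Q : ℕ, ∀ (e q : ℕ), 1 ≤ e → q = 2 ^ e → Q ≤ q →
      ∀ (F : Type) [Field F] [Fintype F], Fintype.card F = q ^ 6 →
        ∀ c₁ ∈ frakC q F, ∀ c₂ ∈ frakC q F, ∀ s ∈ ({1, 5} : Set ℕ), ∀ t ∈ ({1, 5} : Set ℕ),
          (CodeEquiv q (Dcode q c₁ s) (Dcode q c₂ t) ↔
            ∃ ρ : F ≃+* F,
              (s = t ∧ ρ c₁ = c₂) ∨
              (s + t = 6 ∧ ρ c₁ * (c₂ + 1) ^ (q ^ s + q ^ (3 * s)) =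
                (c₂ ^ (q ^ (3 * s) + q ^ s) + 1) * (c₂ ^ (q ^ (5 * s)) + 1))) := by
  refine ⟨0, ?_⟩
  intro e q he hq _ F _ _ hcard c _ d hd s hs t ht
  have hq2 : 2 ≤ q := by
    rw [hq]
    calc 2 = 2 ^ 1 := rfl
      _ ≤ 2 ^ e := Nat.pow_le_pow_right (by norm_num) he
  haveI : CharP F 2 := by
    haveI : Fact (Nat.Prime 2) := ⟨Nat.prime_two⟩
    refine charP_of_card_eq_prime_pow (p := 2) (f := e * 6) ?_
    rw [hcard, hq, pow_mul]
  have p6 : ∀ x : F, x ^ (q ^ 6) = x := by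
    intro x
    rw [← hcard]
    exact FiniteField.pow_card x
  have red : ∀ (n : ℕ) (x : F), x ^ (q ^ (n + 6)) = x ^ (q ^ n) := by
    intro n x
    rw [pow_add, pow_mul, p6]
  let φ : F →+* F := iterateFrobenius F 2 e
  have hφ : ∀ x, φ x = x ^ q := by
    intro x
    rw [hq]
    exact iterateFrobenius_def _ _ _
  obtain ⟨A, B⟩ := st_frak q φ hφ p6 d hd
  let σ : F →+* F := iterateFrobenius F 2 (e * s)
  have hσ : ∀ x, σ x = x ^ (q ^ s) := by
    intro x
    rw [hq, ← pow_mul]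
    exact iterateFrobenius_def _ _ _
  have it2 : ∀ x, σ (σ x) = x ^ (q ^ (2 * s)) := by
    intro x
    simp only [hσ, ← pow_mul, ← pow_add]
    congr 2; ring
  have it3 : ∀ x, σ (σ (σ x)) = x ^ (q ^ (3 * s)) := by
    intro x
    simp only [hσ, ← pow_mul, ← pow_add]
    congr 2; ring
  have it4 : ∀ x, σ (σ (σ (σ x))) = x ^ (q ^ (4 * s)) := by
    intro x
    simp only [hσ, ← pow_mul, ← pow_add]
    congr 2; ring
  have it5 : ∀ x, σ (σ (σ (σ (σ x)))) = x ^ (q ^ (5 * s)) := by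
    intro x
    simp only [hσ, ← pow_mul, ← pow_add]
    congr 2; ring
  have hcomm : ∀ (τ : F ≃+* F) (x : F), τ (σ x) = σ (τ x) := by
    intro τ x
    rw [hσ, hσ, map_pow]
  have hfix : ∀ l : F, l ^ q = l → σ l = l := by
    intro l hl
    rw [hσ]
    clear hσ it2 it3 it4 it5 hcomm hs
    induction s with
    | zero => simp
    | succ n ih => rw [pow_succ, pow_mul, ih, hl]
  have hs' : s = 1 ∨ s = 5 := hs
  have ht' : t = 1 ∨ t = 5 := ht
  have r10 := fun x => red 4 x
  have r15 := fun x => (red 9 x).trans (red 3 x)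
  have r20 := fun x => ((red 14 x).trans (red 8 x)).trans (red 2 x)
  have r25 := fun x => (((red 19 x).trans (red 13 x)).trans (red 7 x)).trans (red 1 x)
  have r30 := fun x => ((((red 24 x).trans (red 18 x)).trans (red 12 x)).trans (red 6 x)).trans
    (red 0 x)
  norm_num at r10 r15 r20 r25 r30
  have h6 : ∀ x, σ (σ (σ (σ (σ (σ x))))) = x := by
    intro x
    rw [it5, hσ, ← pow_mul, ← pow_add]
    rcases hs' with rfl | rfl
    · exact p6 x
    · exact r30 x
  have ind : stInd σ := by
    intro a0 a1 a2 a3 a4 a5 h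
    simp only [hσ, ← pow_mul, ← pow_add] at h
    rcases hs' with rfl | rfl
    · norm_num at h
      exact st_ind0 q hq2 hcard a0 a1 a2 a3 a4 a5 h
    · norm_num at h
      simp only [r10, r15, r20, r25] at h
      have := st_ind0 q hq2 hcard a0 a5 a4 a3 a2 a1 (by
        intro x
        have := h x
        linear_combination this)
      tauto
  have AB : d * σ (σ d) * σ (σ (σ (σ d))) ≠ 1 ∧
      d + σ (σ d) + σ (σ (σ (σ d))) ≠ d * σ (σ d) * σ (σ (σ (σ d))) := by
    rw [it4, it2]
    rcases hs' with rfl | rfl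
    · exact ⟨A, B⟩
    · norm_num
      rw [r10, r20]
      constructor
      · intro h; apply A; linear_combination h
      · intro h; apply B; linear_combination h
  have D1 : ∀ c : F, Dcode q c s = stE (stf σ c) := by
    intro c
    have : stf σ c = fun x => (x ^ (q ^ s) + x ^ (q ^ (3 * s)) + c * x ^ (q ^ (5 * s))) := by
      funext x
      rw [stf, it5, it3, hσ]
    rw [this]
    rfl
  by_cases hst : s = t
  · subst hst
    have h66 : s + s ≠ 6 := by omega
    rw [D1, D1, st_gen1 q σ h6 ind hcomm c d AB.1 AB.2]
    simp [h66]
  · have h66 : s + t = 6 := by omega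
    have D2 : Dcode q d t = stE (stf' σ d) := by
      have : stf' σ d = fun x => (x ^ (q ^ t) + x ^ (q ^ (3 * t)) + d * x ^ (q ^ (5 * t))) := by
        funext x
        rw [stf', it5, it3, hσ]
        rcases hs' with rfl | rfl
        · obtain rfl : t = 5 := by omega
          norm_num
          rw [r15, r25]
        · obtain rfl : t = 1 := by omega
          norm_num
          rw [r15, r25]
      rw [this]
      rfl
    rw [D1, D2, st_gen2 q σ h6 ind hcomm hfix c d AB.1 AB.2]
    simp only [hst, h66, false_and, true_and, false_or, pow_add]
    rw [it5 d, it3 d, it3 (d + 1), hσ d, hσ (d + 1)]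
end
end
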